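/- arXiv:1410.1380 — 5 statements merged into one kernel-verified Lean document; each statement's English description precedes it below -/
import Mathlib

section
/- For every real constant K > 0 there exists a group 𝔾 equipped with a bi-invariant metric d bounded by K such that (𝔾, d) is a complete separable metric space, and for every separable group H equipped with a bi-invariant metric bounded by K there exists an isometric group monomorphism from H into 𝔾. -/
/-- The metric of the metric space `G` is bi-invariant with respect to the group structure. -/
def BiInvariantDist (G : Type*) [Group G] [MetricSpace G] : Prop :=
  ∀ g x y : G, dist (g * x) (g * y) = dist x y ∧ dist (x * g) (y * g) = dist x y

section

/-- Bounded conjugation-invariant (pseudo-)norms on a group. -/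
structure IsNrm {G : Type*} [Group G] (K : ℝ) (p : G → ℝ) : Prop where
  one : p 1 = 0
  inv : ∀ x, p x⁻¹ = p x
  mul : ∀ x y, p (x * y) ≤ p x + p y
  conj : ∀ x y, p (y * x * y⁻¹) = p x
  nonneg : ∀ x, 0 ≤ p x
  le : ∀ x, p x ≤ K

/-- Length functions on a group. -/
structure IsLen {G : Type*} [Group G] (p : G → ℝ) : Prop where
  one : p 1 = 0
  inv : ∀ x, p x⁻¹ = p x
  mul : ∀ x y, p (x * y) ≤ p x + p y
  nonneg : ∀ x, 0 ≤ p x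

theorem IsNrm.comm {G : Type*} [Group G] {K : ℝ} {p : G → ℝ} (h : IsNrm K p) (x y : G) :
    p (x * y) = p (y * x) := by
  have := h.conj (x * y) y
  rw [← this]; congr 1; group

theorem IsNrm.comap {G H : Type*} [Group G] [Group H] {K : ℝ} {p : G → ℝ} (h : IsNrm K p)
    (f : H →* G) : IsNrm K (fun x => p (f x)) where
  one := by simp [h.one]
  inv x := by simp [h.inv]
  mul x y := by simpa using h.mul _ _
  conj x y := by simpa using h.conj _ _
  nonneg x := h.nonneg _
  le x := h.le _

section amalg
variable {A F : Type*} [Group A] [Group F]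

inductive Stp (φ : F →* A) (p : A → ℝ) (ν ℓ : F → ℝ) :
    A → List (F × A) → A → List (F × A) → ℝ → Prop
  | m1 (a f b l s) : Stp φ p ν ℓ a ((f, b) :: l) (a * φ s * b) l (ν (f * s⁻¹) + ℓ s)
  | m2 (a f b g d l s) : Stp φ p ν ℓ a ((f, b) :: (g, d) :: l) a ((f * s * g, d) :: l)
      (p (b * (φ s)⁻¹) + ℓ s)
  | tail (a f b l b' l' c) : Stp φ p ν ℓ b l b' l' c →
      Stp φ p ν ℓ a ((f, b) :: l) a ((f, b') :: l') c

inductive Rl (φ : F →* A) (p : A → ℝ) (ν ℓ : F → ℝ) :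
    A → List (F × A) → A → List (F × A) → ℝ → Prop
  | c1 (a f f' b l) : Rl φ p ν ℓ a ((f, b) :: l) a ((f', b) :: l) (ν (f * f'⁻¹))
  | c2 (a a' l) : Rl φ p ν ℓ a l a' l (p (a * a'⁻¹))
  | c3 (a s f b l) : Rl φ p ν ℓ a ((s * f, b) :: l) (a * φ s) ((f, b) :: l) (ℓ s)
  | c3r (a f s b l) : Rl φ p ν ℓ a ((f * s, b) :: l) a ((f, φ s * b) :: l) (ℓ s)
  | c4a (a f g b l) : Rl φ p ν ℓ a ((f * g, b) :: l) a ((f, 1) :: (g, b) :: l) 0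
  | c4b (a b l) : Rl φ p ν ℓ (a * b) l a ((1, b) :: l) 0
  | tail (a f b l b' l' c) : Rl φ p ν ℓ b l b' l' c →
      Rl φ p ν ℓ a ((f, b) :: l) a ((f, b') :: l') c

inductive RlS (φ : F →* A) (p : A → ℝ) (ν ℓ : F → ℝ) :
    A → List (F × A) → A → List (F × A) → ℝ → Prop
  | refl (a l t) : 0 ≤ t → RlS φ p ν ℓ a l a l t
  | head (a l a1 l1 a' l' d t' t) : Rl φ p ν ℓ a l a1 l1 d → RlS φ p ν ℓ a1 l1 a' l' t' →
      d + t' ≤ t → RlS φ p ν ℓ a l a' l' t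

inductive Der (φ : F →* A) (p : A → ℝ) (ν ℓ : F → ℝ) :
    ℕ → A → List (F × A) → ℝ → Prop
  | nil (n a c) : p a ≤ c → Der φ p ν ℓ n a [] c
  | step (n a l a' l' c d t) : Stp φ p ν ℓ a l a' l' c → Der φ p ν ℓ n a' l' d → c + d ≤ t →
      Der φ p ν ℓ (n + 1) a l t

def Sim (φ : F →* A) (p : A → ℝ) (ν ℓ : F → ℝ) (a : A) (l : List (F × A))
    (a' : A) (l' : List (F × A)) (t : ℝ) : Prop :=
  RlS φ p ν ℓ a l a' l' t ∨
    ∃ x m c d, Stp φ p ν ℓ a l x m c ∧ RlS φ p ν ℓ x m a' l' d ∧ c + d ≤ t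

variable {φ : F →* A} {p : A → ℝ} {ν ℓ : F → ℝ}

theorem Stp.lmul {a a' : A} {l l' c} (h : Stp φ p ν ℓ a l a' l' c) (x : A) :
    Stp φ p ν ℓ (x * a) l (x * a') l' c := by
  cases h with
  | m1 a f b l s =>
    have := Stp.m1 (φ := φ) (p := p) (ν := ν) (ℓ := ℓ) (x * a) f b l' s
    simpa only [mul_assoc] using this
  | m2 => exact Stp.m2 ..
  | tail _ _ _ _ _ _ _ h => exact Stp.tail _ _ _ _ _ _ _ h

theorem Rl.one {a a' : A} {l l' c} (h : Rl φ p ν ℓ a l a' l' c) {t : ℝ} (ht : c ≤ t) :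
    RlS φ p ν ℓ a l a' l' t := .head _ _ _ _ _ _ _ 0 _ h (.refl _ _ _ le_rfl) (by linarith)

theorem Rl.two {a a' a1 : A} {l l' l1 c c'} (h : Rl φ p ν ℓ a l a1 l1 c)
    (h' : Rl φ p ν ℓ a1 l1 a' l' c') {t : ℝ} (ht : c + c' ≤ t) :
    RlS φ p ν ℓ a l a' l' t := .head _ _ _ _ _ _ _ c' _ h (h'.one le_rfl) ht

theorem RlS.tail {b b' : A} {l l' c} (h : RlS φ p ν ℓ b l b' l' c) (a : A) (f : F) :
    RlS φ p ν ℓ a ((f, b) :: l) a ((f, b') :: l') c := by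
  induction h with
  | refl a l t h => exact .refl _ _ _ h
  | head _ _ _ _ _ _ _ _ _ h _ h3 ih => exact .head _ _ _ _ _ _ _ _ _ (.tail _ _ _ _ _ _ _ h) ih h3

theorem Rl.lmul {K : ℝ} (hp : IsNrm K p) {a a' : A} {l l' c} (h : Rl φ p ν ℓ a l a' l' c) (x : A) :
    Rl φ p ν ℓ (x * a) l (x * a') l' c := by
  cases h with
  | c1 a f f' b l => exact .c1 ..
  | c2 a a' l =>
    have := Rl.c2 (φ := φ) (p := p) (ν := ν) (ℓ := ℓ) (x * a) (x * a') l
    rw [← hp.conj _ x]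
    simpa [mul_assoc] using this
  | c3 a s f b l => rw [← mul_assoc]; exact .c3 ..
  | c3r a f s b l => exact .c3r ..
  | c4a a f g b l => exact .c4a ..
  | c4b a b l => rw [← mul_assoc]; exact .c4b ..
  | tail _ _ _ _ _ _ _ h => exact .tail _ _ _ _ _ _ _ h

theorem Rl.nonneg {K : ℝ} (hp : IsNrm K p) (hν : IsNrm K ν) (hℓ : IsLen ℓ)
    {a a' : A} {l l' c} (h : Rl φ p ν ℓ a l a' l' c) : 0 ≤ c := by
  induction h with
  | c1 => exact hν.nonneg _
  | c2 => exact hp.nonneg _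
  | c3 => exact hℓ.nonneg _
  | c3r => exact hℓ.nonneg _
  | c4a => exact le_rfl
  | c4b => exact le_rfl
  | tail _ _ _ _ _ _ _ _ ih => exact ih

theorem Rl.c3' (hℓ : IsLen ℓ) (a : A) (s f : F) (b : A) (l) :
    Rl φ p ν ℓ (a * φ s) ((f, b) :: l) a ((s * f, b) :: l) (ℓ s) := by
  have := Rl.c3 (φ := φ) (p := p) (ν := ν) (ℓ := ℓ) (a * φ s) s⁻¹ (s * f) b l
  simpa [hℓ.inv] using this

theorem Rl.c3r' (hℓ : IsLen ℓ) (a : A) (f s : F) (b : A) (l) :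
    Rl φ p ν ℓ a ((f, φ s * b) :: l) a ((f * s, b) :: l) (ℓ s) := by
  have := Rl.c3r (φ := φ) (p := p) (ν := ν) (ℓ := ℓ) a (f * s) s⁻¹ (φ s * b) l
  simpa [hℓ.inv] using this

theorem Rl.c1' {f f' : F} {c : ℝ} (h : ν (f * f'⁻¹) = c) (a : A) (b : A) (l) :
    Rl φ p ν ℓ a ((f, b) :: l) a ((f', b) :: l) c := h ▸ .c1 ..

theorem Rl.c2' {a a' : A} {c : ℝ} (h : p (a * a'⁻¹) = c) (l) :
    Rl φ p ν ℓ a l a' l c := h ▸ .c2 ..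

theorem sim {K : ℝ} (hp : IsNrm K p) (hν : IsNrm K ν) (hℓ : IsLen ℓ)
    (h1 : ∀ s, p (φ s) ≤ ν s + ℓ s) (h2 : ∀ s, ν s ≤ p (φ s) + ℓ s)
    {a a' : A} {l l' δ} (h : Rl φ p ν ℓ a l a' l' δ) :
    ∀ {a'' l'' c}, Stp φ p ν ℓ a' l' a'' l'' c → Sim φ p ν ℓ a l a'' l'' (δ + c) := by
  have tp : ∀ x y z : A, p (x * z⁻¹) ≤ p (x * y⁻¹) + p (y * z⁻¹) := fun x y z => by
    have := hp.mul (x * y⁻¹) (y * z⁻¹); simpa [mul_assoc] using this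
  have tν : ∀ x y z : F, ν (x * z⁻¹) ≤ ν (x * y⁻¹) + ν (y * z⁻¹) := fun x y z => by
    have := hν.mul (x * y⁻¹) (y * z⁻¹); simpa [mul_assoc] using this
  induction h with
  | c1 a f f' b l =>
    intro a'' l'' c st
    cases st with
    | m1 _ _ _ _ s =>
      exact .inr ⟨_, _, _, 0, .m1 _ _ _ _ s, .refl _ _ _ le_rfl, by linarith [tν f f' s]⟩
    | m2 _ _ _ g d l s =>
      refine .inr ⟨_, _, _, _, .m2 _ _ _ _ _ _ s, (Rl.c1' ?_ _ _ _).one le_rfl, (add_comm _ _).le⟩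
      congr 1; group
    | tail _ _ _ _ b' l' c st =>
      exact .inr ⟨_, _, _, _, .tail _ _ _ _ _ _ _ st, (Rl.c1 ..).one le_rfl, (add_comm _ _).le⟩
  | c2 a a' l =>
    intro a'' l'' c st
    cases st with
    | m1 _ _ _ _ s =>
      refine .inr ⟨_, _, _, _, .m1 _ _ _ _ s, (Rl.c2' ?_ _).one le_rfl, (add_comm _ _).le⟩
      congr 1; group
    | m2 _ _ _ g d l s =>
      exact .inr ⟨_, _, _, _, .m2 _ _ _ _ _ _ s, (Rl.c2 ..).one le_rfl, (add_comm _ _).le⟩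
    | tail _ _ _ _ b' l' c st =>
      exact .inr ⟨_, _, _, _, .tail _ _ _ _ _ _ _ st, (Rl.c2 ..).one le_rfl, (add_comm _ _).le⟩
  | c3 a s f b l =>
    intro a'' l'' c st
    cases st with
    | m1 _ _ _ _ t =>
      refine .inr ⟨_, _, _, 0, .m1 _ _ _ _ (s * t), ?_, ?_⟩
      · rw [map_mul, ← mul_assoc]; exact .refl _ _ _ le_rfl
      · have : ν (s * f * (s * t)⁻¹) = ν (f * t⁻¹) := by
          rw [← hν.conj (f * t⁻¹) s]; congr 1; group
        linarith [hℓ.mul s t]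
    | m2 _ _ _ g d l t =>
      refine .inr ⟨_, _, _, _, .m2 _ _ _ _ _ _ t, Rl.one (c := ℓ s) ?_ le_rfl, (add_comm _ _).le⟩
      rw [mul_assoc, mul_assoc, ← mul_assoc f]; exact .c3 ..
    | tail _ _ _ _ b' l' c st =>
      exact .inr ⟨_, _, _, _, .tail _ _ _ _ _ _ _ st, (Rl.c3 ..).one le_rfl, (add_comm _ _).le⟩
  | c3r a f s b l =>
    intro a'' l'' c st
    cases st with
    | m1 _ _ _ _ t =>
      refine .inr ⟨_, _, _, 0, .m1 _ _ _ _ (t * s), ?_, ?_⟩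
      · rw [map_mul, ← mul_assoc, ← mul_assoc]; exact .refl _ _ _ le_rfl
      · have : ν (f * s * (t * s)⁻¹) = ν (f * t⁻¹) := by congr 1; group
        linarith [hℓ.mul t s]
    | m2 _ _ _ g d l t =>
      refine .inr ⟨_, _, _, 0, .m2 _ _ _ _ _ _ (s⁻¹ * t), ?_, ?_⟩
      · have : f * s * (s⁻¹ * t) * g = f * t * g := by group
        rw [this]; exact .refl _ _ _ le_rfl
      · have : p (b * (φ (s⁻¹ * t))⁻¹) = p (φ s * b * (φ t)⁻¹) := by
          rw [← hp.conj _ (φ s)]; congr 1; simp [mul_assoc]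
        linarith [hℓ.mul s⁻¹ t, hℓ.inv s]
    | tail _ _ _ _ b' l' c st =>
      have st' := st.lmul (φ s)⁻¹
      rw [inv_mul_cancel_left] at st'
      refine .inr ⟨_, _, _, _, .tail _ _ _ _ _ _ _ st', Rl.one (c := ℓ s) ?_ le_rfl, (add_comm _ _).le⟩
      have := Rl.c3r (φ := φ) (p := p) (ν := ν) (ℓ := ℓ) a f s ((φ s)⁻¹ * b') l'
      rwa [mul_inv_cancel_left] at this
  | c4a a f g b l =>
    intro a'' l'' c st
    cases st with
    | m1 _ _ _ _ s =>
      refine .inl (Rl.two (a1 := a) (l1 := (s * g, b) :: l) (c := ν (f * s⁻¹)) (c' := ℓ s)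
        (Rl.c1' ?_ _ _ _) ?_ (zero_add _).ge)
      · congr 1; group
      · rw [mul_one]; exact .c3 ..
    | m2 _ _ _ g d l s =>
      refine .inl (Rl.one (c := ν s) (Rl.c1' ?_ _ _ _) ?_)
      · rw [← hν.inv s, ← hν.conj s⁻¹ f]; congr 1; group
      · rw [one_mul, hp.inv]; linarith [h2 s]
    | tail _ _ _ _ b' l' c st =>
      cases st with
      | m1 _ _ _ _ t =>
        refine .inl (Rl.two (a1 := a) (l1 := (f * t, b) :: l) (c := ν (g * t⁻¹)) (c' := ℓ t)
          (Rl.c1' ?_ _ _ _) ?_ (zero_add _).ge)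
        · rw [← hν.conj (g * t⁻¹) f]; congr 1; group
        · rw [one_mul]; exact .c3r ..
      | m2 _ _ _ g' d l t =>
        refine .inr ⟨_, _, _, _, .m2 _ _ _ _ _ _ t, Rl.one (c := 0) ?_ le_rfl, (add_comm _ _).le⟩
        have : f * g * t * g' = f * (g * t * g') := by group
        rw [this]; exact .c4a ..
      | tail _ _ _ _ b' l' c st =>
        exact .inr ⟨_, _, _, _, .tail _ _ _ _ _ _ _ st, (Rl.c4a ..).one le_rfl, (add_comm _ _).le⟩
  | c4b a b l =>
    intro a'' l'' c st
    cases st with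
    | m1 _ _ _ _ s =>
      refine .inl (Rl.one (c := p (φ s)) (Rl.c2' ?_ _) ?_)
      · rw [← hp.inv (φ s), ← hp.conj (φ s)⁻¹ a]; congr 1; group
      · rw [one_mul, hν.inv]; linarith [h1 s]
    | m2 _ _ _ g d l s =>
      refine .inl (Rl.two (a1 := a * φ s) (l1 := (g, d) :: l) (c := p (b * (φ s)⁻¹)) (c' := ℓ s)
        (Rl.c2' ?_ _) ?_ (zero_add _).ge)
      · rw [← hp.conj (b * (φ s)⁻¹) a]; congr 1; group
      · rw [one_mul]; exact .c3' hℓ ..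
    | tail _ _ _ _ b' l' c st =>
      exact .inr ⟨_, _, _, _, st.lmul a, (Rl.c4b ..).one le_rfl, (add_comm _ _).le⟩
  | tail a f b0 l0 b l δ h ih =>
    intro a'' l'' c st
    cases st with
    | m1 _ _ _ _ s =>
      exact .inr ⟨_, _, _, _, .m1 _ _ _ _ s, (h.lmul hp _).one le_rfl, (add_comm _ _).le⟩
    | tail _ _ _ _ b' l' c st =>
      rcases ih st with h | ⟨x, m, c', d, h, h', h''⟩
      · exact .inl (h.tail _ _)
      · exact .inr ⟨_, _, _, _, .tail _ _ _ _ _ _ _ h, h'.tail _ _, h''⟩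
    | m2 _ _ _ g d l s =>
      cases h with
      | c1 _ g0 _ _ _ =>
        refine .inr ⟨_, _, _, _, .m2 _ _ _ _ _ _ s, (Rl.c1' ?_ _ _ _).one le_rfl, (add_comm _ _).le⟩
        rw [← hν.conj (g0 * g⁻¹) (f * s)]; congr 1; group
      | c2 _ _ _ =>
        exact .inr ⟨_, _, _, 0, .m2 _ _ _ _ _ _ s, .refl _ _ _ le_rfl, by linarith [tp b0 b (φ s)]⟩
      | c3 _ t _ _ _ =>
        refine .inr ⟨_, _, _, 0, .m2 _ _ _ _ _ _ (s * t⁻¹), ?_, ?_⟩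
        · have : f * (s * t⁻¹) * (t * g) = f * s * g := by group
          rw [this]; exact .refl _ _ _ le_rfl
        · have : p (b0 * (φ (s * t⁻¹))⁻¹) = p (b0 * φ t * (φ s)⁻¹) := by
            congr 1; simp [mul_assoc]
          linarith [hℓ.mul s t⁻¹, hℓ.inv t]
      | c3r _ _ t d0 _ =>
        refine .inr ⟨_, _, _, _, .m2 _ _ _ _ _ _ s, Rl.one (c := ℓ t) ?_ le_rfl, (add_comm _ _).le⟩
        rw [← mul_assoc]; exact .c3r ..
      | c4a _ _ g2 d0 l2 =>
        refine .inr ⟨_, _, _, _, .m2 _ _ _ _ _ _ s, Rl.one (c := 0) ?_ le_rfl, (add_comm _ _).le⟩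
        rw [← mul_assoc]; exact .c4a ..
      | c4b _ _ _ =>
        refine .inl (Rl.two (a1 := a) (l1 := (f, φ s * d) :: l0) (c := p (b * (φ s)⁻¹)) (c' := ℓ s)
          (.tail _ _ _ _ _ _ _ (Rl.c2' ?_ _)) ?_ (zero_add _).ge)
        · congr 1; group
        · rw [mul_one]; exact .c3r' hℓ ..
      | tail _ _ d0 l00 _ _ _ h =>
        exact .inr ⟨_, _, _, _, .m2 _ _ _ _ _ _ s, (Rl.tail _ _ _ _ _ _ _ h).one le_rfl,
          (add_comm _ _).le⟩

theorem Der.mono {n : ℕ} {a : A} {l c} (h : Der φ p ν ℓ n a l c) :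
    ∀ {m : ℕ} {c' : ℝ}, n ≤ m → c ≤ c' → Der φ p ν ℓ m a l c' := by
  induction h with
  | nil n a c h => intro m c' _ h'; exact .nil _ _ _ (h.trans h')
  | step n a l a' l' c d t h1 h2 h3 ih =>
    intro m c' hm h'
    obtain ⟨m, rfl⟩ : ∃ k, m = k + 1 := ⟨m - 1, by omega⟩
    exact .step _ _ _ _ _ _ _ _ h1 (ih (by omega : n ≤ m) le_rfl) (h3.trans h')

theorem Der.rl {K : ℝ} (hp : IsNrm K p) (hν : IsNrm K ν) (hℓ : IsLen ℓ)
    (h1 : ∀ s, p (φ s) ≤ ν s + ℓ s) (h2 : ∀ s, ν s ≤ p (φ s) + ℓ s) (n : ℕ) :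
    ∀ {a a' : A} {l l' δ c}, Rl φ p ν ℓ a l a' l' δ → Der φ p ν ℓ n a' l' c →
      Der φ p ν ℓ n a l (δ + c) := by
  have key : ∀ {a a' : A} {l c δ}, Rl φ p ν ℓ a l a' [] δ → p a' ≤ c → ∀ n,
      Der φ p ν ℓ n a l (δ + c) := by
    intro a a' l c δ h hc n
    cases h
    refine .nil _ _ _ ?_
    have := hp.mul (a * a'⁻¹) a'
    rw [inv_mul_cancel_right] at this
    linarith
  induction n with
  | zero =>
    intro a a' l l' δ c h hd
    cases hd with
    | nil _ _ _ hd => exact key h hd _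
  | succ n ih =>
    intro a a' l l' δ c h hd
    cases hd with
    | nil _ _ _ hd => exact key h hd _
    | step _ _ _ a2 l2 c1 d _ hs hd hc =>
      have ih' : ∀ {a a' : A} {l l' δ}, RlS φ p ν ℓ a l a' l' δ → ∀ {c}, Der φ p ν ℓ n a' l' c →
          Der φ p ν ℓ n a l (δ + c) := by
        intro a a' l l' δ h
        induction h with
        | refl a l t h => intro c hd; exact hd.mono le_rfl (by linarith)
        | head _ _ _ _ _ _ _ _ _ h _ h3 ih2 =>
          intro c hd
          exact (ih h (ih2 hd)).mono le_rfl (by linarith)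
      rcases sim hp hν hℓ h1 h2 h hs with h | ⟨x, m, c', d', h, h', h''⟩
      · exact (ih' h hd).mono (by omega) (by linarith)
      · exact .step _ _ _ _ _ _ _ _ h (ih' h' hd) (by linarith)

end amalg

end

section

section amalg2
variable {A F : Type*} [Group A] [Group F]

theorem nrm_of_fun {G : Type*} [Group G] {K : ℝ} {R : G → ℝ} (R0 : ∀ g, 0 ≤ R g)
    (RK : ∀ g, R g ≤ K) : ∃ N : G → ℝ, IsNrm K N ∧
      (∀ g h h', |R (h * g * h') - R (h * h')| ≤ N g) ∧
      (∀ g c, (∀ h h', |R (h * g * h') - R (h * h')| ≤ c) → N g ≤ c) := by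
  have bd : ∀ x y, |R x - R y| ≤ K := fun x y => by
    rw [abs_le]; constructor <;> linarith [R0 x, RK x, R0 y, RK y]
  let N : G → ℝ := fun g => ⨆ h : G × G, |R (h.1 * g * h.2) - R (h.1 * h.2)|
  have lo : ∀ g h h', |R (h * g * h') - R (h * h')| ≤ N g := fun g h h' =>
    le_ciSup (f := fun h : G × G => |R (h.1 * g * h.2) - R (h.1 * h.2)|)
      ⟨K, by rintro _ ⟨h, rfl⟩; exact bd _ _⟩ (h, h')
  have up : ∀ g c, (∀ h h', |R (h * g * h') - R (h * h')| ≤ c) → N g ≤ c := fun g c hh =>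
    ciSup_le fun h => hh _ _
  have cj : ∀ x y, N (y * x * y⁻¹) ≤ N x := fun x y => up _ _ fun h h' => by
    have := lo x (h * y) (y⁻¹ * h')
    simpa [mul_assoc] using this
  have iv : ∀ x, N x⁻¹ ≤ N x := fun x => up _ _ fun h h' => by
    have := lo x (h * x⁻¹) h'
    rw [abs_sub_comm]
    simpa [mul_assoc] using this
  have nn : ∀ x, 0 ≤ N x := fun x => (abs_nonneg _).trans (lo x 1 1)
  refine ⟨N, ⟨?_, ?_, ?_, ?_, nn, fun x => up _ _ fun _ _ => bd _ _⟩, lo, up⟩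
  · exact le_antisymm (up _ _ fun h h' => by simp) (nn _)
  · exact fun x => le_antisymm (iv x) (by simpa using iv x⁻¹)
  · refine fun x y => up _ _ fun h h' => ?_
    have e1 := lo x h (y * h')
    have e2 := lo y h h'
    have := abs_sub_le (R (h * x * (y * h'))) (R (h * (y * h'))) (R (h * h'))
    simp only [mul_assoc] at *
    linarith
  · refine fun x y => le_antisymm (cj x y) ?_
    have := cj (y * x * y⁻¹) y⁻¹
    simpa [mul_assoc] using this

theorem Stp.nonneg {φ : F →* A} {p : A → ℝ} {ν ℓ : F → ℝ} {K : ℝ} (hp : IsNrm K p)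
    (hν : IsNrm K ν) (hℓ : IsLen ℓ)
    {a a' : A} {l l' c} (h : Stp φ p ν ℓ a l a' l' c) : 0 ≤ c := by
  induction h with
  | m1 => exact add_nonneg (hν.nonneg _) (hℓ.nonneg _)
  | m2 => exact add_nonneg (hp.nonneg _) (hℓ.nonneg _)
  | tail _ _ _ _ _ _ _ _ ih => exact ih

theorem Der.nonneg {φ : F →* A} {p : A → ℝ} {ν ℓ : F → ℝ} {K : ℝ} (hp : IsNrm K p)
    (hν : IsNrm K ν) (hℓ : IsLen ℓ) {n : ℕ}
    {a : A} {l c} (h : Der φ p ν ℓ n a l c) : 0 ≤ c := by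
  induction h with
  | nil n a c h => exact (hp.nonneg _).trans h
  | step n a l a' l' c d t h1 h2 h3 ih => linarith [h1.nonneg hp hν hℓ]

/-- The truncated killing cost of an alternating word. -/
noncomputable def Psi (K : ℝ) (φ : F →* A) (p : A → ℝ) (ν ℓ : F → ℝ) (u : A × List (F × A)) : ℝ :=
  sInf {c | c = K ∨ ∃ n, Der φ p ν ℓ n u.1 u.2 c}

/-- Prepend a letter to an alternating word. -/
def actL (x : A ⊕ F) (u : A × List (F × A)) : A × List (F × A) :=
  match x with
  | .inl a => (a * u.1, u.2)
  | .inr f => (1, (f, u.1) :: u.2)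

/-- Alternating form of a list. -/
def altL (w : List (A ⊕ F)) : A × List (F × A) := w.foldr actL (1, [])

theorem amalgam {K : ℝ} (hK : 0 < K) {φ : F →* A} {p : A → ℝ} {ν ℓ : F → ℝ} (hp : IsNrm K p)
    (hν : IsNrm K ν) (hℓ : IsLen ℓ)
    (h1 : ∀ s, p (φ s) ≤ ν s + ℓ s) (h2 : ∀ s, ν s ≤ p (φ s) + ℓ s) :
    ∃ N : Monoid.Coprod A F → ℝ, IsNrm K N ∧ (∀ a, N (Monoid.Coprod.inl a) = p a) ∧
      (∀ f, N (Monoid.Coprod.inr f) = ν f) ∧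
      (∀ s, N (Monoid.Coprod.inr s * (Monoid.Coprod.inl (φ s))⁻¹) ≤ ℓ s) := by
  set Ψ := Psi K φ p ν ℓ with hΨ
  have bdd : ∀ u : A × List (F × A), BddBelow {c | c = K ∨ ∃ n, Der φ p ν ℓ n u.1 u.2 c} := by
    intro u
    refine ⟨0, ?_⟩
    rintro c (rfl | ⟨n, h⟩)
    · exact hK.le
    · exact h.nonneg hp hν hℓ
  have ne : ∀ u : A × List (F × A), {c | c = K ∨ ∃ n, Der φ p ν ℓ n u.1 u.2 c}.Nonempty :=
    fun u => ⟨K, .inl rfl⟩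
  have Ψ0 : ∀ u, 0 ≤ Ψ u := by
    intro u
    refine le_csInf (ne u) ?_
    rintro c (rfl | ⟨n, h⟩)
    · exact hK.le
    · exact h.nonneg hp hν hℓ
  have ΨK : ∀ u, Ψ u ≤ K := fun u => csInf_le (bdd u) (.inl rfl)
  have ΨR : ∀ {u v : A × List (F × A)} {δ}, Rl φ p ν ℓ u.1 u.2 v.1 v.2 δ → Ψ u ≤ Ψ v + δ := by
    intro u v δ h
    have hδ := h.nonneg hp hν hℓ
    rw [← sub_le_iff_le_add]
    refine le_csInf (ne v) ?_
    rintro c (rfl | ⟨n, hd⟩)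
    · linarith [ΨK u]
    · have := csInf_le (bdd u) (.inr ⟨n, Der.rl hp hν hℓ h1 h2 n h hd⟩)
      change Ψ u ≤ _ at this
      linarith
  have ΨS : ∀ {u v : A × List (F × A)} {δ}, Stp φ p ν ℓ u.1 u.2 v.1 v.2 δ → Ψ u ≤ Ψ v + δ := by
    intro u v δ h
    have hδ := h.nonneg hp hν hℓ
    rw [← sub_le_iff_le_add]
    refine le_csInf (ne v) ?_
    rintro c (rfl | ⟨n, hd⟩)
    · linarith [ΨK u]
    · have := csInf_le (bdd u) (.inr ⟨n + 1, .step _ _ _ _ _ _ _ _ h hd le_rfl⟩)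
      change Ψ u ≤ _ at this
      linarith
  have ctxR : ∀ (L : List (A ⊕ F)) {u v : A × List (F × A)} {δ}, Rl φ p ν ℓ u.1 u.2 v.1 v.2 δ →
      Rl φ p ν ℓ (L.foldr actL u).1 (L.foldr actL u).2 (L.foldr actL v).1 (L.foldr actL v).2 δ := by
    intro L u v δ h
    induction L with
    | nil => exact h
    | cons x L ih =>
      rcases x with a | f
      · exact ih.lmul hp a
      · exact .tail _ _ _ _ _ _ _ ih
  have ctxS : ∀ (L : List (A ⊕ F)) {u v : A × List (F × A)} {δ}, Stp φ p ν ℓ u.1 u.2 v.1 v.2 δ →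
      Stp φ p ν ℓ (L.foldr actL u).1 (L.foldr actL u).2 (L.foldr actL v).1 (L.foldr actL v).2 δ := by
    intro L u v δ h
    induction L with
    | nil => exact h
    | cons x L ih =>
      rcases x with a | f
      · exact ih.lmul a
      · exact .tail _ _ _ _ _ _ _ ih
  have z1 : ν (1 * (1 : F)⁻¹) + ℓ 1 = 0 := by simp [hν.one, hℓ.one]
  have z2 : p (1 * (φ 1)⁻¹) + ℓ 1 = 0 := by simp [hp.one, hℓ.one]
  -- the two equalities
  have eqA : ∀ (L : List (A ⊕ F)) (f g b l),
      Ψ (L.foldr actL ((1 : A), (f, (1 : A)) :: (g, b) :: l)) = Ψ (L.foldr actL (1, (f * g, b) :: l)) := by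
    intro L f g b l
    apply le_antisymm
    · have := Stp.m2 (φ := φ) (p := p) (ν := ν) (ℓ := ℓ) 1 f 1 g b l 1
      rw [z2, mul_one] at this
      have := ΨS (ctxS L (u := (_, _)) (v := (_, _)) this)
      simpa using this
    · have := ΨR (ctxR L (u := (_, _)) (v := (_, _))
        (Rl.c4a (φ := φ) (p := p) (ν := ν) (ℓ := ℓ) 1 f g b l))
      simpa using this
  have eqB : ∀ (L : List (A ⊕ F)) (u),
      Ψ (L.foldr actL ((1 : A), (1, u.1) :: u.2)) = Ψ (L.foldr actL u) := by
    rintro L ⟨b, l⟩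
    apply le_antisymm
    · have := Stp.m1 (φ := φ) (p := p) (ν := ν) (ℓ := ℓ) 1 1 b l 1
      rw [z1] at this
      have := ΨS (ctxS L (u := (_, _)) (v := (_, _)) this)
      simpa using this
    · have := ΨR (ctxR L (u := (_, _)) (v := (_, _))
        (Rl.c4b (φ := φ) (p := p) (ν := ν) (ℓ := ℓ) 1 b l))
      simpa using this
  -- descend to the coproduct
  let Q : List (A ⊕ F) → ℝ := fun w => Ψ (altL w)
  let C : Con (FreeMonoid (A ⊕ F)) :=
    { r := fun x y => ∀ L M : List (A ⊕ F),
        Q (L ++ (FreeMonoid.toList x ++ M)) = Q (L ++ (FreeMonoid.toList y ++ M))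
      iseqv := ⟨fun _ _ _ => rfl, fun h L M => (h L M).symm, fun h h' L M => (h L M).trans (h' L M)⟩
      mul' := by
        intro w x y z h h' L M
        have e1 := h L (FreeMonoid.toList y ++ M)
        have e2 := h' (L ++ FreeMonoid.toList x) M
        simp only [FreeMonoid.toList_mul, List.append_assoc] at e1 e2 ⊢
        rw [e1, e2] }
  have hC : Monoid.coprodCon A F ≤ C := by
    refine sInf_le ?_
    refine ⟨?_, ?_, ?_, ?_⟩
    · intro x y L M
      simp [Q, altL, actL, mul_assoc]
    · intro x y L M
      have := (eqA L x y (altL M).1 (altL M).2).symm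
      simpa [Q, altL, actL] using this
    · intro L M
      simp [Q, altL, actL]
    · intro L M
      have := eqB L (altL M)
      simpa [Q, altL, actL] using this
  have hQ : ∀ x y : FreeMonoid (A ⊕ F), Monoid.Coprod.mk x = Monoid.Coprod.mk y → 
      Q (FreeMonoid.toList x) = Q (FreeMonoid.toList y) := by
    intro x y h
    have := hC (Monoid.Coprod.mk_eq_mk.1 h) [] []
    simpa using this
  let R : Monoid.Coprod A F → ℝ := fun g =>
    Q (FreeMonoid.toList (Function.surjInv Monoid.Coprod.mk_surjective g))
  have hR : ∀ x : FreeMonoid (A ⊕ F), R (Monoid.Coprod.mk x) = Q (FreeMonoid.toList x) := fun x =>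
    hQ _ _ (Function.surjInv_eq _ _)
  have R0 : ∀ g, 0 ≤ R g := fun g => Ψ0 _
  have RK : ∀ g, R g ≤ K := fun g => ΨK _
  obtain ⟨N, hN, lo, up⟩ := nrm_of_fun R0 RK
  -- values
  have vA : ∀ a, R (Monoid.Coprod.inl a) = p a := by
    intro a
    rw [← Monoid.Coprod.mk_of_inl, hR]
    have : Q (FreeMonoid.toList (FreeMonoid.of (Sum.inl a : A ⊕ F))) = Ψ (a, []) := by
      simp [Q, altL, actL]
    rw [this]
    apply le_antisymm
    · exact csInf_le (bdd _) (.inr ⟨0, .nil _ _ _ le_rfl⟩)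
    · refine le_csInf (ne _) ?_
      rintro c (rfl | ⟨n, h⟩)
      · exact hp.le _
      · cases h with
        | nil _ _ _ h => exact h
        | step _ _ _ _ _ _ _ _ h => cases h
  have vF : ∀ f, R (Monoid.Coprod.inr f) = ν f := by
    intro f
    rw [← Monoid.Coprod.mk_of_inr, hR]
    have : Q (FreeMonoid.toList (FreeMonoid.of (Sum.inr f : A ⊕ F))) = Ψ (1, [(f, 1)]) := by
      simp [Q, altL, actL]
    rw [this]
    apply le_antisymm
    · refine csInf_le (bdd _) (.inr ⟨1, .step _ _ _ _ _ _ 0 _ (.m1 _ _ _ _ 1) (.nil _ _ _ ?_) ?_⟩)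
      · simp [hp.one]
      · simp [hℓ.one]
    · refine le_csInf (ne _) ?_
      rintro c (rfl | ⟨n, h⟩)
      · exact hν.le _
      · cases h with
        | step _ _ _ _ _ _ _ _ h hd hc =>
          cases h with
          | tail _ _ _ _ _ _ _ h => cases h
          | m1 _ _ _ _ s =>
            cases hd with
            | step _ _ _ _ _ _ _ _ h => cases h
            | nil _ _ _ h =>
              simp only [one_mul, mul_one] at h
              have := hν.mul (f * s⁻¹) s
              rw [inv_mul_cancel_right] at this
              linarith [h2 s]
  have R1 : R 1 = 0 := by rw [← map_one Monoid.Coprod.inl, vA, hp.one]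
  have ctx : ∀ (x : FreeMonoid (A ⊕ F)) (c : ℝ),
      (∀ (L : List (A ⊕ F)) (u : A × List (F × A)),
        |Ψ (L.foldr actL ((FreeMonoid.toList x).foldr actL u)) - Ψ (L.foldr actL u)| ≤ c) →
      N (Monoid.Coprod.mk x) ≤ c := by
    intro x c h
    refine up _ _ fun g g' => ?_
    obtain ⟨L, rfl⟩ := Monoid.Coprod.mk_surjective g
    obtain ⟨M, rfl⟩ := Monoid.Coprod.mk_surjective g'
    rw [← map_mul, ← map_mul, ← map_mul, hR, hR]
    have := h (FreeMonoid.toList L) (altL (FreeMonoid.toList M))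
    simpa [Q, altL] using this
  have rev : ∀ (L : List (A ⊕ F)) {u v : A × List (F × A)} {c}, Rl φ p ν ℓ u.1 u.2 v.1 v.2 c →
      Rl φ p ν ℓ v.1 v.2 u.1 u.2 c → |Ψ (L.foldr actL u) - Ψ (L.foldr actL v)| ≤ c := by
    intro L u v c h h'
    rw [abs_le]
    constructor <;> linarith [ΨR (ctxR L h), ΨR (ctxR L h')]
  refine ⟨N, hN, fun a => le_antisymm ?_ ?_, fun f => le_antisymm ?_ ?_, fun s => ?_⟩
  · rw [← Monoid.Coprod.mk_of_inl]
    refine ctx _ _ ?_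
    rintro L ⟨b, l⟩
    refine rev L (u := (a * b, l)) (v := (b, l)) (Rl.c2' ?_ _) (Rl.c2' ?_ _)
    · congr 1; group
    · rw [← hp.inv a]; congr 1; group
  · have := lo (Monoid.Coprod.inl a) 1 1
    simp only [one_mul, mul_one, R1, vA, sub_zero] at this
    exact (le_abs_self _).trans this
  · rw [← Monoid.Coprod.mk_of_inr]
    refine ctx _ _ ?_
    rintro L u
    rw [← eqB L u]
    refine rev L (u := (1, (f, u.1) :: u.2)) (v := (1, (1, u.1) :: u.2)) (Rl.c1' ?_ _ _ _) (Rl.c1' ?_ _ _ _)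
    · congr 1; group
    · rw [← hν.inv f]; congr 1; group
  · have := lo (Monoid.Coprod.inr f) 1 1
    simp only [one_mul, mul_one, R1, vF, sub_zero] at this
    exact (le_abs_self _).trans this
  · rw [← map_inv, ← Monoid.Coprod.mk_of_inr, ← Monoid.Coprod.mk_of_inl, ← map_mul]
    refine ctx _ _ ?_
    rintro L ⟨b, l⟩
    rw [← eqB L (b, l)]
    have e1 := Rl.c3r (φ := φ) (p := p) (ν := ν) (ℓ := ℓ) 1 1 s ((φ s)⁻¹ * b) l
    have e2 := Rl.c3r' (φ := φ) (p := p) (ν := ν) hℓ 1 1 s ((φ s)⁻¹ * b) l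
    rw [mul_inv_cancel_left, one_mul] at e1 e2
    exact rev L (u := (1, (s, (φ s)⁻¹ * b) :: l)) (v := (1, (1, b) :: l)) e1 e2
end amalg2

end

section

open Filter Topology

/-- The `m`-th copy of the free group. -/
def iotaH (m : ℕ) : FreeGroup ℕ →* FreeGroup (ℕ × ℕ) := FreeGroup.map (fun i => (m, i))

theorem tree_fin {K : ℝ} (hK : 0 < K) (nd : ℕ → FreeGroup ℕ → ℝ) (hnd : ∀ m, IsNrm K (nd m))
    (par : ℕ → ℕ) (hpar : ∀ m, par (m + 1) ≤ m) (e : ℕ → FreeGroup ℕ → ℝ) (he : ∀ m, IsLen (e m))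
    (hcl : ∀ m w, |nd (m + 1) w - nd (par (m + 1)) w| ≤ e (m + 1) w) (n : ℕ) :
    ∃ P : FreeGroup (ℕ × ℕ) → ℝ, IsNrm K P ∧ (∀ m ≤ n, ∀ w, P (iotaH m w) = nd m w) ∧
      ∀ m, m + 1 ≤ n → ∀ w, P (iotaH (m + 1) w * (iotaH (par (m + 1)) w)⁻¹) ≤ e (m + 1) w := by
  induction n with
  | zero =>
    refine ⟨_, (hnd 0).comap (FreeGroup.map (fun x : ℕ × ℕ => x.2)), ?_, fun m hm => by omega⟩
    intro m hm w
    obtain rfl : m = 0 := by omega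
    have : (FreeGroup.map (fun x : ℕ × ℕ => x.2)).comp (iotaH 0) = MonoidHom.id _ := by
      ext i; simp [iotaH]
    have := DFunLike.congr_fun this w
    simp only [MonoidHom.comp_apply, MonoidHom.id_apply] at this
    rw [this]
  | succ n ih =>
    obtain ⟨P, hP, hPn, hPe⟩ := ih
    have hq := hPn _ (hpar n)
    obtain ⟨N, hN, hl, hr, hc⟩ := amalgam hK (φ := iotaH (par (n + 1))) hP (hnd (n + 1)) (he (n + 1))
      (fun s => by rw [hq]; linarith [(abs_le.1 (hcl n s)).1])
      (fun s => by rw [hq]; linarith [(abs_le.1 (hcl n s)).2])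
    let θ : FreeGroup (ℕ × ℕ) →* Monoid.Coprod (FreeGroup (ℕ × ℕ)) (FreeGroup ℕ) :=
      FreeGroup.lift (fun x => if x.1 = n + 1 then Monoid.Coprod.inr (FreeGroup.of x.2)
        else Monoid.Coprod.inl (FreeGroup.of x))
    have t1 : ∀ w, θ (iotaH (n + 1) w) = Monoid.Coprod.inr w := by
      intro w
      have : θ.comp (iotaH (n + 1)) = Monoid.Coprod.inr := by
        ext i; simp [θ, iotaH]
      exact DFunLike.congr_fun this w
    have t2 : ∀ m ≤ n, ∀ w, θ (iotaH m w) = Monoid.Coprod.inl (iotaH m w) := by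
      intro m hm w
      have : θ.comp (iotaH m) = Monoid.Coprod.inl.comp (iotaH m) := by
        ext i; simp [θ, iotaH, show m ≠ n + 1 by omega]
      exact DFunLike.congr_fun this w
    refine ⟨_, hN.comap θ, ?_, ?_⟩
    · intro m hm w
      rcases Nat.lt_or_ge n m with h | h
      · obtain rfl : m = n + 1 := by omega
        rw [t1, hr]
      · rw [t2 m h, hl, hPn m h]
    · intro m hm w
      rcases Nat.lt_or_ge m n with h | h
      · rw [map_mul, map_inv, t2 _ h, t2 _ ((hpar m).trans (by omega)), ← map_inv, ← map_mul, hl]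
        exact hPe m h w
      · obtain rfl : m = n := by omega
        rw [map_mul, map_inv, t1, t2 _ (hpar m)]
        exact hc w

theorem tree {K : ℝ} (hK : 0 < K) (nd : ℕ → FreeGroup ℕ → ℝ) (hnd : ∀ m, IsNrm K (nd m))
    (par : ℕ → ℕ) (hpar : ∀ m, par (m + 1) ≤ m) (e : ℕ → FreeGroup ℕ → ℝ) (he : ∀ m, IsLen (e m))
    (hcl : ∀ m w, |nd (m + 1) w - nd (par (m + 1)) w| ≤ e (m + 1) w) :
    ∃ P : FreeGroup (ℕ × ℕ) → ℝ, IsNrm K P ∧ (∀ m w, P (iotaH m w) = nd m w) ∧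
      ∀ m w, P (iotaH (m + 1) w * (iotaH (par (m + 1)) w)⁻¹) ≤ e (m + 1) w := by
  choose Q hQ hQn hQe using tree_fin hK nd hnd par hpar e he hcl
  let U : Ultrafilter ℕ := hyperfilter ℕ
  have hU : (U : Filter ℕ) ≤ atTop := Nat.hyperfilter_le_atTop
  have ex : ∀ g, ∃ c, Tendsto (fun n => Q n g) U (𝓝 c) := by
    intro g
    have hc : IsCompact (Set.Icc (0 : ℝ) K) := isCompact_Icc
    have := hc.ultrafilter_le_nhds (U.map (fun n => Q n g)) (by
      rw [le_principal_iff]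
      exact Filter.mem_map.2 (Filter.univ_mem' fun n => ⟨(hQ n).nonneg g, (hQ n).le g⟩))
    obtain ⟨c, _, h⟩ := this
    exact ⟨c, h⟩
  choose P hP using ex
  refine ⟨P, ⟨?_, ?_, ?_, ?_, ?_, ?_⟩, ?_, ?_⟩
  · refine tendsto_nhds_unique (hP 1) ?_
    simp only [(hQ _).one]; exact tendsto_const_nhds
  · intro x
    refine tendsto_nhds_unique (hP x⁻¹) ?_
    simp only [(hQ _).inv]; exact hP x
  · intro x y
    exact le_of_tendsto_of_tendsto' (hP _) ((hP x).add (hP y)) fun n => (hQ n).mul x y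
  · intro x y
    refine tendsto_nhds_unique (hP _) ?_
    simp only [(hQ _).conj]; exact hP x
  · exact fun x => ge_of_tendsto' (hP x) fun n => (hQ n).nonneg x
  · exact fun x => le_of_tendsto' (hP x) fun n => (hQ n).le x
  · intro m w
    refine tendsto_nhds_unique (hP _) ?_
    refine tendsto_const_nhds.congr' ?_
    filter_upwards [hU (eventually_ge_atTop m)] with n hn
    exact (hQn n m hn w).symm
  · intro m w
    refine le_of_tendsto (hP _) ?_
    filter_upwards [hU (eventually_ge_atTop (m + 1))] with n hn
    exact hQe n m hn w

/-- Weighted word length. -/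
def wlen (w : FreeGroup ℕ) : ℕ := (w.toWord.map (fun x => x.1 + 1)).sum

theorem wlen_isLen {c : ℝ} (hc : 0 ≤ c) : IsLen (fun w => c * (wlen w : ℝ)) where
  one := by simp [wlen]
  inv x := by
    have : wlen x⁻¹ = wlen x := by
      simp [wlen, FreeGroup.toWord_inv, FreeGroup.invRev, Function.comp_def, List.sum_reverse]
    simp only [this]
  mul x y := by
    have : wlen (x * y) ≤ wlen x + wlen y := by
      have h : List.Sublist (x * y).toWord (x.toWord ++ y.toWord) := by
        rw [FreeGroup.toWord_mul]; exact FreeGroup.Red.sublist FreeGroup.reduce.red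
      have := (h.map (fun x => x.1 + 1)).sum_le_sum (by simp)
      simpa [wlen] using this
    have : (wlen (x * y) : ℝ) ≤ wlen x + wlen y := by exact_mod_cast this
    nlinarith
  nonneg x := by positivity

theorem wlen_pos {w : FreeGroup ℕ} (h : w ≠ 1) : 1 ≤ wlen w := by
  have : w.toWord ≠ [] := by simpa using h
  obtain ⟨x, l, hl⟩ := List.exists_cons_of_ne_nil this
  simp [wlen, hl]; omega

theorem wlen_finite (R : ℕ) : {w : FreeGroup ℕ | wlen w ≤ R}.Finite := by
  have h1 : (Set.range (fun l : {l : List (Fin (R + 1) × Bool) // l.length ≤ R} =>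
      FreeGroup.mk (l.1.map (fun x => ((x.1 : ℕ), x.2))))).Finite := by
    have : Finite {l : List (Fin (R + 1) × Bool) // l.length ≤ R} :=
      (List.finite_length_le (Fin (R + 1) × Bool) R).to_subtype
    exact Set.finite_range _
  refine h1.subset ?_
  intro w hw
  have hw : (w.toWord.map (fun x => x.1 + 1)).sum ≤ R := hw
  have hlen : w.toWord.length ≤ R := by
    have := List.length_le_sum_of_one_le (w.toWord.map (fun x => x.1 + 1)) (by simp)
    simp at this hw ⊢
    omega
  have hmem : ∀ x ∈ w.toWord, x.1 < R + 1 := by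
    intro x hx
    have := List.single_le_sum (l := w.toWord.map (fun x => x.1 + 1)) (by simp) (x.1 + 1)
      (List.mem_map.2 ⟨x, hx, rfl⟩)
    omega
  refine ⟨⟨w.toWord.map (fun x => (Fin.ofNat (R + 1) x.1, x.2)), by simpa using hlen⟩, ?_⟩
  simp only [List.map_map]
  conv_rhs => rw [← FreeGroup.mk_toWord (x := w)]
  congr 1
  conv_rhs => rw [← List.map_id w.toWord]
  apply List.map_congr_left
  intro x hx
  simp [Nat.mod_eq_of_lt (hmem x hx)]

theorem dense_norms {K : ℝ} (hK : 0 < K) : ∃ den : ℕ → ℕ → FreeGroup ℕ → ℝ,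
    (∀ k j, IsNrm K (den k j)) ∧ ∀ ν, IsNrm K ν → ∀ k, ∃ j, ∀ w,
      |den k j w - ν w| ≤ K * (1 / 2) ^ k * (wlen w : ℝ) := by
  classical
  have hz : IsNrm K (fun _ : FreeGroup ℕ => (0 : ℝ)) :=
    ⟨rfl, fun _ => rfl, fun _ _ => by simp, fun _ _ => rfl, fun _ => le_rfl, fun _ => hK.le⟩
  obtain ⟨q, hq⟩ := exists_surjective_nat (FreeGroup ℕ →₀ ℚ)
  have : ∀ k j, ∃ μ : FreeGroup ℕ → ℝ, IsNrm K μ ∧ ((∃ μ', IsNrm K μ' ∧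
      ∀ w, |μ' w - (q j w : ℝ)| ≤ K * (1 / 2) ^ (k + 1) * (wlen w : ℝ)) →
      ∀ w, |μ w - (q j w : ℝ)| ≤ K * (1 / 2) ^ (k + 1) * (wlen w : ℝ)) := by
    intro k j
    by_cases h : ∃ μ', IsNrm K μ' ∧
      ∀ w, |μ' w - (q j w : ℝ)| ≤ K * (1 / 2) ^ (k + 1) * (wlen w : ℝ)
    · obtain ⟨μ, h1, h2⟩ := h
      exact ⟨μ, h1, fun _ => h2⟩
    · exact ⟨_, hz, fun h' => absurd h' h⟩
  choose den hd hd' using this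
  refine ⟨den, hd, fun ν hν k => ?_⟩
  have hε : 0 < K * (1 / 2 : ℝ) ^ (k + 1) := by positivity
  have : ∀ w, ∃ r : ℚ, |ν w - r| < K * (1 / 2) ^ (k + 1) := fun w => exists_rat_near _ hε
  choose r hr using this
  let g : FreeGroup ℕ →₀ ℚ := Finsupp.onFinset (wlen_finite (2 ^ (k + 1))).toFinset
    (fun w => if w = 1 then 0 else if wlen w ≤ 2 ^ (k + 1) then r w else 0) (by
      intro w hw
      by_contra h
      simp at h hw
      omega)
  obtain ⟨j, hj⟩ := hq g
  have hg : ∀ w, |ν w - (q j w : ℝ)| ≤ K * (1 / 2) ^ (k + 1) * (wlen w : ℝ) := by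
    intro w
    have hgw : g w = if w = 1 then 0 else if wlen w ≤ 2 ^ (k + 1) then r w else 0 := rfl
    rw [hj, hgw]
    split_ifs with h1 h2
    · subst h1; simp [hν.one]; positivity
    · have : (1 : ℝ) ≤ wlen w := by exact_mod_cast wlen_pos h1
      nlinarith [hr w]
    · have : (2 : ℝ) ^ (k + 1) ≤ wlen w := by exact_mod_cast (not_le.1 h2).le
      have e : K = K * (1 / 2) ^ (k + 1) * 2 ^ (k + 1) := by
        rw [mul_assoc, ← mul_pow]; norm_num
      simp only [Rat.cast_zero, sub_zero]
      rw [abs_of_nonneg (hν.nonneg w)]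
      nlinarith [hν.le w]
  refine ⟨j, fun w => ?_⟩
  have h1 := hd' k j ⟨ν, hν, hg⟩ w
  have h2 := hg w
  have := abs_sub_le (den k j w) (q j w) (ν w)
  rw [abs_sub_comm (q j w : ℝ)] at this
  have e : K * (1 / 2) ^ k * (wlen w : ℝ) = K * (1 / 2) ^ (k + 1) * (wlen w : ℝ) +
    K * (1 / 2) ^ (k + 1) * (wlen w : ℝ) := by rw [pow_succ]; ring
  linarith

open Classical in
/-- The tree of norms: node number ↦ (norm, level). -/
noncomputable def nodeT (K : ℝ) (den : ℕ → ℕ → FreeGroup ℕ → ℝ) : ℕ → (FreeGroup ℕ → ℝ) × ℕ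
  | 0 => (fun _ => 0, 0)
  | m + 1 =>
    have : (Nat.unpair m).1 < m + 1 := Nat.lt_succ_of_le (Nat.unpair_left_le m)
    let a := nodeT K den (Nat.unpair m).1
    (if ∀ w, |den (a.2 + 1) (Nat.unpair m).2 w - a.1 w| ≤ 2 * K * (1 / 2) ^ a.2 * (wlen w : ℝ) then
      den (a.2 + 1) (Nat.unpair m).2 else a.1, a.2 + 1)

/-- Universal norm on the countable free group. -/
theorem univ_norm {K : ℝ} (hK : 0 < K) : ∃ P : FreeGroup (ℕ × ℕ) → ℝ, IsNrm K P ∧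
    ∀ ν, IsNrm K ν → ∃ b : ℕ → ℕ, (∀ w, Tendsto (fun k => P (iotaH (b k) w)) atTop (𝓝 (ν w))) ∧
      ∀ k w, P (iotaH (b (k + 1)) w * (iotaH (b k) w)⁻¹) ≤ 2 * K * (wlen w : ℝ) * (1 / 2) ^ k := by
  classical
  obtain ⟨den, hden, hd⟩ := dense_norms hK
  let T := nodeT K den
  let par : ℕ → ℕ := fun m => (Nat.unpair (m - 1)).1
  let e : ℕ → FreeGroup ℕ → ℝ := fun m w => 2 * K * (1 / 2) ^ (T (par m)).2 * (wlen w : ℝ)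
  have hT : ∀ m, T (m + 1) = (if ∀ w, |den ((T (par (m + 1))).2 + 1) (Nat.unpair m).2 w -
      (T (par (m + 1))).1 w| ≤ e (m + 1) w then
      den ((T (par (m + 1))).2 + 1) (Nat.unpair m).2 else (T (par (m + 1))).1,
      (T (par (m + 1))).2 + 1) := by
    intro m
    simp only [T]
    rw [nodeT]
    simp only [par, e, Nat.add_sub_cancel, T]
  have hT0 : T 0 = (fun _ => 0, 0) := by simp only [T]; rw [nodeT]
  have hpar : ∀ m, par (m + 1) ≤ m := fun m => Nat.unpair_left_le m
  have hn : ∀ m, IsNrm K (T m).1 := by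
    intro m
    induction m using Nat.strong_induction_on with
    | _ m ih =>
      rcases m with _ | m
      · rw [hT0]
        exact ⟨rfl, fun _ => rfl, fun _ _ => by simp, fun _ _ => rfl, fun _ => le_rfl, fun _ => hK.le⟩
      · rw [hT]
        dsimp only
        split_ifs
        · exact hden _ _
        · exact ih _ (Nat.lt_succ_of_le (hpar m))
  have he : ∀ m, IsLen (e m) := fun m => wlen_isLen (by positivity)
  obtain ⟨P, hP, hPn, hPe⟩ := tree hK (fun m => (T m).1) hn par hpar e he (by
    intro m w
    rw [hT]
    dsimp only
    split_ifs with h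
    · exact h w
    · simpa using (he _).nonneg w)
  refine ⟨P, hP, fun ν hν => ?_⟩
  choose j hj using hd ν hν
  let b : ℕ → ℕ := fun k => Nat.rec 0 (fun k a => Nat.pair a (j (k + 1)) + 1) k
  have hb : ∀ k, b (k + 1) = Nat.pair (b k) (j (k + 1)) + 1 := fun k => rfl
  have hbp : ∀ k, par (b (k + 1)) = b k := fun k => by simp [hb, par]
  have key : ∀ k, (T (b k)).2 = k ∧ ∀ w, |(T (b k)).1 w - ν w| ≤ K * (1 / 2) ^ k * (wlen w : ℝ) := by
    intro k
    induction k with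
    | zero =>
      have : T (b 0) = (fun _ => 0, 0) := hT0
      rw [this]
      refine ⟨rfl, fun w => ?_⟩
      by_cases h : w = 1
      · subst h; simp [hν.one]; positivity
      · have : (1 : ℝ) ≤ wlen w := by exact_mod_cast wlen_pos h
        simp [abs_of_nonneg (hν.nonneg w)]
        nlinarith [hν.le w]
    | succ k ih =>
      have := hT (Nat.pair (b k) (j (k + 1)))
      rw [← hb, hbp, Nat.unpair_pair, ih.1] at this
      rw [if_pos] at this
      · rw [this]; exact ⟨rfl, hj (k + 1)⟩
      · intro w
        have h1 := hj (k + 1) w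
        have h2 := ih.2 w
        have h3 := abs_sub_le (den (k + 1) (j (k + 1)) w) (ν w) ((T (b k)).1 w)
        rw [abs_sub_comm (ν w)] at h3
        have h4 : e (b (k + 1)) w = 2 * K * (1 / 2) ^ k * (wlen w : ℝ) := by
          simp only [e, hbp, ih.1]
        dsimp only
        rw [h4]
        rw [pow_succ] at h1
        have : 0 ≤ K * (1 / 2) ^ k * (wlen w : ℝ) := by positivity
        linarith
  refine ⟨b, fun w => ?_, fun k w => ?_⟩
  · simp only [hPn]
    rw [tendsto_iff_dist_tendsto_zero]
    refine squeeze_zero (fun _ => dist_nonneg) (fun k => (key k).2 w) ?_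
    have : Tendsto (fun k : ℕ => K * (1 / 2 : ℝ) ^ k * (wlen w : ℝ)) atTop (𝓝 (K * 0 * wlen w)) :=
      ((tendsto_pow_atTop_nhds_zero_of_lt_one (by norm_num) (by norm_num)).const_mul K).mul_const _
    simpa using this
  · have := hPe (Nat.pair (b k) (j (k + 1))) w
    rw [← hb, hbp] at this
    simp only [e, hbp, (key k).1] at this
    linarith

end

section

theorem bi_dist_inv {G : Type*} [Group G] [MetricSpace G] (h : BiInvariantDist G) (x y : G) :
    dist x⁻¹ y⁻¹ = dist x y := by
  have h1 := (h x x⁻¹ y⁻¹).1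
  have h2 := (h y (x * x⁻¹) (x * y⁻¹)).2
  rw [← h1, ← h2]; simp [dist_comm]

theorem bi_dist_mul {G : Type*} [Group G] [MetricSpace G] (h : BiInvariantDist G) (x y x' y' : G) :
    dist (x * y) (x' * y') ≤ dist x x' + dist y y' := by
  have h1 := (h y x x').2
  have h2 := (h x' y y').1
  linarith [dist_triangle (x * y) (x' * y) (x' * y')]

theorem bi_nrm {G : Type*} [Group G] [MetricSpace G] (h : BiInvariantDist G) {K : ℝ}
    (hb : ∀ x y : G, dist x y ≤ K) : IsNrm K (fun x : G => dist x 1) where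
  one := dist_self _
  inv x := by simpa using bi_dist_inv h x 1
  mul x y := by simpa using bi_dist_mul h x y 1 1
  conj x y := by
    have h1 := (h y⁻¹ (y * x) y).1
    have h2 := (h y⁻¹ (y * x) y).2
    have h3 := (h y x 1).1
    simp at h1 h2 h3 ⊢
    rw [h2]; exact h3
  nonneg x := dist_nonneg
  le x := hb _ _

open Filter Topology in
/-- Extending an isometric relation from a dense image. -/
theorem extend_iso {F H G : Type*} [Group F] [Group H] [MetricSpace H] [Group G] [MetricSpace G]
    [CompleteSpace G] (hH : BiInvariantDist H) (hG : BiInvariantDist G) (ψ : F →* H)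
    (hψ : DenseRange ψ) (f0 : F →* G) (hf : ∀ w w', dist (f0 w) (f0 w') = dist (ψ w) (ψ w')) :
    ∃ f : H →* G, Function.Injective f ∧ Isometry f := by
  have hex : ∀ x : H, ∃ g : G, ∀ w, dist g (f0 w) = dist x (ψ w) := by
    intro x
    obtain ⟨u, hu, hux⟩ := mem_closure_iff_seq_limit.1 (hψ x)
    choose v hv using hu
    have hc : CauchySeq (fun n => f0 (v n)) := by
      have := hux.cauchySeq
      rw [Metric.cauchySeq_iff] at this ⊢
      simpa only [hf, hv] using this
    obtain ⟨g, hg⟩ := cauchySeq_tendsto_of_complete hc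
    refine ⟨g, fun w => ?_⟩
    have h1 := hg.dist (tendsto_const_nhds (x := f0 w))
    have h2 := hux.dist (tendsto_const_nhds (x := ψ w))
    simp only [hf, hv] at h1
    exact tendsto_nhds_unique h1 h2
  choose f hf' using hex
  have happ : ∀ x : H, ∀ ε > 0, ∃ w, dist x (ψ w) < ε := fun x ε hε => by
    simpa using hψ.exists_dist_lt x hε
  have hiso : ∀ x y, dist (f x) (f y) = dist x y := by
    intro x y
    apply eq_of_forall_dist_le
    intro ε hε
    obtain ⟨w, hw⟩ := happ y (ε / 2) (by linarith)
    have h1 := abs_dist_sub_le (f y) (f0 w) (f x)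
    have h2 := abs_dist_sub_le y (ψ w) x
    rw [dist_comm (f0 w), hf', hf'] at h1
    rw [dist_comm (ψ w)] at h2
    rw [Real.dist_eq, dist_comm (f x), dist_comm x y]
    rw [abs_le] at *
    constructor <;> linarith
  have hmul : ∀ x y, f (x * y) = f x * f y := by
    intro x y
    apply eq_of_forall_dist_le
    intro ε hε
    obtain ⟨w, hw⟩ := happ x (ε / 4) (by linarith)
    obtain ⟨w', hw'⟩ := happ y (ε / 4) (by linarith)
    have h1 := bi_dist_mul hG (f x) (f y) (f0 w) (f0 w')
    have h2 := bi_dist_mul hH x y (ψ w) (ψ w')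
    have h3 := hf' (x * y) (w * w')
    rw [map_mul, map_mul] at h3
    rw [hf', hf'] at h1
    have := dist_triangle_right (f (x * y)) (f x * f y) (f0 w * f0 w')
    linarith
  have hI : Isometry f := Isometry.of_dist_eq hiso
  exact ⟨MonoidHom.mk' f hmul, hI.injective, hI⟩

/-- Metric on the free group. -/
def nrmMet {G : Type*} [Group G] {K : ℝ} {P : G → ℝ} (h : IsNrm K P) :
    PseudoMetricSpace (Additive G) where
  dist x y := P (x.toMul * y.toMul⁻¹)
  dist_self x := by simp [h.one]
  dist_comm x y := by rw [← h.inv]; simp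
  dist_triangle x y z := by
    have := h.mul (x.toMul * y.toMul⁻¹) (y.toMul * z.toMul⁻¹)
    simpa using this

open Filter Topology UniformSpace in
theorem completion_exists {G : Type} [Group G] [Countable G] {K : ℝ} {P : G → ℝ} (h : IsNrm K P) :
    ∃ (𝔾 : Type) (_ : Group 𝔾) (_ : MetricSpace 𝔾),
      BiInvariantDist 𝔾 ∧ (∀ x y : 𝔾, dist x y ≤ K) ∧
      CompleteSpace 𝔾 ∧ TopologicalSpace.SeparableSpace 𝔾 ∧
      ∃ i : G →* 𝔾, ∀ x y, dist (i x) (i y) = P (x * y⁻¹) := by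
  letI : PseudoMetricSpace (Additive G) := nrmMet h
  have hd : ∀ x y : Additive G, dist x y = P (x.toMul * y.toMul⁻¹) := fun _ _ => rfl
  have hr : ∀ g x y : Additive G, dist (x + g) (y + g) = dist x y := by
    intro g x y; simp [hd, mul_assoc]
  have hl : ∀ g x y : Additive G, dist (g + x) (g + y) = dist x y := by
    intro g x y
    have := h.conj (x.toMul * y.toMul⁻¹) g.toMul
    simpa [hd, mul_assoc] using this
  have hs : ∀ x y x' y' : Additive G, dist (x - y) (x' - y') ≤ dist x x' + dist y y' := by
    intro x y x' y'
    have h1 := hl y (-y) (-y')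
    have h2 := hr y' (y + -y) (y + -y')
    have h3 := hr (-y) x x'
    have h4 := hl x' (-y) (-y')
    have h5 := dist_triangle (x - y) (x' - y) (x' - y')
    simp only [sub_eq_add_neg] at *
    rw [add_neg_cancel, zero_add, neg_add_cancel_right] at h2
    rw [add_neg_cancel] at h1
    rw [dist_comm y y']
    linarith
  haveI : IsUniformAddGroup (Additive G) := by
    refine ⟨Metric.uniformContinuous_iff.2 fun ε hε => ⟨ε / 2, by linarith, ?_⟩⟩
    rintro ⟨x, y⟩ ⟨x', y'⟩ hxy
    rw [Prod.dist_eq, max_lt_iff] at hxy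
    have := hs x y x' y'
    dsimp only at *
    linarith
  let C := Completion (Additive G)
  have hcl : ∀ g x y : C, dist (g + x) (g + y) = dist x y := by
    intro g x y
    refine Completion.induction_on₃ g x y (isClosed_eq (by fun_prop) (by fun_prop)) ?_
    intro a b c
    rw [← Completion.coe_add, ← Completion.coe_add, Completion.dist_eq, Completion.dist_eq, hl]
  have hcr : ∀ g x y : C, dist (x + g) (y + g) = dist x y := by
    intro g x y
    refine Completion.induction_on₃ g x y (isClosed_eq (by fun_prop) (by fun_prop)) ?_
    intro a b c
    rw [← Completion.coe_add, ← Completion.coe_add, Completion.dist_eq, Completion.dist_eq, hr]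
  have hcb : ∀ x y : C, dist x y ≤ K := by
    intro x y
    refine Completion.induction_on₂ x y (isClosed_le (by fun_prop) (by fun_prop)) ?_
    intro a b
    rw [Completion.dist_eq]
    exact h.le _
  haveI : Countable (Additive G) := ‹Countable G›
  have hsep : TopologicalSpace.SeparableSpace C :=
    ⟨_, Set.countable_range _, Completion.denseRange_coe (α := Additive G)⟩
  refine ⟨Multiplicative C, inferInstance, (inferInstance : MetricSpace C), fun g x y => ⟨hcl g x y, hcr g x y⟩,
    hcb, (inferInstance : CompleteSpace C), hsep,
    MonoidHom.mk' (fun x => Multiplicative.ofAdd ((Additive.ofMul x : Additive G) : C))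
      (fun x y => Completion.coe_add (Additive.ofMul x) (Additive.ofMul y)), fun x y => ?_⟩
  exact Completion.dist_eq (Additive.ofMul x) (Additive.ofMul y)

open Filter Topology in
theorem final_thm (K : ℝ) (hK : 0 < K) :
    ∃ (𝔾 : Type) (_ : Group 𝔾) (_ : MetricSpace 𝔾),
      BiInvariantDist 𝔾 ∧ (∀ x y : 𝔾, dist x y ≤ K) ∧
      CompleteSpace 𝔾 ∧ TopologicalSpace.SeparableSpace 𝔾 ∧
      ∀ (H : Type) (_ : Group H) (_ : MetricSpace H),
        BiInvariantDist H → (∀ x y : H, dist x y ≤ K) →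
        TopologicalSpace.SeparableSpace H →
        ∃ f : H →* 𝔾, Function.Injective f ∧ Isometry f := by
  obtain ⟨P, hP, huniv⟩ := univ_norm hK
  haveI : Countable (FreeGroup (ℕ × ℕ)) := inferInstance
  obtain ⟨G, _, _, hbi, hbd, hc, hsep, i, hi⟩ := completion_exists hP
  refine ⟨G, _, _, hbi, hbd, hc, hsep, ?_⟩
  intro H _ _ hH hHb _
  have hi1 : ∀ x, dist (i x) 1 = P x := fun x => by simpa using hi x 1
  let ψ : FreeGroup ℕ →* H := FreeGroup.lift (TopologicalSpace.denseSeq H)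
  have hψ : DenseRange ψ := by
    refine (TopologicalSpace.denseRange_denseSeq H).mono ?_
    rintro _ ⟨n, rfl⟩
    exact ⟨FreeGroup.of n, by simp [ψ]⟩
  obtain ⟨b, hb1, hb2⟩ := huniv _ ((bi_nrm hH hHb).comap ψ)
  have hcs : ∀ w, ∃ g : G, Tendsto (fun k => i (iotaH (b k) w)) atTop (𝓝 g) := by
    intro w
    refine cauchySeq_tendsto_of_complete
      (cauchySeq_of_le_geometric (1 / 2) (2 * K * (wlen w : ℝ)) (by norm_num) fun k => ?_)
    rw [dist_comm, hi]
    exact hb2 k w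
  choose f0 hf0 using hcs
  have hmul : ∀ w w', f0 (w * w') = f0 w * f0 w' := by
    intro w w'
    refine tendsto_nhds_unique (hf0 (w * w')) ?_
    rw [tendsto_iff_dist_tendsto_zero]
    have h1 := (tendsto_iff_dist_tendsto_zero.1 (hf0 w)).add (tendsto_iff_dist_tendsto_zero.1 (hf0 w'))
    rw [add_zero] at h1
    refine squeeze_zero (fun _ => dist_nonneg) (fun k => ?_) h1
    rw [map_mul, map_mul]
    exact bi_dist_mul hbi _ _ _ _
  have hn : ∀ w, dist (f0 w) 1 = dist (ψ w) 1 := by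
    intro w
    have h1 := (hf0 w).dist (tendsto_const_nhds (x := (1 : G)))
    simp only [hi1] at h1
    exact tendsto_nhds_unique h1 (hb1 w)
  let F0 : FreeGroup ℕ →* G := MonoidHom.mk' f0 hmul
  refine extend_iso hH hbi ψ hψ F0 fun w w' => ?_
  have h1 := (hbi (F0 w')⁻¹ (F0 w) (F0 w')).2
  have h2 := (hH (ψ w')⁻¹ (ψ w) (ψ w')).2
  rw [mul_inv_cancel, ← map_inv, ← map_mul] at h1 h2
  rw [← h1, ← h2]
  exact hn _

end


/-- For every real `K > 0` there is a group `𝔾` with a complete separable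
bi-invariant metric bounded by `K` such that every separable group with a bi-invariant metric
bounded by `K` admits an isometric group monomorphism into `𝔾`. -/
theorem exists_metrically_universal_bounded_group (K : ℝ) (hK : 0 < K) :
    ∃ (𝔾 : Type) (_ : Group 𝔾) (_ : MetricSpace 𝔾),
      BiInvariantDist 𝔾 ∧ (∀ x y : 𝔾, dist x y ≤ K) ∧
      CompleteSpace 𝔾 ∧ TopologicalSpace.SeparableSpace 𝔾 ∧
      ∀ (H : Type) (_ : Group H) (_ : MetricSpace H),
        BiInvariantDist H → (∀ x y : H, dist x y ≤ K) →
        TopologicalSpace.SeparableSpace H →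
        ∃ f : H →* 𝔾, Function.Injective f ∧ Isometry f := by
  exact final_thm K hK
end

section
/- Let (G, d) be a separable group equipped with a bi-invariant metric d. Then there exists a bi-invariant metric d̄ on the free product G ∗ F_∞, where F_∞ is the free group on countably many generators, such that the canonical embedding of G into G ∗ F_∞ is an isometry from (G, d) onto its image in (G ∗ F_∞, d̄), and the canonical copy of F_∞ inside G ∗ F_∞ is dense in (G ∗ F_∞, d̄). -/
namespace DenseFree

open Monoid

section Cost

variable {ι : Type} {M : ι → Type} [∀ i, Group (M i)]

/-- A conjugation-invariant length function on each factor. -/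
structure IsLen (L : ∀ i, M i → ℝ) : Prop where
  one : ∀ i, L i 1 = 0
  nonneg : ∀ i g, 0 ≤ L i g
  inv : ∀ i g, L i g⁻¹ = L i g
  mul : ∀ i g h, L i (g * h) ≤ L i g + L i h
  conj : ∀ i g h, L i (g * h * g⁻¹) = L i h
  pos : ∀ i g, g ≠ 1 → 0 < L i g

/-- `Cost L w c`: the word `w` can be reduced to the empty word by merging adjacent letters
of the same factor and deleting letters, with total deletion cost at most `c`. -/
inductive Cost (L : ∀ i, M i → ℝ) : List (Σ i, M i) → ℝ → Prop
  | nil (c : ℝ) (hc : 0 ≤ c) : Cost L [] c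
  | del (a : List (Σ i, M i)) (i : ι) (g : M i) (b : List (Σ i, M i)) (c : ℝ)
      (h : Cost L (a ++ b) c) : Cost L (a ++ ⟨i, g⟩ :: b) (c + L i g)
  | mrg (a : List (Σ i, M i)) (i : ι) (g g' : M i) (b : List (Σ i, M i)) (c : ℝ)
      (h : Cost L (a ++ ⟨i, g * g'⟩ :: b) c) : Cost L (a ++ ⟨i, g⟩ :: ⟨i, g'⟩ :: b) c

theorem split_eq {X : Type} {a b a' b' : List X} {x y : X} (h : a' ++ x :: b' = a ++ y :: b) :
    (a' = a ∧ x = y ∧ b' = b) ∨ (∃ t, a' = a ++ y :: t ∧ b = t ++ x :: b') ∨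
      (∃ t, a = a' ++ x :: t ∧ b' = t ++ y :: b) := by
  rcases List.append_eq_append_iff.1 h with ⟨t, h1, h2⟩ | ⟨t, h1, h2⟩
  · cases t with
    | nil => simp at h1 h2; left; simp [h1, h2]
    | cons z t => simp at h2; right; right; exact ⟨t, by simp [h1, h2], h2.2⟩
  · cases t with
    | nil => simp at h1 h2; left; simp [h1, h2]
    | cons z t => simp at h2; right; left; exact ⟨t, by simp [h1, h2], h2.2⟩

variable {L : ∀ i, M i → ℝ}

theorem Cost.of_eq {w w' : List (Σ i, M i)} {c c' : ℝ} (h : Cost L w c) (hw : w = w')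
    (hc : c = c') : Cost L w' c' := by
  subst hw hc; exact h

theorem Cost.mono {w : List (Σ i, M i)} {c : ℝ} (h : Cost L w c) :
    ∀ c', c ≤ c' → Cost L w c' := by
  induction h with
  | nil c hc => intro c' h; exact .nil _ (hc.trans h)
  | del a i g b c h ih =>
    intro c' h'
    exact (Cost.del a i g b (c' - L i g) (ih _ (by linarith))).of_eq rfl (by ring)
  | mrg a i g g' b c h ih => intro c' h'; exact .mrg _ _ _ _ _ _ (ih _ h')

theorem Cost.nonneg (hL : IsLen L) {w : List (Σ i, M i)} {c : ℝ} (h : Cost L w c) : 0 ≤ c := by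
  induction h with
  | nil c hc => exact hc
  | del a i g b c h ih => have := hL.nonneg i g; linarith
  | mrg a i g g' b c h ih => exact ih

theorem Cost.exists (w : List (Σ i, M i)) : ∃ c, Cost L w c := by
  induction w with
  | nil => exact ⟨0, .nil _ le_rfl⟩
  | cons x w ih =>
    obtain ⟨c, hc⟩ := ih
    exact ⟨_, .del [] x.1 x.2 w c hc⟩

theorem Cost.change (hL : IsLen L) {w : List (Σ i, M i)} {c : ℝ} (h : Cost L w c) :
    ∀ (a : List (Σ i, M i)) (i : ι) (g : M i) (b : List (Σ i, M i)) (k : M i),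
      w = a ++ ⟨i, g⟩ :: b → Cost L (a ++ ⟨i, k⟩ :: b) (c + L i (g⁻¹ * k)) := by
  induction h with
  | nil c hc => intro a i g b k h; simp at h
  | del a' j x b' c h ih =>
    intro a i g b k hw
    rcases split_eq hw with ⟨rfl, h2, rfl⟩ | ⟨t, rfl, rfl⟩ | ⟨t, rfl, rfl⟩
    · cases h2
      refine (Cost.del a' j k b' _ h).mono _ ?_
      have := hL.mul j x (x⁻¹ * k)
      simp only [mul_inv_cancel_left] at this
      linarith
    · have := Cost.del (a ++ ⟨i, k⟩ :: t) j x b' _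
        ((ih a i g (t ++ b') k (by simp)).of_eq (by simp) rfl)
      exact this.of_eq (by simp) (by ring)
    · have := Cost.del a' j x (t ++ ⟨i, k⟩ :: b) _
        ((ih (a' ++ t) i g b k (by simp)).of_eq (by simp) rfl)
      exact this.of_eq (by simp) (by ring)
  | mrg a' j x x' b' c h ih =>
    intro a i g b k hw
    rcases split_eq hw with ⟨rfl, h2, rfl⟩ | ⟨t, rfl, rfl⟩ | ⟨t, rfl, h3⟩
    · cases h2
      refine (Cost.mrg a' j k x' b' _ (ih a' j (x * x') b' (k * x') rfl)).of_eq rfl ?_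
      have := hL.conj j x'⁻¹ (x⁻¹ * k)
      rw [← this]; congr 2; group
    · have := Cost.mrg (a ++ ⟨i, k⟩ :: t) j x x' b' _
        ((ih a i g (t ++ ⟨j, x * x'⟩ :: b') k (by simp)).of_eq (by simp) rfl)
      exact this.of_eq (by simp) rfl
    · cases t with
      | nil =>
        simp only [List.nil_append, List.cons.injEq] at h3
        obtain ⟨h3, rfl⟩ := h3
        cases h3
        refine (Cost.mrg a' j x k b' _ (ih a' j (x * x') b' (x * k) rfl)).of_eq (by simp) ?_
        congr 2; group
      | cons y t =>
        simp only [List.cons_append, List.cons.injEq] at h3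
        obtain ⟨rfl, rfl⟩ := h3
        have := Cost.mrg a' j x x' (t ++ ⟨i, k⟩ :: b) _
          ((ih (a' ++ ⟨j, x * x'⟩ :: t) i g b k (by simp)).of_eq (by simp) rfl)
        exact this.of_eq (by simp) rfl

theorem Cost.merge (hL : IsLen L) {w : List (Σ i, M i)} {c : ℝ} (h : Cost L w c) :
    ∀ (a : List (Σ i, M i)) (i : ι) (g g' : M i) (b : List (Σ i, M i)),
      w = a ++ ⟨i, g⟩ :: ⟨i, g'⟩ :: b → Cost L (a ++ ⟨i, g * g'⟩ :: b) c := by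
  induction h with
  | nil c hc => intro a i g g' b h; simp at h
  | del a' j x b' c h ih =>
    intro a i g g' b hw
    rcases split_eq hw with ⟨rfl, h2, rfl⟩ | ⟨t, rfl, h3⟩ | ⟨t, rfl, rfl⟩
    · cases h2
      refine (h.change hL a' j g' b (x * g') rfl).of_eq rfl ?_
      have := hL.conj j g'⁻¹ x
      rw [← this]; congr 2; group
    · cases t with
      | nil =>
        simp only [List.nil_append, List.cons.injEq] at h3
        obtain ⟨h3, rfl⟩ := h3
        cases h3
        refine (h.change hL a j g b (g * x) (by simp)).of_eq rfl ?_
        congr 2; group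
      | cons y t =>
        simp only [List.cons_append, List.cons.injEq] at h3
        obtain ⟨rfl, rfl⟩ := h3
        have := Cost.del (a ++ ⟨i, g * g'⟩ :: t) j x b' _
          ((ih a i g g' (t ++ b') (by simp)).of_eq (by simp) rfl)
        exact this.of_eq (by simp) rfl
    · have := Cost.del a' j x (t ++ ⟨i, g * g'⟩ :: b) _
        ((ih (a' ++ t) i g g' b (by simp)).of_eq (by simp) rfl)
      exact this.of_eq (by simp) rfl
  | mrg a' j x x' b' c h ih =>
    intro a i g g' b hw
    rcases split_eq hw with ⟨rfl, h2, h3⟩ | ⟨t, rfl, h3⟩ | ⟨t, rfl, h3⟩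
    · cases h2
      cases h3
      exact h
    · cases t with
      | nil =>
        simp only [List.nil_append, List.cons.injEq] at h3
        obtain ⟨h3, rfl⟩ := h3
        cases h3
        have := Cost.mrg a j (g * x) x' b' c
          ((ih a j g (x * x') b' (by simp)).of_eq (by simp [mul_assoc]) rfl)
        exact this.of_eq (by simp) rfl
      | cons y t =>
        simp only [List.cons_append, List.cons.injEq] at h3
        obtain ⟨rfl, rfl⟩ := h3
        have := Cost.mrg (a ++ ⟨i, g * g'⟩ :: t) j x x' b' _
          ((ih a i g g' (t ++ ⟨j, x * x'⟩ :: b') (by simp)).of_eq (by simp) rfl)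
        exact this.of_eq (by simp) rfl
    · cases t with
      | nil =>
        simp only [List.nil_append, List.cons.injEq] at h3
        obtain ⟨h3, rfl⟩ := h3
        cases h3
        have := Cost.mrg a' j x (x' * g') b c
          ((ih a' j (x * x') g' b (by simp)).of_eq (by simp [mul_assoc]) rfl)
        exact this.of_eq (by simp) rfl
      | cons y t =>
        simp only [List.cons_append, List.cons.injEq] at h3
        obtain ⟨rfl, rfl⟩ := h3
        have := Cost.mrg a' j x x' (t ++ ⟨i, g * g'⟩ :: b) _
          ((ih (a' ++ ⟨j, x * x'⟩ :: t) i g g' b (by simp)).of_eq (by simp) rfl)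
        exact this.of_eq (by simp) rfl

theorem Cost.del_one (hL : IsLen L) {w : List (Σ i, M i)} {c : ℝ} (h : Cost L w c) :
    ∀ (a : List (Σ i, M i)) (i : ι) (b : List (Σ i, M i)),
      w = a ++ ⟨i, 1⟩ :: b → Cost L (a ++ b) c := by
  induction h with
  | nil c hc => intro a i b h; simp at h
  | del a' j x b' c h ih =>
    intro a i b hw
    rcases split_eq hw with ⟨rfl, h2, rfl⟩ | ⟨t, rfl, rfl⟩ | ⟨t, rfl, rfl⟩
    · cases h2
      exact h.of_eq rfl (by simp [hL.one])
    · have := Cost.del (a ++ t) j x b' _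
        ((ih a i (t ++ b') (by simp)).of_eq (by simp) rfl)
      exact this.of_eq (by simp) rfl
    · have := Cost.del a' j x (t ++ b) _
        ((ih (a' ++ t) i b (by simp)).of_eq (by simp) rfl)
      exact this.of_eq (by simp) rfl
  | mrg a' j x x' b' c h ih =>
    intro a i b hw
    rcases split_eq hw with ⟨rfl, h2, rfl⟩ | ⟨t, rfl, rfl⟩ | ⟨t, rfl, h3⟩
    · cases h2
      exact h.of_eq (by simp) rfl
    · have := Cost.mrg (a ++ t) j x x' b' _
        ((ih a i (t ++ ⟨j, x * x'⟩ :: b') (by simp)).of_eq (by simp) rfl)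
      exact this.of_eq (by simp) rfl
    · cases t with
      | nil =>
        simp only [List.nil_append, List.cons.injEq] at h3
        obtain ⟨h3, rfl⟩ := h3
        cases h3
        exact h.of_eq (by simp) rfl
      | cons y t =>
        simp only [List.cons_append, List.cons.injEq] at h3
        obtain ⟨rfl, rfl⟩ := h3
        have := Cost.mrg a' j x x' (t ++ b) _
          ((ih (a' ++ ⟨j, x * x'⟩ :: t) i b (by simp)).of_eq (by simp) rfl)
        exact this.of_eq (by simp) rfl

theorem Cost.append {w v : List (Σ i, M i)} {c d : ℝ} (h : Cost L w c) (hv : Cost L v d) :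
    Cost L (w ++ v) (c + d) := by
  induction h with
  | nil c hc => exact hv.mono _ (by linarith)
  | del a i g b c h ih =>
    exact (Cost.del a i g (b ++ v) _ (ih.of_eq (by simp) rfl)).of_eq (by simp) (by ring)
  | mrg a i g g' b c h ih =>
    exact (Cost.mrg a i g g' (b ++ v) _ (ih.of_eq (by simp) rfl)).of_eq (by simp) rfl

theorem Cost.conj (hL : IsLen L) {w : List (Σ i, M i)} {c : ℝ} (j : ι) (x : M j)
    (h : Cost L w c) : Cost L (⟨j, x⟩ :: (w ++ [⟨j, x⁻¹⟩])) c := by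
  induction h with
  | nil c hc =>
    refine .mrg [] j x x⁻¹ [] c ?_
    exact (Cost.del [] j (x * x⁻¹) [] c (.nil c hc)).of_eq rfl (by simp [hL.one])
  | del a i g b c h ih =>
    exact (Cost.del (⟨j, x⟩ :: a) i g (b ++ [⟨j, x⁻¹⟩]) _ (ih.of_eq (by simp) rfl)).of_eq
      (by simp) rfl
  | mrg a i g g' b c h ih =>
    exact (Cost.mrg (⟨j, x⟩ :: a) i g g' (b ++ [⟨j, x⁻¹⟩]) _ (ih.of_eq (by simp) rfl)).of_eq
      (by simp) rfl

/-- formal inverse of a word -/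
def winv (w : List (Σ i, M i)) : List (Σ i, M i) :=
  (w.map fun s => (⟨s.1, s.2⁻¹⟩ : Σ i, M i)).reverse

theorem Cost.winv (hL : IsLen L) {w : List (Σ i, M i)} {c : ℝ} (h : Cost L w c) :
    Cost L (winv w) c := by
  induction h with
  | nil c hc => exact .nil c hc
  | del a i g b c h ih =>
    exact (Cost.del (DenseFree.winv b) i g⁻¹ (DenseFree.winv a) _
      (ih.of_eq (by simp [DenseFree.winv]) rfl)).of_eq
      (by simp [DenseFree.winv]) (by rw [hL.inv])
  | mrg a i g g' b c h ih =>
    exact (Cost.mrg (DenseFree.winv b) i g'⁻¹ g⁻¹ (DenseFree.winv a) _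
      (ih.of_eq (by simp [DenseFree.winv]) rfl)).of_eq
      (by simp [DenseFree.winv]) rfl

/-- evaluation of a word -/
def ev (w : List (Σ i, M i)) : CoprodI M := (w.map fun s => CoprodI.of s.2).prod

theorem ev_append (w v : List (Σ i, M i)) : ev (w ++ v) = ev w * ev v := by simp [ev]

theorem ev_cons (s : Σ i, M i) (v : List (Σ i, M i)) : ev (s :: v) = CoprodI.of s.2 * ev v := by
  simp [ev]

theorem ev_nil : ev ([] : List (Σ i, M i)) = 1 := by simp [ev]

theorem ev_winv (w : List (Σ i, M i)) : ev (winv w) = (ev w)⁻¹ := by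
  induction w with
  | nil => simp [winv, ev]
  | cons s w ih =>
    have : winv (s :: w) = winv w ++ [⟨s.1, s.2⁻¹⟩] := by simp [winv]
    rw [this, ev_append, ih, ev_cons, ev_cons, ev_nil]; simp

theorem exists_reduced (hL : IsLen L) (n : ℕ) : ∀ (w : List (Σ i, M i)), w.length = n →
    ∃ v : CoprodI.Word M, v.prod = ev w ∧ ∀ c, Cost L w c → Cost L v.toList c := by
  induction n with
  | zero =>
    intro w hw
    obtain rfl := List.length_eq_zero_iff.1 hw
    exact ⟨CoprodI.Word.empty, by simp [ev], fun c h => h⟩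
  | succ n ih =>
    intro w hw
    by_cases h1 : ∃ s ∈ w, s.2 = 1
    · obtain ⟨⟨i, g⟩, hs, hg⟩ := h1
      obtain rfl : g = 1 := hg
      obtain ⟨a, b, rfl⟩ := List.append_of_mem hs
      obtain ⟨v, hv, hc⟩ := ih (a ++ b) (by simp at hw ⊢; omega)
      refine ⟨v, ?_, fun c h => hc c (h.del_one hL a i b rfl)⟩
      rw [hv, ev_append, ev_append, ev_cons]; simp
    · by_cases h2 : w.IsChain (fun l l' => l.1 ≠ l'.1)
      · exact ⟨⟨w, fun l hl h => h1 ⟨l, hl, h⟩, h2⟩, rfl, fun c h => h⟩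
      · have : ∃ a i, ∃ g g' : M i, ∃ b, w = a ++ ⟨i, g⟩ :: ⟨i, g'⟩ :: b := by
          clear ih hw h1
          induction w with
          | nil => simp at h2
          | cons s w ih =>
            by_cases h3 : w.IsChain (fun l l' => l.1 ≠ l'.1)
            · cases w with
              | nil => simp at h2
              | cons t w =>
                have : s.1 = t.1 := by
                  by_contra hne
                  exact h2 (List.isChain_cons_cons.2 ⟨hne, h3⟩)
                obtain ⟨i, g⟩ := s
                obtain ⟨j, g'⟩ := t
                simp only at this
                subst this
                exact ⟨[], i, g, g', w, rfl⟩
            · obtain ⟨a, i, g, g', b, rfl⟩ := ih h3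
              exact ⟨s :: a, i, g, g', b, rfl⟩
        obtain ⟨a, i, g, g', b, rfl⟩ := this
        obtain ⟨v, hv, hc⟩ := ih (a ++ ⟨i, g * g'⟩ :: b) (by simp at hw ⊢; omega)
        refine ⟨v, ?_, fun c h => hc c (h.merge hL a i g g' b rfl)⟩
        rw [hv, ev_append, ev_append, ev_cons, ev_cons, ev_cons]; simp [mul_assoc]

theorem Cost.reduced (hL : IsLen L) {w : List (Σ i, M i)} {c : ℝ} (h : Cost L w c)
    (hw : w.IsChain (fun l l' => l.1 ≠ l'.1)) (hne : w ≠ []) : ∃ s ∈ w, L s.1 s.2 ≤ c := by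
  cases h with
  | nil c hc => simp at hne
  | del a i g b c h =>
    exact ⟨⟨i, g⟩, by simp, by have := h.nonneg hL; simp only; linarith⟩
  | mrg a i g g' b c h =>
    have := (List.isChain_append.1 hw).2.1
    simp at this

/-- the length function on the free product -/
noncomputable def nm (L : ∀ i, M i → ℝ) (x : CoprodI M) : ℝ :=
  sInf {c | ∃ w, ev w = x ∧ Cost L w c}

theorem nm_nonempty (x : CoprodI M) : {c | ∃ w, ev w = x ∧ Cost L w c}.Nonempty := by
  classical
  obtain ⟨c, hc⟩ := Cost.exists (L := L) (CoprodI.Word.equiv x).toList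
  exact ⟨c, _, CoprodI.Word.equiv.symm_apply_apply x, hc⟩

theorem nm_bdd (hL : IsLen L) (x : CoprodI M) :
    BddBelow {c | ∃ w, ev w = x ∧ Cost L w c} :=
  ⟨0, fun _ ⟨_, _, h⟩ => h.nonneg hL⟩

theorem nm_nonneg (hL : IsLen L) (x : CoprodI M) : 0 ≤ nm L x :=
  le_csInf (nm_nonempty x) fun _ ⟨_, _, h⟩ => h.nonneg hL

theorem nm_le (hL : IsLen L) {w : List (Σ i, M i)} {c : ℝ} (h : Cost L w c) : nm L (ev w) ≤ c :=
  csInf_le (nm_bdd hL _) ⟨w, rfl, h⟩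

theorem nm_one (hL : IsLen L) : nm L (1 : CoprodI M) = 0 :=
  le_antisymm (by have := nm_le hL (Cost.nil (L := L) 0 le_rfl); rwa [ev_nil] at this)
    (nm_nonneg hL 1)

theorem nm_mul (hL : IsLen L) (x y : CoprodI M) : nm L (x * y) ≤ nm L x + nm L y := by
  refine le_of_forall_pos_le_add fun e he => ?_
  obtain ⟨c, ⟨w, rfl, hw⟩, hc⟩ := exists_lt_of_csInf_lt (nm_nonempty (L := L) x)
    (show nm L x < nm L x + e / 2 by linarith)
  obtain ⟨d, ⟨v, rfl, hv⟩, hd⟩ := exists_lt_of_csInf_lt (nm_nonempty (L := L) y)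
    (show nm L y < nm L y + e / 2 by linarith)
  have := nm_le hL (hw.append hv)
  rw [ev_append] at this
  linarith

theorem nm_inv (hL : IsLen L) (x : CoprodI M) : nm L x⁻¹ = nm L x := by
  have key : ∀ x : CoprodI M, nm L x⁻¹ ≤ nm L x := by
    intro x
    refine le_csInf (nm_nonempty x) ?_
    rintro c ⟨w, rfl, h⟩
    rw [← ev_winv]
    exact nm_le hL (h.winv hL)
  refine le_antisymm (key x) ?_
  simpa using key x⁻¹

theorem nm_conj (hL : IsLen L) (g x : CoprodI M) : nm L (g * x * g⁻¹) = nm L x := by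
  have key : ∀ g x : CoprodI M, nm L (g * x * g⁻¹) ≤ nm L x := by
    intro g
    induction g using CoprodI.induction_on with
    | one => intro x; simp
    | of i m =>
      intro x
      refine le_csInf (nm_nonempty x) ?_
      rintro c ⟨w, rfl, h⟩
      have := nm_le hL (h.conj hL i m)
      simpa [ev_cons, ev_append, ev_nil, mul_assoc] using this
    | mul a b ha hb =>
      intro x
      have := (ha (b * x * b⁻¹)).trans (hb x)
      simpa [mul_assoc] using this
  refine le_antisymm (key g x) ?_
  simpa [mul_assoc] using key g⁻¹ (g * x * g⁻¹)

theorem exists_le_nm (hL : IsLen L) (v : CoprodI.Word M) (hv : v.toList ≠ []) :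
    ∃ s ∈ v.toList, L s.1 s.2 ≤ nm L v.prod := by
  classical
  by_contra! hcon
  obtain ⟨s, hs, hmin⟩ := v.toList.toFinset.exists_min_image (fun s => L s.1 s.2)
    (by simpa [Finset.nonempty_iff_ne_empty] using hv)
  refine absurd (hcon s (by simpa using hs)) (not_lt.2 ?_)
  refine le_csInf (nm_nonempty _) ?_
  rintro c ⟨w, hw, h⟩
  obtain ⟨u, hu, hc⟩ := exists_reduced hL _ w rfl
  have huv : u = v := CoprodI.Word.equiv.symm.injective (hu.trans hw)
  subst huv
  obtain ⟨t, ht, htc⟩ := (hc c h).reduced hL u.chain_ne hv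
  exact (hmin t (by simpa using ht)).trans htc

theorem nm_pos (hL : IsLen L) (x : CoprodI M) (hx : nm L x = 0) : x = 1 := by
  classical
  obtain ⟨v, rfl⟩ := CoprodI.Word.equiv.symm.surjective x
  by_contra hne
  have hv : v.toList ≠ [] := by
    intro h
    apply hne
    change (v.toList.map fun l => CoprodI.of l.snd).prod = 1
    simp [h]
  obtain ⟨s, hs, h⟩ := exists_le_nm hL v hv
  have := hL.pos s.1 s.2 (v.ne_one s hs)
  change nm L v.prod = 0 at hx
  linarith

theorem nm_of (hL : IsLen L) {i : ι} (g : M i) : nm L (CoprodI.of g) = L i g := by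
  apply le_antisymm
  · have := nm_le hL (Cost.del [] i g [] 0 (Cost.nil (L := L) 0 le_rfl))
    simpa [ev] using this
  · by_cases hg : g = 1
    · subst hg
      rw [hL.one]; exact nm_nonneg hL _
    · obtain ⟨s, hs, h⟩ := exists_le_nm hL (⟨[⟨i, g⟩], by simpa using hg, by simp⟩ : CoprodI.Word M)
        (by simp)
      simp only [List.mem_singleton] at hs
      subst hs
      simpa [CoprodI.Word.prod] using h

end Cost

/-- the factors: `G` and countably many copies of `ℤ` -/
def Fac (G : Type) : Option ℕ → Type
  | none => G
  | some _ => Multiplicative ℤ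

instance (G : Type) [Group G] : ∀ i, Group (Fac G i)
  | none => inferInstanceAs (Group G)
  | some _ => inferInstanceAs (Group (Multiplicative ℤ))

/-- a conjugation-invariant length function on a group -/
structure Len1 {H : Type} [Group H] (l : H → ℝ) : Prop where
  one : l 1 = 0
  nonneg : ∀ g, 0 ≤ l g
  inv : ∀ g, l g⁻¹ = l g
  mul : ∀ g h, l (g * h) ≤ l g + l h
  conj : ∀ g h, l (g * h * g⁻¹) = l h
  pos : ∀ g, g ≠ 1 → 0 < l g

/-- the length on `ℤ` -/
noncomputable def lenZ (e : ℝ) (k : Multiplicative ℤ) : ℝ := e * |((Multiplicative.toAdd k : ℤ) : ℝ)|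

theorem len1_Z (e : ℝ) (he : 0 < e) : Len1 (lenZ e) where
  one := by simp [lenZ]
  nonneg g := mul_nonneg he.le (abs_nonneg _)
  inv g := by simp [lenZ]
  mul g h := by
    simp only [lenZ, toAdd_mul, Int.cast_add]
    rw [← mul_add]
    exact mul_le_mul_of_nonneg_left (abs_add_le _ _) he.le
  conj g h := by rw [mul_inv_cancel_comm]
  pos g hg := by
    refine mul_pos he (abs_pos.2 ?_)
    intro h
    apply hg
    have h' : Multiplicative.toAdd g = 0 := by exact_mod_cast h
    exact toAdd_eq_zero.1 h'

theorem len1_G (G : Type) [Group G] [MetricSpace G] (hbi : BiInvariantDist G) :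
    Len1 (fun g : G => dist g 1) where
  one := dist_self _
  nonneg g := dist_nonneg
  inv g := by
    rw [← (hbi g g⁻¹ 1).1, mul_inv_cancel, mul_one, dist_comm]
  mul g h := by
    have := dist_triangle (g * h) h 1
    have h2 := (hbi h g 1).2
    rw [one_mul] at h2
    linarith
  conj g h := by
    rw [← (hbi g _ 1).2, inv_mul_cancel_right, one_mul]
    have := (hbi g h 1).1
    rwa [mul_one] at this
  pos g hg := dist_pos.2 hg

/-- lengths on the factors -/
noncomputable def len (G : Type) [Group G] [MetricSpace G] (e : ℕ → ℝ) : ∀ i, Fac G i → ℝ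
  | none => fun g : G => dist g 1
  | some n => lenZ (e n)

theorem isLen (G : Type) [Group G] [MetricSpace G] (hbi : BiInvariantDist G) (e : ℕ → ℝ)
    (he : ∀ n, 0 < e n) : IsLen (len G e) := by
  have h : ∀ i, Len1 (len G e i) := fun i =>
    match i with
    | none => len1_G G hbi
    | some n => len1_Z (e n) (he n)
  exact ⟨fun i => (h i).one, fun i => (h i).nonneg, fun i => (h i).inv, fun i => (h i).mul,
    fun i => (h i).conj, fun i => (h i).pos⟩

/-- the embedding `G → ∗ Fac` -/
def inG (G : Type) [Group G] : G →* CoprodI (Fac G) := CoprodI.of (M := Fac G) (i := none)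

/-- the new generators -/
def hh (G : Type) [Group G] (n : ℕ) : CoprodI (Fac G) :=
  CoprodI.of (M := Fac G) (i := some n) (Multiplicative.ofAdd (1 : ℤ) : Multiplicative ℤ)

/-- the twisted hom -/
noncomputable def phi (G : Type) [Group G] (s : ℕ → G) :
    Monoid.Coprod G (FreeGroup ℕ) →* CoprodI (Fac G) :=
  Monoid.Coprod.lift (inG G) (FreeGroup.lift fun n => hh G n * inG G (s n))

/-- components of the inverse -/
noncomputable def psiAux (G : Type) [Group G] (s : ℕ → G) :
    ∀ i, Fac G i →* Monoid.Coprod G (FreeGroup ℕ)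
  | none => (Monoid.Coprod.inl : G →* Monoid.Coprod G (FreeGroup ℕ))
  | some n => (zpowersHom (Monoid.Coprod G (FreeGroup ℕ))
      (Monoid.Coprod.inr (FreeGroup.of n) * (Monoid.Coprod.inl (s n))⁻¹) :
        Multiplicative ℤ →* Monoid.Coprod G (FreeGroup ℕ))

theorem psi_hh (G : Type) [Group G] (s : ℕ → G) (n : ℕ) :
    CoprodI.lift (psiAux G s) (hh G n) =
      Monoid.Coprod.inr (FreeGroup.of n) * (Monoid.Coprod.inl (s n))⁻¹ := by
  refine (CoprodI.lift_of (psiAux G s) (i := some n) _).trans ?_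
  change (zpowersHom (Monoid.Coprod G (FreeGroup ℕ)) _ : Multiplicative ℤ →* _)
    (Multiplicative.ofAdd (1 : ℤ)) = _
  simp

theorem psi_inG (G : Type) [Group G] (s : ℕ → G) (g : G) :
    CoprodI.lift (psiAux G s) (inG G g) = Monoid.Coprod.inl g := by
  exact CoprodI.lift_of (psiAux G s) (i := none) _

theorem phi_inj (G : Type) [Group G] (s : ℕ → G) : Function.Injective (phi G s) := by
  have : (CoprodI.lift (psiAux G s)).comp (phi G s) = MonoidHom.id _ := by
    apply Monoid.Coprod.hom_ext
    · ext g
      simp [phi, psi_inG]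
    · ext n
      simp [phi, psi_inG, psi_hh]
  intro x y h
  have h2 := congrArg (CoprodI.lift (psiAux G s)) h
  have h3 := fun z => DFunLike.congr_fun this z
  simp only [MonoidHom.comp_apply, MonoidHom.id_apply] at h3
  rwa [h3, h3] at h2

/-- the metric -/
@[reducible]
noncomputable def theMetric (G : Type) [Group G] [MetricSpace G] (hbi : BiInvariantDist G)
    (s : ℕ → G) (e : ℕ → ℝ) (he : ∀ n, 0 < e n) : MetricSpace (Monoid.Coprod G (FreeGroup ℕ)) where
  dist x y := nm (len G e) ((phi G s x)⁻¹ * phi G s y)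
  dist_self x := by
    rw [inv_mul_cancel, nm_one (isLen G hbi e he)]
  dist_comm x y := by
    rw [← nm_inv (isLen G hbi e he)]; simp
  dist_triangle x y z := by
    have := nm_mul (isLen G hbi e he) ((phi G s x)⁻¹ * phi G s y) ((phi G s y)⁻¹ * phi G s z)
    simpa [mul_assoc] using this
  eq_of_dist_eq_zero {x y} h := by
    have := nm_pos (isLen G hbi e he) _ h
    exact phi_inj G s (inv_mul_eq_one.1 this)

end DenseFree

/-- For any separable group `G` with bi-invariant metric there is a
bi-invariant metric on the free product `G ∗ F_∞` (`F_∞` the free group on countably many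
generators) extending the metric of `G`, such that the canonical copy of `F_∞` is dense. -/
theorem exists_dense_free_factor (G : Type) [Group G] [MetricSpace G]
    (hbi : BiInvariantDist G) (hsep : TopologicalSpace.SeparableSpace G) :
    ∃ _ : MetricSpace (Monoid.Coprod G (FreeGroup ℕ)),
      BiInvariantDist (Monoid.Coprod G (FreeGroup ℕ)) ∧
      Isometry ⇑(Monoid.Coprod.inl : G →* Monoid.Coprod G (FreeGroup ℕ)) ∧
      Dense (Set.range ⇑(Monoid.Coprod.inr : FreeGroup ℕ →* Monoid.Coprod G (FreeGroup ℕ))) := by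
  classical
  obtain ⟨s, hs⟩ := TopologicalSpace.exists_dense_seq G
  let s' : ℕ → G := fun n => s n.unpair.1
  let e : ℕ → ℝ := fun n => 1 / ((n.unpair.2 : ℝ) + 1)
  have he : ∀ n, 0 < e n := fun n => by positivity
  have hL := DenseFree.isLen G hbi e he
  letI := DenseFree.theMetric G hbi s' e he
  have hd : ∀ x y : Monoid.Coprod G (FreeGroup ℕ), dist x y =
      DenseFree.nm (DenseFree.len G e) ((DenseFree.phi G s' x)⁻¹ * DenseFree.phi G s' y) :=
    fun _ _ => rfl
  have hB : BiInvariantDist (Monoid.Coprod G (FreeGroup ℕ)) := by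
    intro g x y
    constructor
    · rw [hd, hd]
      congr 1
      simp only [map_mul]
      group
    · rw [hd, hd, ← DenseFree.nm_conj hL (DenseFree.phi G s' g)⁻¹
        ((DenseFree.phi G s' x)⁻¹ * DenseFree.phi G s' y)]
      congr 1
      simp only [map_mul]
      group
  have hI : Isometry ⇑(Monoid.Coprod.inl : G →* Monoid.Coprod G (FreeGroup ℕ)) := by
    refine Isometry.of_dist_eq fun x y => ?_
    rw [hd]
    have h1 : (DenseFree.phi G s' (Monoid.Coprod.inl x))⁻¹ *
        DenseFree.phi G s' (Monoid.Coprod.inl y) = DenseFree.inG G (x⁻¹ * y) := by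
      simp [DenseFree.phi]
    rw [h1]
    refine (DenseFree.nm_of hL (i := none) (x⁻¹ * y : G)).trans ?_
    change dist (x⁻¹ * y) 1 = dist x y
    rw [← (hbi x _ _).1, mul_inv_cancel_left, mul_one, dist_comm]
  refine ⟨inferInstance, hB, hI, ?_⟩
  have hgen : ∀ n, dist (Monoid.Coprod.inl (s' n) : Monoid.Coprod G (FreeGroup ℕ))
      (Monoid.Coprod.inr (FreeGroup.of n)) = e n := by
    intro n
    rw [hd]
    have h1 : (DenseFree.phi G s' (Monoid.Coprod.inl (s' n)))⁻¹ *
        DenseFree.phi G s' (Monoid.Coprod.inr (FreeGroup.of n)) =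
        (DenseFree.inG G (s' n))⁻¹ * DenseFree.hh G n * ((DenseFree.inG G (s' n))⁻¹)⁻¹ := by
      simp [DenseFree.phi, mul_assoc]
    rw [h1, DenseFree.nm_conj hL]
    refine (DenseFree.nm_of hL (i := some n) _).trans ?_
    change DenseFree.lenZ (e n) (Multiplicative.ofAdd (1 : ℤ)) = e n
    simp [DenseFree.lenZ]
  have key : ∀ x : Monoid.Coprod G (FreeGroup ℕ), ∀ r > 0, ∃ f : FreeGroup ℕ,
      dist x (Monoid.Coprod.inr f) < r := by
    intro x
    induction x using Monoid.Coprod.induction_on with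
    | inl g =>
      intro r hr
      obtain ⟨m, hm⟩ := hs.exists_dist_lt g (half_pos hr)
      obtain ⟨k, hk⟩ := exists_nat_one_div_lt (half_pos hr)
      refine ⟨FreeGroup.of (Nat.pair m k), ?_⟩
      have h1 := hgen (Nat.pair m k)
      have h2 : s' (Nat.pair m k) = s m := by simp [s']
      have h3 : e (Nat.pair m k) = 1 / ((k : ℝ) + 1) := by simp [e]
      rw [h2, h3] at h1
      have h4 := dist_triangle (Monoid.Coprod.inl g : Monoid.Coprod G (FreeGroup ℕ))
        (Monoid.Coprod.inl (s m)) (Monoid.Coprod.inr (FreeGroup.of (Nat.pair m k)))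
      rw [hI.dist_eq] at h4
      linarith
    | inr f => intro r hr; exact ⟨f, by simpa using hr⟩
    | mul x y hx hy =>
      intro r hr
      obtain ⟨f, hf⟩ := hx _ (half_pos hr)
      obtain ⟨f', hf'⟩ := hy _ (half_pos hr)
      refine ⟨f * f', ?_⟩
      have h := dist_triangle (x * y) (Monoid.Coprod.inr f * y)
        (Monoid.Coprod.inr f * Monoid.Coprod.inr f')
      rw [(hB y x _).2, (hB _ y _).1] at h
      rw [map_mul]
      linarith
  rw [Metric.dense_iff]
  intro x r hr
  obtain ⟨f, hf⟩ := key x r hr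
  exact ⟨_, by rw [Metric.mem_ball, dist_comm]; exact hf, f, rfl⟩
end

section
/- Let K > 0 and let (G, d) be a separable group equipped with a bi-invariant metric d bounded by K. Then there exists a bi-invariant metric d̄ bounded by K on the free product G ∗ F_∞, where F_∞ is the free group on countably many generators, such that the canonical embedding of G into G ∗ F_∞ is an isometry from (G, d) onto its image in (G ∗ F_∞, d̄), and the canonical copy of F_∞ inside G ∗ F_∞ is dense in (G ∗ F_∞, d̄). -/
namespace FreeNorm

open Monoid

/-- A conjugation-invariant norm on each member of a family of groups. -/
structure NormFam {ι : Type*} (H : ι → Type*) [∀ i, Group (H i)] (N : ∀ i, H i → ℝ) : Prop where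
  one : ∀ i, N i 1 = 0
  nonneg : ∀ i x, 0 ≤ N i x
  mul : ∀ i x y, N i (x * y) ≤ N i x + N i y
  inv : ∀ i x, N i x⁻¹ = N i x
  conj : ∀ i x y, N i (x * y * x⁻¹) = N i y

section
variable {ι : Type*} {H : ι → Type*} [∀ i, Group (H i)] {N : ∀ i, H i → ℝ}

/-- Two words of the same shape at total distance at most `c`. -/
inductive WRel (N : ∀ i, H i → ℝ) : List (Σ i, H i) → List (Σ i, H i) → ℝ → Prop
  | nil (c : ℝ) (hc : 0 ≤ c) : WRel N [] [] c
  | cons (i : ι) (x y : H i) (a b : List (Σ i, H i)) (c c' : ℝ) (h : WRel N a b c)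
      (hc : N i (x⁻¹ * y) + c ≤ c') : WRel N (⟨i, x⟩ :: a) (⟨i, y⟩ :: b) c'

/-- The element represented by a word. -/
def wprod (a : List (Σ i, H i)) : CoprodI H := (a.map fun l => CoprodI.of l.2).prod

/-- The inverse word. -/
def winv (a : List (Σ i, H i)) : List (Σ i, H i) := (a.map fun l => ⟨l.1, l.2⁻¹⟩).reverse

/-- Reduced words. -/
def Red (a : List (Σ i, H i)) : Prop :=
  (∀ l ∈ a, l.2 ≠ 1) ∧ a.IsChain fun l l' => l.1 ≠ l'.1

@[simp] lemma wprod_nil : wprod ([] : List (Σ i, H i)) = 1 := rfl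

@[simp] lemma wprod_cons (l : Σ i, H i) (a : List (Σ i, H i)) :
    wprod (l :: a) = CoprodI.of l.2 * wprod a := by simp [wprod]

@[simp] lemma wprod_append (a b : List (Σ i, H i)) :
    wprod (a ++ b) = wprod a * wprod b := by simp [wprod]

@[simp] lemma winv_nil : winv ([] : List (Σ i, H i)) = [] := rfl

@[simp] lemma winv_cons (l : Σ i, H i) (a : List (Σ i, H i)) :
    winv (l :: a) = winv a ++ [⟨l.1, l.2⁻¹⟩] := by simp [winv]

@[simp] lemma wprod_winv (a : List (Σ i, H i)) : wprod (winv a) = (wprod a)⁻¹ := by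
  induction a with
  | nil => simp
  | cons l a ih => simp [ih]

lemma winv_append (a b : List (Σ i, H i)) : winv (a ++ b) = winv b ++ winv a := by
  simp [winv]

lemma exists_red (u : CoprodI H) : ∃ a : List (Σ i, H i), Red a ∧ wprod a = u := by
  classical
  refine ⟨(CoprodI.Word.equiv u).toList, ⟨(CoprodI.Word.equiv u).ne_one,
    (CoprodI.Word.equiv u).chain_ne⟩, ?_⟩
  exact CoprodI.Word.equiv.symm_apply_apply u

lemma red_unique {a b : List (Σ i, H i)} (ha : Red a) (hb : Red b) (h : wprod a = wprod b) :
    a = b := by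
  classical
  have : (⟨a, ha.1, ha.2⟩ : CoprodI.Word H) = ⟨b, hb.1, hb.2⟩ :=
    CoprodI.Word.equiv.symm.injective h
  exact congrArg CoprodI.Word.toList this

lemma red_or (a : List (Σ i, H i)) : Red a ∨ (∃ i P Q, a = P ++ (⟨i, 1⟩ : Σ i, H i) :: Q) ∨
    (∃ i x y P Q, a = P ++ (⟨i, x⟩ : Σ i, H i) :: ⟨i, y⟩ :: Q) := by
  by_cases h1 : ∀ l ∈ a, l.2 ≠ 1
  · by_cases h2 : a.IsChain fun l l' => l.1 ≠ l'.1
    · exact Or.inl ⟨h1, h2⟩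
    · right; right
      clear h1
      induction a with
      | nil => simp at h2
      | cons l a ih =>
        cases a with
        | nil => simp at h2
        | cons m a =>
          by_cases h : l.1 = m.1
          · obtain ⟨i, x⟩ := l
            obtain ⟨j, y⟩ := m
            obtain rfl : i = j := h
            exact ⟨i, x, y, [], a, rfl⟩
          · obtain ⟨i, x, y, P, Q, hP⟩ := ih (fun hh => h2 (List.isChain_cons_cons.2 ⟨h, hh⟩))
            exact ⟨i, x, y, l :: P, Q, by rw [hP]; rfl⟩
  · right; left
    push Not at h1
    obtain ⟨⟨i, x⟩, hl, hx⟩ := h1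
    obtain ⟨P, Q, h⟩ := List.append_of_mem hl
    simp only at hx
    rw [hx] at h
    exact ⟨i, P, Q, h⟩

lemma conj_normal (hN : NormFam H N) (i : ι) (v : List (Σ i, H i)) : Red v → ∀ h : H i, h ≠ 1 →
    ∃ (v' : List (Σ i, H i)) (h' : H i), N i h' = N i h ∧
      Red (v' ++ ⟨i, h'⟩ :: winv v') ∧
      wprod v' * CoprodI.of h' * (wprod v')⁻¹ = wprod v * CoprodI.of h * (wprod v)⁻¹ := by
  induction v using List.reverseRecOn with
  | nil =>
    intro _ h hh
    refine ⟨[], h, rfl, ⟨by simpa using hh, by simp⟩, rfl⟩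
  | append_singleton v l ih =>
    intro hv h hh
    obtain ⟨j, x⟩ := l
    by_cases hj : j = i
    · subst hj
      have hv0 : Red v := ⟨fun l hl => hv.1 l (by simp [hl]), hv.2.left_of_append⟩
      obtain ⟨v', h', h1, h2, h3⟩ := ih hv0 (x * h * x⁻¹) (by simpa using hh)
      refine ⟨v', h', by rw [h1, hN.conj], h2, ?_⟩
      rw [h3]; simp [mul_assoc]
    · refine ⟨v ++ [⟨j, x⟩], h, rfl, ⟨?_, ?_⟩, rfl⟩
      · intro l hl
        simp only [List.mem_append, List.mem_cons, winv, List.mem_reverse, List.mem_map] at hl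
        rcases hl with hl | rfl | ⟨m, hm, rfl⟩
        · exact hv.1 l (by simpa using hl)
        · exact hh
        · have := hv.1 m (by simpa using hm)
          simpa using this
      · have hr : (winv (v ++ [⟨j, x⟩])).IsChain fun l l' => l.1 ≠ l'.1 := by
          rw [winv, List.isChain_reverse, List.isChain_map]
          exact hv.2.imp fun a b hab => hab.symm
        rw [winv_append] at hr ⊢
        simp only [winv_cons, winv_nil, List.nil_append, List.append_assoc, List.cons_append] at hr ⊢
        rw [List.isChain_append_cons_cons]
        refine ⟨hv.2, hj, ?_⟩
        rw [List.isChain_cons_cons]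
        exact ⟨fun h => hj h.symm, hr⟩

lemma WRel.mono {a b : List (Σ i, H i)} {c c' : ℝ} (h : WRel N a b c) (hc : c ≤ c') :
    WRel N a b c' := by
  cases h with
  | nil _ h => exact .nil _ (h.trans hc)
  | cons i x y a b c0 _ h h' => exact .cons i x y a b c0 _ h (h'.trans hc)

lemma WRel.refl (hN : NormFam H N) (a : List (Σ i, H i)) : WRel N a a 0 := by
  induction a with
  | nil => exact .nil _ le_rfl
  | cons l a ih => exact .cons l.1 l.2 l.2 a a 0 0 ih (by simp [hN.one])

lemma WRel.nonneg (hN : NormFam H N) {a b : List (Σ i, H i)} {c : ℝ} (h : WRel N a b c) :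
    0 ≤ c := by
  induction h with
  | nil _ h => exact h
  | cons i x y a b c0 c1 h h' ih => linarith [hN.nonneg i (x⁻¹ * y)]

lemma WRel.append {a b a' b' : List (Σ i, H i)} {c c' : ℝ} (h : WRel N a b c)
    (h' : WRel N a' b' c') : WRel N (a ++ a') (b ++ b') (c + c') := by
  induction h with
  | nil _ h => exact h'.mono (by linarith)
  | cons i x y a b c0 c1 h hc ih => exact .cons i x y _ _ _ _ ih (by linarith)

lemma WRel.split {P Q : List (Σ i, H i)} : ∀ {b : List (Σ i, H i)} {c : ℝ}, WRel N (P ++ Q) b c →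
    ∃ P' Q' c1 c2, b = P' ++ Q' ∧ WRel N P P' c1 ∧ WRel N Q Q' c2 ∧ c1 + c2 ≤ c := by
  induction P with
  | nil => intro b c h; exact ⟨[], b, 0, c, rfl, .nil _ le_rfl, h, by simp⟩
  | cons l P ih =>
    intro b c h
    cases h with
    | cons i x y a b c0 _ h hc =>
      obtain ⟨P', Q', c1, c2, rfl, h1, h2, h3⟩ := ih h
      exact ⟨⟨i, y⟩ :: P', Q', N i (x⁻¹ * y) + c1, c2, rfl, .cons i x y _ _ _ _ h1 le_rfl, h2,
        by linarith⟩

lemma WRel.trans (hN : NormFam H N) {a b : List (Σ i, H i)} {c : ℝ} (h : WRel N a b c) :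
    ∀ {d : List (Σ i, H i)} {c' : ℝ}, WRel N b d c' → WRel N a d (c + c') := by
  induction h with
  | nil _ h => intro d c' h'; exact h'.mono (by linarith)
  | cons i x y a b c0 c1 h hc ih =>
    intro d c' h'
    cases h' with
    | cons _ _ z _ d c2 _ h2 hc2 =>
      refine .cons i x z _ _ _ _ (ih h2) ?_
      have := hN.mul i (x⁻¹ * y) (y⁻¹ * z)
      have e : x⁻¹ * y * (y⁻¹ * z) = x⁻¹ * z := by group
      rw [e] at this
      linarith

lemma WRel.winv (hN : NormFam H N) {a b : List (Σ i, H i)} {c : ℝ} (h : WRel N a b c) :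
    WRel N (winv a) (winv b) c := by
  induction h with
  | nil _ h => exact .nil _ h
  | cons i x y a b c0 c1 h hc ih =>
    rw [winv_cons, winv_cons]
    have h1 : WRel N [⟨i, x⁻¹⟩] [⟨i, y⁻¹⟩] (N i (x⁻¹ * y)) := by
      refine .cons i _ _ _ _ 0 _ (.nil _ le_rfl) ?_
      rw [← hN.inv, ← hN.conj i x⁻¹]
      simp [mul_assoc]
    exact (ih.append h1).mono (by linarith)

/-- A word representing a conjugate of a letter `h` can be made trivial at cost `N h`. -/
lemma conj_fix (hN : NormFam H N) (i : ι) (h : H i) (u : CoprodI H) :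
    ∀ (n : ℕ) (X : List (Σ i, H i)), X.length = n → wprod X = u * CoprodI.of h * u⁻¹ →
      ∃ X', wprod X' = 1 ∧ WRel N X X' (N i h) := by
  intro n
  induction n using Nat.strong_induction_on with
  | _ n ih =>
  intro X hn hX
  by_cases hh : h = 1
  · subst hh
    exact ⟨X, by simpa using hX, (WRel.refl hN X).mono (hN.nonneg _ _)⟩
  rcases red_or X with hr | ⟨j, P, Q, rfl⟩ | ⟨j, x, y, P, Q, rfl⟩
  · obtain ⟨v, hv, hvu⟩ := exists_red u
    obtain ⟨v', h', h1, h2, h3⟩ := conj_normal hN i v hv h hh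
    have : X = v' ++ ⟨i, h'⟩ :: FreeNorm.winv v' := by
      apply red_unique hr h2
      rw [hX, ← hvu, ← h3]
      simp [mul_assoc]
    subst this
    refine ⟨v' ++ ⟨i, 1⟩ :: FreeNorm.winv v', by simp, ?_⟩
    have := (WRel.refl hN v').append (.cons i h' 1 _ _ _ _ (WRel.refl hN (FreeNorm.winv v')) le_rfl)
    refine this.mono ?_
    simp [hN.inv, h1]
  · simp only [List.length_append, List.length_cons] at hn
    obtain ⟨X', h1, h2⟩ := ih (P ++ Q).length (by simp; omega) (P ++ Q) rfl (by simpa using hX)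
    obtain ⟨P', Q', c1, c2, rfl, h3, h4, h5⟩ := h2.split
    refine ⟨P' ++ ⟨j, 1⟩ :: Q', by simpa using h1, ?_⟩
    exact (h3.append (.cons j 1 1 _ _ _ _ h4 le_rfl)).mono (by simpa [hN.one] using h5)
  · simp only [List.length_append, List.length_cons] at hn
    obtain ⟨X', h1, h2⟩ := ih (P ++ ⟨j, x * y⟩ :: Q).length (by simp; omega) _ rfl
      (by simpa [mul_assoc] using hX)
    obtain ⟨P', Q', c1, c2, rfl, h3, h4, h5⟩ := h2.split
    cases h4 with
    | cons _ _ z _ Q' c3 _ h6 h7 =>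
    refine ⟨P' ++ ⟨j, x⟩ :: ⟨j, x⁻¹ * z⟩ :: Q', by simpa [mul_assoc] using h1, ?_⟩
    refine (h3.append (.cons j x x _ _ _ _ (.cons j y (x⁻¹ * z) _ _ _ _ h6 le_rfl) le_rfl)).mono ?_
    have e : y⁻¹ * (x⁻¹ * z) = (x * y)⁻¹ * z := by group
    rw [e]
    simp only [inv_mul_cancel, hN.one]
    linarith

/-- Reduction of the first word of a pair. -/
lemma reduce_pair (hN : NormFam H N) (c : ℝ) :
    ∀ (n : ℕ) (a b : List (Σ i, H i)), a.length = n → WRel N a b c → wprod b = 1 →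
      ∃ a' b', Red a' ∧ wprod a' = wprod a ∧ wprod b' = 1 ∧ WRel N a' b' c := by
  intro n
  induction n using Nat.strong_induction_on with
  | _ n ih =>
  intro a b hn hab hb
  rcases red_or a with hr | ⟨j, P, Q, rfl⟩ | ⟨j, x, y, P, Q, rfl⟩
  · exact ⟨a, b, hr, rfl, hb, hab⟩
  · obtain ⟨P', R, c1, c2, rfl, h3, h4, h5⟩ := hab.split
    cases h4 with
    | cons _ _ z _ Q' c3 _ h6 h7 =>
    simp only [List.length_append, List.length_cons] at hn
    have hc : wprod (P' ++ Q') = wprod P' * CoprodI.of z⁻¹ * (wprod P')⁻¹ := by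
      simp only [wprod_append, wprod_cons] at hb ⊢
      have h1 : CoprodI.of z * wprod Q' = (wprod P')⁻¹ := (inv_eq_of_mul_eq_one_right hb).symm
      rw [← h1, map_inv]
      group
    obtain ⟨X', h8, h9⟩ := conj_fix hN j z⁻¹ _ _ _ rfl hc
    obtain ⟨a', b', h10, h11, h12, h13⟩ := ih (P ++ Q).length (by simp; omega) (P ++ Q) X' rfl
      ((WRel.trans hN (h3.append h6) h9).mono (by
        rw [hN.inv]; simp only [inv_one, one_mul] at h7; linarith)) h8
    exact ⟨a', b', h10, by simpa using h11, h12, h13⟩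
  · obtain ⟨P', R, c1, c2, rfl, h3, h4, h5⟩ := hab.split
    cases h4 with
    | cons _ _ z _ Q' c3 _ h6 h7 =>
    cases h6 with
    | cons _ _ t _ Q' c4 _ h8 h9 =>
    simp only [List.length_append, List.length_cons] at hn
    have key : N j ((x * y)⁻¹ * (z * t)) ≤ N j (x⁻¹ * z) + N j (y⁻¹ * t) := by
      have e : (x * y)⁻¹ * (z * t) = (y⁻¹ * (x⁻¹ * z) * y⁻¹⁻¹) * (y⁻¹ * t) := by group
      rw [e]
      refine (hN.mul _ _ _).trans ?_
      rw [hN.conj]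
    obtain ⟨a', b', h10, h11, h12, h13⟩ := ih (P ++ ⟨j, x * y⟩ :: Q).length (by simp; omega)
      (P ++ ⟨j, x * y⟩ :: Q) (P' ++ ⟨j, z * t⟩ :: Q') rfl
      ((h3.append (.cons j (x * y) (z * t) _ _ _ _ h8 le_rfl)).mono (by linarith))
      (by simpa [mul_assoc] using hb)
    exact ⟨a', b', h10, by simpa [mul_assoc] using h11, h12, h13⟩

lemma exists_delta (hN : NormFam H N) (hpos : ∀ i x, N i x = 0 → x = 1) (a : List (Σ i, H i))
    (ha : ∀ l ∈ a, l.2 ≠ 1) : ∃ δ > 0, ∀ l ∈ a, δ ≤ N l.1 l.2 := by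
  induction a with
  | nil => exact ⟨1, one_pos, by simp⟩
  | cons l a ih =>
    obtain ⟨δ, h1, h2⟩ := ih fun l hl => ha l (by simp [hl])
    have hl : 0 < N l.1 l.2 :=
      lt_of_le_of_ne (hN.nonneg _ _) fun h => ha l (by simp) (hpos _ _ h.symm)
    refine ⟨min δ (N l.1 l.2), lt_min h1 hl, ?_⟩
    intro m hm
    rcases List.mem_cons.1 hm with rfl | hm
    · exact min_le_right _ _
    · exact (min_le_left _ _).trans (h2 m hm)

lemma WRel.shape {a b : List (Σ i, H i)} {c : ℝ} (h : WRel N a b c) :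
    a.map Sigma.fst = b.map Sigma.fst := by
  induction h with
  | nil => rfl
  | cons i x y a b c0 c1 h hc ih => simp [ih]

lemma WRel.ne_one (hN : NormFam H N) {a b : List (Σ i, H i)} {c : ℝ} (h : WRel N a b c) {δ : ℝ}
    (hcδ : c < δ) (ha : ∀ l ∈ a, δ ≤ N l.1 l.2) : ∀ l ∈ b, l.2 ≠ 1 := by
  induction h with
  | nil => simp
  | cons i x y a b c0 c1 h hc ih =>
    have h0 := WRel.nonneg hN h
    have h1 := hN.nonneg i (x⁻¹ * y)
    intro l hl
    rcases List.mem_cons.1 hl with rfl | hl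
    · rintro (rfl : y = 1)
      have := ha ⟨i, x⟩ (by simp)
      rw [mul_one, hN.inv] at hc
      simp only at this
      linarith
    · exact ih (by linarith) (fun l hl => ha l (by simp [hl])) l hl

/-- The costs of an element of the free product. -/
def costs (N : ∀ i, H i → ℝ) (w : CoprodI H) : Set ℝ :=
  {c | ∃ a b, wprod a = w ∧ wprod b = 1 ∧ WRel N a b c}

/-- The maximal norm on the free product. -/
noncomputable def fnorm (N : ∀ i, H i → ℝ) (w : CoprodI H) : ℝ := sInf (costs N w)

lemma costs_pos (hN : NormFam H N) (hpos : ∀ i x, N i x = 0 → x = 1) {w : CoprodI H}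
    (hw : w ≠ 1) : ∃ δ > 0, ∀ c ∈ costs N w, δ ≤ c := by
  obtain ⟨v, hv, hvw⟩ := exists_red w
  obtain ⟨δ, h1, h2⟩ := exists_delta hN hpos v hv.1
  refine ⟨δ, h1, ?_⟩
  rintro c ⟨a, b, rfl, hb, hab⟩
  by_contra! hc
  obtain ⟨a', b', h3, h4, h5, h6⟩ := reduce_pair hN c _ a b rfl hab hb
  obtain rfl : a' = v := red_unique h3 hv (by rw [h4, hvw])
  have hb' : Red b' := by
    refine ⟨h6.ne_one hN hc h2, ?_⟩
    have := h3.2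
    rw [← List.isChain_map (f := Sigma.fst) (R := fun i j => i ≠ j)] at this ⊢
    rwa [← h6.shape]
  obtain rfl : b' = [] := red_unique hb' ⟨by simp, by simp⟩ (by rw [h5]; rfl)
  cases h6
  exact hw (by rw [← hvw]; rfl)

lemma costs_nonempty (hN : NormFam H N) (w : CoprodI H) : (costs N w).Nonempty := by
  obtain ⟨v, hv, rfl⟩ := exists_red w
  clear hv
  induction v with
  | nil => exact ⟨0, [], [], rfl, rfl, .nil _ le_rfl⟩
  | cons l v ih =>
    obtain ⟨c, a, b, h1, h2, h3⟩ := ih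
    exact ⟨N l.1 l.2 + c, l :: a, ⟨l.1, 1⟩ :: b, by simp [h1], by simp [h2],
      .cons l.1 l.2 1 _ _ _ _ h3 (by simp [hN.inv])⟩

lemma costs_nonneg (hN : NormFam H N) {w : CoprodI H} {c : ℝ} (hc : c ∈ costs N w) : 0 ≤ c := by
  obtain ⟨a, b, -, -, h⟩ := hc
  exact h.nonneg hN

lemma costs_bdd (hN : NormFam H N) (w : CoprodI H) : BddBelow (costs N w) :=
  ⟨0, fun _ hc => costs_nonneg hN hc⟩

lemma fnorm_nonneg (hN : NormFam H N) (w : CoprodI H) : 0 ≤ fnorm N w :=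
  le_csInf (costs_nonempty hN w) fun _ hc => costs_nonneg hN hc

lemma fnorm_one (hN : NormFam H N) : fnorm N (1 : CoprodI H) = 0 :=
  le_antisymm (csInf_le (costs_bdd hN 1) ⟨[], [], rfl, rfl, .nil _ le_rfl⟩) (fnorm_nonneg hN 1)

lemma fnorm_of (hN : NormFam H N) (i : ι) (x : H i) : fnorm N (CoprodI.of x) ≤ N i x :=
  csInf_le (costs_bdd hN _) ⟨[⟨i, x⟩], [⟨i, 1⟩], by simp, by simp,
    .cons i x 1 _ _ 0 _ (.nil _ le_rfl) (by simp [hN.inv])⟩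

lemma fnorm_mul (hN : NormFam H N) (v w : CoprodI H) :
    fnorm N (v * w) ≤ fnorm N v + fnorm N w := by
  have h : ∀ c ∈ costs N v, ∀ c' ∈ costs N w, fnorm N (v * w) ≤ c + c' := by
    rintro c ⟨a, b, h1, h2, h3⟩ c' ⟨a', b', h1', h2', h3'⟩
    exact csInf_le (costs_bdd hN _) ⟨a ++ a', b ++ b', by simp [h1, h1'], by simp [h2, h2'],
      h3.append h3'⟩
  have h2 : ∀ c ∈ costs N v, fnorm N (v * w) - c ≤ fnorm N w := fun c hc =>
    le_csInf (costs_nonempty hN w) fun c' hc' => by linarith [h c hc c' hc']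
  have h3 : fnorm N (v * w) - fnorm N w ≤ fnorm N v :=
    le_csInf (costs_nonempty hN v) fun c hc => by linarith [h2 c hc]
  linarith

lemma fnorm_inv_le (hN : NormFam H N) (w : CoprodI H) : fnorm N w⁻¹ ≤ fnorm N w := by
  refine le_csInf (costs_nonempty hN w) ?_
  rintro c ⟨a, b, h1, h2, h3⟩
  exact csInf_le (costs_bdd hN _) ⟨winv a, winv b, by simp [h1], by simp [h2], h3.winv hN⟩

lemma fnorm_inv (hN : NormFam H N) (w : CoprodI H) : fnorm N w⁻¹ = fnorm N w :=
  le_antisymm (fnorm_inv_le hN w) (by simpa using fnorm_inv_le hN w⁻¹)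

lemma fnorm_conj_le (hN : NormFam H N) (u w : CoprodI H) :
    fnorm N (u * w * u⁻¹) ≤ fnorm N w := by
  refine le_csInf (costs_nonempty hN w) ?_
  rintro c ⟨a, b, h1, h2, h3⟩
  obtain ⟨v, -, rfl⟩ := exists_red u
  exact csInf_le (costs_bdd hN _) ⟨v ++ a ++ winv v, v ++ b ++ winv v, by simp [h1, mul_assoc], by simp [h2],
    (((WRel.refl hN v).append h3).append (WRel.refl hN (winv v))).mono (by simp)⟩

lemma fnorm_conj (hN : NormFam H N) (u w : CoprodI H) :
    fnorm N (u * w * u⁻¹) = fnorm N w := by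
  refine le_antisymm (fnorm_conj_le hN u w) ?_
  have := fnorm_conj_le hN u⁻¹ (u * w * u⁻¹)
  have e : u⁻¹ * (u * w * u⁻¹) * u⁻¹⁻¹ = w := by group
  rwa [e] at this

lemma fnorm_pos (hN : NormFam H N) (hpos : ∀ i x, N i x = 0 → x = 1) {w : CoprodI H}
    (hw : w ≠ 1) : 0 < fnorm N w := by
  obtain ⟨δ, h1, h2⟩ := costs_pos hN hpos hw
  exact h1.trans_le (le_csInf (costs_nonempty hN w) h2)

end

/-- Killing all generators of index at least `m`. -/
noncomputable def rho (m : ℕ) : FreeGroup ℕ →* FreeGroup ℕ :=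
  FreeGroup.lift fun n => if n < m then FreeGroup.of n else 1

lemma rho_eventually (f : FreeGroup ℕ) : ∃ m, ∀ k, m ≤ k → rho k f = f := by
  induction f using FreeGroup.induction_on with
  | C1 => exact ⟨0, by simp⟩
  | of n => exact ⟨n + 1, fun k hk => by simp [rho]; omega⟩
  | inv_of n ih =>
    obtain ⟨m, hm⟩ := ih
    exact ⟨m, fun k hk => by rw [map_inv]; exact congrArg _ (hm k hk)⟩
  | mul x y hx hy =>
    obtain ⟨m, hm⟩ := hx
    obtain ⟨m', hm'⟩ := hy
    refine ⟨max m m', fun k hk => ?_⟩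
    rw [map_mul, hm k (le_trans (le_max_left _ _) hk), hm' k (le_trans (le_max_right _ _) hk)]

lemma rho_ne {f : FreeGroup ℕ} (hf : f ≠ 1) : ∃ m, rho m f ≠ 1 := by
  obtain ⟨m, hm⟩ := rho_eventually f
  exact ⟨m, by rwa [hm m le_rfl]⟩

open Classical in
/-- A conjugation-invariant norm on the free group in which the generators tend to `1`. -/
noncomputable def nF (f : FreeGroup ℕ) : ℝ :=
  if h : ∃ m, rho m f ≠ 1 then 1 / ((Nat.find h : ℝ) + 1) else 0

lemma nF_nonneg (f : FreeGroup ℕ) : 0 ≤ nF f := by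
  unfold nF; split_ifs <;> positivity

lemma nF_one : nF 1 = 0 := by simp [nF]

lemma nF_eq_zero {f : FreeGroup ℕ} (h : nF f = 0) : f = 1 := by
  by_contra hf
  rw [nF, dif_pos (rho_ne hf)] at h
  have : (0 : ℝ) < 1 / ((Nat.find (rho_ne hf) : ℝ) + 1) := by positivity
  exact this.ne' (by convert h)

lemma nF_congr {f g : FreeGroup ℕ} (h : ∀ m, rho m f ≠ 1 ↔ rho m g ≠ 1) : nF f = nF g := by
  have : (fun m => rho m f ≠ 1) = fun m => rho m g ≠ 1 := funext fun m => propext (h m)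
  have key : ∀ p q : ℕ → Prop, p = q → ∀ (hp : DecidablePred p) (hq : DecidablePred q)
      (dp : Decidable (∃ m, p m)) (dq : Decidable (∃ m, q m)),
      (if h : ∃ m, p m then 1 / ((Nat.find h : ℝ) + 1) else 0) =
      (if h : ∃ m, q m then 1 / ((Nat.find h : ℝ) + 1) else 0) := by
    rintro p q rfl hp hq dp dq
    by_cases h : ∃ m, p m
    · rw [dif_pos h, dif_pos h]; congr!
    · rw [dif_neg h, dif_neg h]
  exact key _ _ this _ _ _ _

lemma nF_inv (f : FreeGroup ℕ) : nF f⁻¹ = nF f :=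
  nF_congr fun m => by rw [map_inv]; exact not_congr inv_eq_one

lemma nF_conj (x y : FreeGroup ℕ) : nF (x * y * x⁻¹) = nF y :=
  nF_congr fun m => by rw [map_mul, map_mul, map_inv]; exact not_congr conj_eq_one_iff

lemma le_nF {f : FreeGroup ℕ} {m : ℕ} (h : rho m f ≠ 1) : 1 / ((m : ℝ) + 1) ≤ nF f := by
  classical
  have hex : ∃ m, rho m f ≠ 1 := ⟨m, h⟩
  rw [nF, dif_pos hex]
  have : (Nat.find hex : ℝ) ≤ m := by exact_mod_cast Nat.find_min' hex h
  convert one_div_le_one_div_of_le (by positivity) (add_le_add_left this 1)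

lemma nF_le {f : FreeGroup ℕ} {c : ℝ} (hc : 0 ≤ c) (h : ∀ m, rho m f ≠ 1 → 1 / ((m : ℝ) + 1) ≤ c) :
    nF f ≤ c := by
  unfold nF
  split_ifs with hex
  · exact h _ (Nat.find_spec hex)
  · exact hc

lemma nF_mul (f g : FreeGroup ℕ) : nF (f * g) ≤ nF f + nF g := by
  refine nF_le (add_nonneg (nF_nonneg f) (nF_nonneg g)) fun m hm => ?_
  by_cases hf : rho m f = 1
  · have hg : rho m g ≠ 1 := by simpa [hf] using hm
    linarith [le_nF hg, nF_nonneg f]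
  · linarith [le_nF hf, nF_nonneg g]

lemma nF_of (n : ℕ) : nF (FreeGroup.of n) ≤ 1 / ((n : ℝ) + 1) := by
  refine nF_le (by positivity) fun m hm => ?_
  have hnm : n ≤ m := by
    by_contra h
    exact hm (by simp [rho]; omega)
  have : (n : ℝ) ≤ m := by exact_mod_cast hnm
  exact one_div_le_one_div_of_le (by positivity) (by linarith)

/-- The two factors. -/
def Fam (G : Type) : Bool → Type
  | true => G
  | false => FreeGroup ℕ

instance (G : Type) [Group G] : ∀ b, Group (Fam G b)
  | true => inferInstanceAs (Group G)
  | false => inferInstanceAs (Group (FreeGroup ℕ))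

/-- The norms on the two factors. -/
noncomputable def nFam (G : Type) [Group G] [MetricSpace G] : ∀ b, Fam G b → ℝ
  | true => fun (g : G) => dist g 1
  | false => fun (f : FreeGroup ℕ) => nF f

section
variable {G : Type} [Group G] [MetricSpace G]

lemma gnorm_mul (hbi : BiInvariantDist G) (x y : G) : dist (x * y) 1 ≤ dist x 1 + dist y 1 := by
  have h := dist_triangle (x * y) x 1
  have h1 := (hbi x y 1).1
  rw [mul_one] at h1
  linarith

lemma gnorm_inv (hbi : BiInvariantDist G) (x : G) : dist x⁻¹ 1 = dist x 1 := by
  have h1 := (hbi x x⁻¹ 1).1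
  rw [mul_one, mul_inv_cancel] at h1
  rw [← h1, dist_comm]

lemma gnorm_conj (hbi : BiInvariantDist G) (x y : G) : dist (x * y * x⁻¹) 1 = dist y 1 := by
  have h1 := (hbi x⁻¹ (x * y) x).2
  have h2 := (hbi x y 1).1
  rw [mul_inv_cancel] at h1
  rw [mul_one] at h2
  rw [h1, h2]

lemma normFam (hbi : BiInvariantDist G) : NormFam (Fam G) (nFam G) where
  one := by
    rintro (_ | _)
    · exact nF_one
    · exact dist_self (1 : G)
  nonneg := by
    rintro (_ | _) x
    · exact nF_nonneg x
    · exact dist_nonneg (α := G) (x := x) (y := 1)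
  mul := by
    rintro (_ | _) x y
    · exact nF_mul x y
    · exact gnorm_mul (G := G) hbi x y
  inv := by
    rintro (_ | _) x
    · exact nF_inv x
    · exact gnorm_inv (G := G) hbi x
  conj := by
    rintro (_ | _) x y
    · exact nF_conj x y
    · exact gnorm_conj (G := G) hbi x y

lemma nFam_pos : ∀ b x, nFam G b x = 0 → x = 1 := by
  rintro (_ | _) x h
  · exact nF_eq_zero h
  · exact eq_of_dist_eq_zero (γ := G) (x := x) (y := 1) h

/-- The inclusion of `G`. -/
def iG (G : Type) [Group G] : G →* CoprodI (Fam G) := CoprodI.of (M := Fam G) (i := true)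

/-- The inclusion of the free group. -/
def iF (G : Type) [Group G] : FreeGroup ℕ →* CoprodI (Fam G) := CoprodI.of (M := Fam G) (i := false)

/-- The change of variables `x n = s n * y n`. -/
noncomputable def Phi (s : ℕ → G) : Coprod G (FreeGroup ℕ) →* CoprodI (Fam G) :=
  Coprod.lift (iG G) (FreeGroup.lift fun n => iG G (s n) * iF G (FreeGroup.of n))

/-- The inverse change of variables, on the factors. -/
noncomputable def psiFam (s : ℕ → G) : ∀ b, Fam G b →* Coprod G (FreeGroup ℕ)
  | true => (Coprod.inl : G →* Coprod G (FreeGroup ℕ))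
  | false => (FreeGroup.lift fun n => Coprod.inl (s n)⁻¹ * Coprod.inr (FreeGroup.of n) :
      FreeGroup ℕ →* Coprod G (FreeGroup ℕ))

/-- The inverse change of variables. -/
noncomputable def Psi (s : ℕ → G) : CoprodI (Fam G) →* Coprod G (FreeGroup ℕ) :=
  CoprodI.lift (psiFam s)

omit [MetricSpace G] in
lemma Psi_iG (s : ℕ → G) (g : G) : Psi s (iG G g) = Coprod.inl g :=
  CoprodI.lift_of (M := Fam G) (psiFam s) (i := true) g

omit [MetricSpace G] in
lemma Psi_iF (s : ℕ → G) (f : FreeGroup ℕ) : Psi s (iF G f) =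
    FreeGroup.lift (fun n => Coprod.inl (s n)⁻¹ * Coprod.inr (FreeGroup.of n)) f :=
  CoprodI.lift_of (M := Fam G) (psiFam s) (i := false) f

omit [MetricSpace G] in
lemma Psi_Phi (s : ℕ → G) (w : Coprod G (FreeGroup ℕ)) : Psi s (Phi s w) = w := by
  have : (Psi s).comp (Phi s) = MonoidHom.id _ := by
    apply Coprod.hom_ext
    · ext g
      simp [Phi, Psi_iG]
    · ext n
      simp [Phi, Psi_iG, Psi_iF]
  exact DFunLike.congr_fun this w

omit [MetricSpace G] in
lemma Phi_ne (s : ℕ → G) {w : Coprod G (FreeGroup ℕ)} (hw : w ≠ 1) : Phi s w ≠ 1 := fun h =>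
  hw (by rw [← Psi_Phi s w, h, map_one])

/-- The retraction onto `G`. -/
noncomputable def ret (s : ℕ → G) : Coprod G (FreeGroup ℕ) →* G :=
  Coprod.lift (MonoidHom.id G) (FreeGroup.lift s)

/-- The norm on `G ∗ F_∞`. -/
noncomputable def tnorm (K : ℝ) (s : ℕ → G) (w : Coprod G (FreeGroup ℕ)) : ℝ :=
  max (dist (ret s w) 1) (min K (fnorm (nFam G) (Phi s w)))

variable {K : ℝ} (hK : 0 < K) (hbi : BiInvariantDist G) (s : ℕ → G)
include hK hbi

lemma tnorm_one : tnorm K s 1 = 0 := by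
  simp [tnorm, fnorm_one (normFam hbi), hK.le]

lemma tnorm_mul (v w : Coprod G (FreeGroup ℕ)) :
    tnorm K s (v * w) ≤ tnorm K s v + tnorm K s w := by
  have hv := fnorm_nonneg (normFam hbi) (Phi s v)
  have hw := fnorm_nonneg (normFam hbi) (Phi s w)
  have h1 := fnorm_mul (normFam hbi) (Phi s v) (Phi s w)
  have h2 := gnorm_mul hbi (ret s v) (ret s w)
  unfold tnorm
  rw [map_mul, map_mul]
  refine max_le (h2.trans (add_le_add (le_max_left _ _) (le_max_left _ _))) ?_
  refine le_trans ?_ (add_le_add (le_max_right _ _) (le_max_right _ _))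
  rcases le_total K (fnorm (nFam G) (Phi s v)) with h | h
  · rw [min_eq_left h]
    exact (min_le_left _ _).trans (le_add_of_nonneg_right (le_min hK.le hw))
  · rcases le_total K (fnorm (nFam G) (Phi s w)) with h' | h'
    · rw [min_eq_left h']
      exact (min_le_left _ _).trans (le_add_of_nonneg_left (le_min hK.le hv))
    · rw [min_eq_right h, min_eq_right h']
      exact (min_le_right _ _).trans h1

omit hK in
lemma tnorm_inv (w : Coprod G (FreeGroup ℕ)) : tnorm K s w⁻¹ = tnorm K s w := by
  unfold tnorm
  rw [map_inv, map_inv, gnorm_inv hbi, fnorm_inv (normFam hbi)]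

omit hK in
lemma tnorm_conj (u w : Coprod G (FreeGroup ℕ)) : tnorm K s (u * w * u⁻¹) = tnorm K s w := by
  unfold tnorm
  rw [map_mul, map_mul, map_inv, map_mul, map_mul, map_inv, gnorm_conj hbi,
    fnorm_conj (normFam hbi)]

lemma tnorm_eq_zero {w : Coprod G (FreeGroup ℕ)} (h : tnorm K s w = 0) : w = 1 := by
  by_contra hw
  have h1 := fnorm_pos (normFam hbi) nFam_pos (Phi_ne s hw)
  have : 0 < tnorm K s w := (lt_min hK h1).trans_le (le_max_right _ _)
  exact this.ne' h

omit hK in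
lemma tnorm_inl (g : G) : tnorm K s (Coprod.inl g) = dist g 1 := by
  have h1 : fnorm (nFam G) (Phi s (Coprod.inl g)) ≤ dist g 1 :=
    fnorm_of (normFam hbi) true g
  have h2 : ret s (Coprod.inl g) = g := by simp [ret]
  unfold tnorm
  rw [h2]
  exact max_eq_left ((min_le_right _ _).trans h1)

omit hK in
lemma tnorm_y (n : ℕ) :
    tnorm K s ((Coprod.inl (s n))⁻¹ * Coprod.inr (FreeGroup.of n)) ≤ 1 / ((n : ℝ) + 1) := by
  have h1 : Phi s ((Coprod.inl (s n))⁻¹ * Coprod.inr (FreeGroup.of n)) = iF G (FreeGroup.of n) := by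
    simp [Phi]
  have h2 : ret s ((Coprod.inl (s n))⁻¹ * Coprod.inr (FreeGroup.of n)) = 1 := by
    simp [ret]
  have h3 : fnorm (nFam G) (iF G (FreeGroup.of n)) ≤ nF (FreeGroup.of n) :=
    fnorm_of (normFam hbi) false (FreeGroup.of n)
  unfold tnorm
  rw [h1, h2, dist_self]
  exact max_le (by positivity) ((min_le_right _ _).trans (h3.trans (nF_of n)))

omit hbi hK in
lemma tnorm_le (hbdd : ∀ x y : G, dist x y ≤ K) (w : Coprod G (FreeGroup ℕ)) : tnorm K s w ≤ K :=
  max_le (hbdd _ _) (min_le_left _ _)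

/-- The metric on `G ∗ F_∞`. -/
noncomputable def tmetric : MetricSpace (Coprod G (FreeGroup ℕ)) where
  dist x y := tnorm K s (x⁻¹ * y)
  dist_self x := by simpa using tnorm_one hK hbi s
  dist_comm x y := by
    change tnorm K s (x⁻¹ * y) = tnorm K s (y⁻¹ * x)
    rw [← tnorm_inv hbi]; simp
  dist_triangle x y z := by
    change tnorm K s (x⁻¹ * z) ≤ tnorm K s (x⁻¹ * y) + tnorm K s (y⁻¹ * z)
    have := tnorm_mul hK hbi s (x⁻¹ * y) (y⁻¹ * z)
    simpa [mul_assoc] using this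
  eq_of_dist_eq_zero {x y} h := by
    exact (inv_mul_eq_one.1 (tnorm_eq_zero hK hbi s h))

lemma approx (hs : ∀ g : G, ∀ ε > 0, ∃ n, dist g (s n) < ε ∧ 1 / ((n : ℝ) + 1) < ε)
    (w : Coprod G (FreeGroup ℕ)) :
    ∀ ε > 0, ∃ f : FreeGroup ℕ, tnorm K s (w⁻¹ * Coprod.inr f) < ε := by
  induction w using Coprod.induction_on with
  | inl g =>
    intro ε hε
    obtain ⟨n, h1, h2⟩ := hs g (ε / 2) (by positivity)
    refine ⟨FreeGroup.of n, ?_⟩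
    have h3 := tnorm_mul hK hbi s (Coprod.inl (g⁻¹ * s n))
      ((Coprod.inl (s n))⁻¹ * Coprod.inr (FreeGroup.of n))
    have h4 := tnorm_y (K := K) hbi s n
    rw [tnorm_inl hbi] at h3
    have h5 := (hbi g (g⁻¹ * s n) 1).1
    rw [mul_one, mul_inv_cancel_left, dist_comm] at h5
    have e : (Coprod.inl (g⁻¹ * s n) : Coprod G (FreeGroup ℕ)) *
        ((Coprod.inl (s n))⁻¹ * Coprod.inr (FreeGroup.of n)) =
        (Coprod.inl g)⁻¹ * Coprod.inr (FreeGroup.of n) := by simp [mul_assoc]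
    rw [e] at h3
    linarith
  | inr f =>
    intro ε hε
    exact ⟨f, by simpa [tnorm_one hK hbi] using hε⟩
  | mul v w hv hw =>
    intro ε hε
    obtain ⟨f, hf⟩ := hv (ε / 2) (by positivity)
    obtain ⟨f', hf'⟩ := hw (ε / 2) (by positivity)
    refine ⟨f * f', ?_⟩
    have h1 := tnorm_mul hK hbi s (w⁻¹ * Coprod.inr f') ((Coprod.inr f')⁻¹ * (v⁻¹ * Coprod.inr f)
      * (Coprod.inr f')⁻¹⁻¹)
    rw [tnorm_conj hbi] at h1
    have e : w⁻¹ * Coprod.inr f' * ((Coprod.inr f')⁻¹ * (v⁻¹ * Coprod.inr f)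
      * (Coprod.inr f')⁻¹⁻¹) = (v * w)⁻¹ * Coprod.inr (f * f') := by simp [mul_assoc]
    rw [e] at h1
    linarith

end

lemma exists_seq (G : Type) [Group G] [MetricSpace G] [TopologicalSpace.SeparableSpace G] :
    ∃ s : ℕ → G, ∀ g : G, ∀ ε > 0, ∃ n, dist g (s n) < ε ∧ 1 / ((n : ℝ) + 1) < ε := by
  refine ⟨fun n => TopologicalSpace.denseSeq G n.unpair.1, fun g ε hε => ?_⟩
  obtain ⟨k, hk⟩ := (TopologicalSpace.denseRange_denseSeq G).exists_dist_lt g hε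
  obtain ⟨m, hm⟩ := exists_nat_one_div_lt hε
  refine ⟨Nat.pair k m, by simpa using hk, lt_of_le_of_lt ?_ hm⟩
  have : (m : ℝ) ≤ Nat.pair k m := by exact_mod_cast Nat.right_le_pair k m
  exact one_div_le_one_div_of_le (by positivity) (by linarith)

end FreeNorm

/-- The bounded version of the dense-free-factor theorem: if the bi-invariant
metric of a separable group `G` is bounded by `K > 0`, then the extension to `G ∗ F_∞` can be
taken bounded by `K` as well. -/
theorem exists_dense_free_factor_bounded (K : ℝ) (hK : 0 < K)
    (G : Type) [Group G] [MetricSpace G]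
    (hbi : BiInvariantDist G) (hbdd : ∀ x y : G, dist x y ≤ K)
    (hsep : TopologicalSpace.SeparableSpace G) :
    ∃ _ : MetricSpace (Monoid.Coprod G (FreeGroup ℕ)),
      BiInvariantDist (Monoid.Coprod G (FreeGroup ℕ)) ∧
      (∀ x y : Monoid.Coprod G (FreeGroup ℕ), dist x y ≤ K) ∧
      Isometry ⇑(Monoid.Coprod.inl : G →* Monoid.Coprod G (FreeGroup ℕ)) ∧
      Dense (Set.range ⇑(Monoid.Coprod.inr : FreeGroup ℕ →* Monoid.Coprod G (FreeGroup ℕ))) := by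
  obtain ⟨s, hs⟩ := FreeNorm.exists_seq G
  refine ⟨FreeNorm.tmetric hK hbi s, ?_⟩
  letI := FreeNorm.tmetric hK hbi s
  have hd : ∀ x y : Monoid.Coprod G (FreeGroup ℕ),
      dist x y = FreeNorm.tnorm K s (x⁻¹ * y) := fun _ _ => rfl
  refine ⟨?_, ?_, ?_, ?_⟩
  · intro g x y
    constructor
    · rw [hd, hd]; congr 1; group
    · rw [hd, hd, ← FreeNorm.tnorm_conj hbi s g⁻¹ (x⁻¹ * y)]; congr 1; group
  · intro x y
    rw [hd]
    exact FreeNorm.tnorm_le s hbdd _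
  · refine Isometry.of_dist_eq fun x y => ?_
    rw [hd, ← map_inv, ← map_mul, FreeNorm.tnorm_inl hbi, dist_comm x y]
    have := (hbi x (x⁻¹ * y) 1).1
    rw [mul_one, mul_inv_cancel_left] at this
    exact this.symm
  · rw [Metric.dense_iff]
    intro w ε hε
    obtain ⟨f, hf⟩ := FreeNorm.approx hK hbi s hs w ε hε
    refine ⟨Monoid.Coprod.inr f, ?_, ⟨f, rfl⟩⟩
    rw [Metric.mem_ball, dist_comm, hd]
    exact hf
end

section
/- For every separable metric group (G, d_G), where d_G is a bi-invariant metric, there exists a separable metric group (H, d_H), where d_H is bi-invariant and the metric topology of (H, d_H) is locally compact, such that there is no isometric group monomorphism from H into G. -/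
open scoped Quaternion

namespace LCNE

noncomputable section

/-- The unit quaternion `cos t + i sin t`. -/
def qi (t : ℝ) : ℍ[ℝ] := ⟨Real.cos t, Real.sin t, 0, 0⟩

/-- The unit quaternion `cos t + j sin t`. -/
def qj (t : ℝ) : ℍ[ℝ] := ⟨Real.cos t, 0, Real.sin t, 0⟩

@[simp] lemma qi_re (t : ℝ) : (qi t).re = Real.cos t := rfl
@[simp] lemma qi_imI (t : ℝ) : (qi t).imI = Real.sin t := rfl
@[simp] lemma qi_imJ (t : ℝ) : (qi t).imJ = 0 := rfl
@[simp] lemma qi_imK (t : ℝ) : (qi t).imK = 0 := rfl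
@[simp] lemma qj_re (t : ℝ) : (qj t).re = Real.cos t := rfl
@[simp] lemma qj_imI (t : ℝ) : (qj t).imI = 0 := rfl
@[simp] lemma qj_imJ (t : ℝ) : (qj t).imJ = Real.sin t := rfl
@[simp] lemma qj_imK (t : ℝ) : (qj t).imK = 0 := rfl

lemma qi_add (s t : ℝ) : qi (s + t) = qi s * qi t := by
  ext <;> simp [Real.cos_add, Real.sin_add] <;> try ring

lemma qj_add (s t : ℝ) : qj (s + t) = qj s * qj t := by
  ext <;> simp [Real.cos_add, Real.sin_add] <;> try ring

lemma qi_zero : qi 0 = 1 := by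
  ext <;> simp

lemma qj_zero : qj 0 = 1 := by
  ext <;> simp

lemma norm_sub_one_sq_aux (q : ℍ[ℝ]) : ‖q‖ ^ 2 = q.re ^ 2 + q.imI ^ 2 + q.imJ ^ 2 + q.imK ^ 2 := by
  rw [sq, ← Quaternion.normSq_eq_norm_mul_self, Quaternion.normSq_def']

lemma norm_eq_one_of_sq {q : ℍ[ℝ]} (h : ‖q‖ ^ 2 = 1) : ‖q‖ = 1 := by
  have := norm_nonneg q
  nlinarith

lemma norm_qi (t : ℝ) : ‖qi t‖ = 1 := by
  apply norm_eq_one_of_sq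
  rw [norm_sub_one_sq_aux]; simp

lemma norm_qj (t : ℝ) : ‖qj t‖ = 1 := by
  apply norm_eq_one_of_sq
  rw [norm_sub_one_sq_aux]; simp

lemma trig_aux (t : ℝ) : (Real.cos t - 1) ^ 2 + Real.sin t ^ 2 ≤ t ^ 2 := by
  have h1 := Real.one_sub_sq_div_two_le_cos (x := t)
  have h2 := Real.sin_sq_add_cos_sq t
  nlinarith

lemma norm_qi_sub (t : ℝ) : ‖qi t - 1‖ ≤ |t| := by
  apply abs_le_of_sq_le_sq' _ (abs_nonneg t) |>.2
  rw [norm_sub_one_sq_aux, sq_abs]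
  have := trig_aux t
  simpa using this

lemma norm_qj_sub (t : ℝ) : ‖qj t - 1‖ ≤ |t| := by
  apply abs_le_of_sq_le_sq' _ (abs_nonneg t) |>.2
  rw [norm_sub_one_sq_aux, sq_abs]
  have := trig_aux t
  simpa using this

/-- `qi t` as a unit. -/
def ui (t : ℝ) : (ℍ[ℝ])ˣ where
  val := qi t
  inv := qi (-t)
  val_inv := by rw [← qi_add, add_neg_cancel, qi_zero]
  inv_val := by rw [← qi_add, neg_add_cancel, qi_zero]

/-- `qj t` as a unit. -/
def uj (t : ℝ) : (ℍ[ℝ])ˣ where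
  val := qj t
  inv := qj (-t)
  val_inv := by rw [← qj_add, add_neg_cancel, qj_zero]
  inv_val := by rw [← qj_add, neg_add_cancel, qj_zero]

lemma ui_pow (t : ℝ) (k : ℕ) : ui t ^ k = ui (k * t) := by
  induction k with
  | zero => ext1; simp [ui, qi_zero]
  | succ k ih =>
    rw [pow_succ, ih]; ext1
    simp only [ui, Units.val_mul]
    rw [← qi_add]; push_cast; congr 1; ring

lemma uj_pow (t : ℝ) (k : ℕ) : uj t ^ k = uj (k * t) := by
  induction k with
  | zero => ext1; simp [uj, qj_zero]
  | succ k ih =>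
    rw [pow_succ, ih]; ext1
    simp only [uj, Units.val_mul]
    rw [← qj_add]; push_cast; congr 1; ring

abbrev F := FreeGroup Bool

/-- The scale `16 ^ (n + 1)`. -/
def L (n : ℕ) : ℕ := 16 ^ (n + 1)

lemma L_pos (n : ℕ) : (0 : ℝ) < L n := by simp [L]

/-- Angle at level `n`. -/
def th (n : ℕ) : ℝ := Real.pi / 2 / L n

lemma th_pos (n : ℕ) : 0 < th n := div_pos (by positivity) (L_pos n)

lemma th_le (n : ℕ) : L n * th n ≤ 2 := by
  have := (L_pos n).ne'
  have h := Real.pi_le_four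
  unfold th; rw [mul_div_cancel₀ _ this]; linarith

/-- The representation at level `n`. -/
def rho (n : ℕ) : F →* (ℍ[ℝ])ˣ := FreeGroup.lift (fun b => if b then ui (th n) else uj (th n))

lemma norm_rho (n : ℕ) (x : F) : ‖(rho n x : ℍ[ℝ])‖ = 1 := by
  induction x using FreeGroup.induction_on with
  | C1 => simp
  | of b => cases b <;> simp [rho, ui, uj, norm_qi, norm_qj]
  | inv_of b _ => cases b <;> simp [rho, ui, uj, norm_qi, norm_qj, Units.inv_mk]
  | mul x y hx hy => simp [hx, hy]

/-- The scaled pseudometric at level `n`. -/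
def E (n : ℕ) (x y : F) : ℝ := L n * ‖(rho n x : ℍ[ℝ]) - rho n y‖

lemma E_nonneg (n : ℕ) (x y : F) : 0 ≤ E n x y := by unfold E; positivity

lemma E_self (n : ℕ) (x : F) : E n x x = 0 := by simp [E]

lemma E_comm (n : ℕ) (x y : F) : E n x y = E n y x := by simp [E, norm_sub_rev]

lemma E_tri (n : ℕ) (x y z : F) : E n x z ≤ E n x y + E n y z := by
  unfold E
  rw [← mul_add]
  exact mul_le_mul_of_nonneg_left (norm_sub_le_norm_sub_add_norm_sub _ _ _) (L_pos n).le

lemma E_left (n : ℕ) (g x y : F) : E n (g * x) (g * y) = E n x y := by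
  simp [E, ← mul_sub, norm_rho]

lemma E_right (n : ℕ) (g x y : F) : E n (x * g) (y * g) = E n x y := by
  simp [E, ← sub_mul, norm_rho]

lemma E_of (n : ℕ) (b : Bool) : E n (FreeGroup.of b) 1 ≤ 2 := by
  refine le_trans ?_ (th_le n)
  unfold E
  refine mul_le_mul_of_nonneg_left ?_ (L_pos n).le
  cases b
  · simpa [rho, uj, abs_of_pos (th_pos n)] using norm_qj_sub (th n)
  · simpa [rho, ui, abs_of_pos (th_pos n)] using norm_qi_sub (th n)

lemma E_bdd_one (x : F) : ∃ C, ∀ n, E n x 1 ≤ C := by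
  induction x using FreeGroup.induction_on with
  | C1 => exact ⟨0, fun n => (E_self n 1).le⟩
  | of b => exact ⟨2, fun n => E_of n b⟩
  | inv_of b _ =>
    refine ⟨2, fun n => ?_⟩
    have h := E_left n (FreeGroup.of b) (FreeGroup.of b)⁻¹ 1
    rw [mul_inv_cancel, mul_one, E_comm] at h
    change E n (FreeGroup.of b)⁻¹ 1 ≤ 2
    rw [← h]; exact E_of n b
  | mul x y hx hy =>
    obtain ⟨C, hC⟩ := hx
    obtain ⟨C', hC'⟩ := hy
    refine ⟨C' + C, fun n => ?_⟩
    have h1 := E_tri n (x * y) x 1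
    have h2 := E_left n x y 1
    rw [mul_one] at h2
    linarith [hC n, hC' n]

lemma E_bdd (x y : F) : ∃ C, ∀ n, E n x y ≤ C := by
  obtain ⟨C, hC⟩ := E_bdd_one x
  obtain ⟨C', hC'⟩ := E_bdd_one y
  refine ⟨C + C', fun n => ?_⟩
  have := E_tri n x 1 y
  rw [E_comm n 1 y] at this
  linarith [hC n, hC' n]

open Classical in
/-- `E` restricted to levels in `A`. -/
def EA (A : Set ℕ) (n : ℕ) (x y : F) : ℝ := if n ∈ A then E n x y else 0

lemma EA_nonneg (A : Set ℕ) (n : ℕ) (x y : F) : 0 ≤ EA A n x y := by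
  unfold EA; split_ifs <;> simp [E_nonneg]

lemma EA_le (A : Set ℕ) (n : ℕ) (x y : F) : EA A n x y ≤ E n x y := by
  unfold EA; split_ifs <;> simp [E_nonneg]

lemma EA_bdd (A : Set ℕ) (x y : F) : BddAbove (Set.range fun n => EA A n x y) := by
  obtain ⟨C, hC⟩ := E_bdd x y
  refine ⟨C, ?_⟩
  rintro _ ⟨n, rfl⟩
  exact (EA_le A n x y).trans (hC n)

/-- The supremum pseudometric. -/
def P (A : Set ℕ) (x y : F) : ℝ := ⨆ n, EA A n x y

lemma le_P (A : Set ℕ) (n : ℕ) (x y : F) : EA A n x y ≤ P A x y := le_ciSup (EA_bdd A x y) n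

lemma P_nonneg (A : Set ℕ) (x y : F) : 0 ≤ P A x y := (EA_nonneg A 0 x y).trans (le_P A 0 x y)

open Classical in
/-- The metric. -/
def D (A : Set ℕ) (x y : F) : ℝ := P A x y + if x = y then 0 else 1

lemma D_self (A : Set ℕ) (x : F) : D A x x = 0 := by
  simp [D, P, EA, E_self]

lemma D_comm (A : Set ℕ) (x y : F) : D A x y = D A y x := by
  simp [D, P, EA, E_comm _ x y, eq_comm (a := x)]

lemma P_tri (A : Set ℕ) (x y z : F) : P A x z ≤ P A x y + P A y z := by
  refine ciSup_le fun n => ?_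
  refine le_trans ?_ (add_le_add (le_P A n x y) (le_P A n y z))
  unfold EA; split_ifs
  · exact E_tri n x y z
  · simp

lemma D_tri (A : Set ℕ) (x y z : F) : D A x z ≤ D A x y + D A y z := by
  have := P_tri A x y z
  unfold D
  by_cases h1 : x = y
  · subst h1; simp [P, EA, E_self]
  · simp only [h1, if_false]
    split_ifs <;> linarith

lemma D_ge (A : Set ℕ) {x y : F} (h : x ≠ y) : 1 ≤ D A x y := by
  have := P_nonneg A x y
  simp [D, h, this]

lemma D_left (A : Set ℕ) (g x y : F) : D A (g * x) (g * y) = D A x y := by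
  simp [D, P, EA, E_left]

lemma D_right (A : Set ℕ) (g x y : F) : D A (x * g) (y * g) = D A x y := by
  simp [D, P, EA, E_right]

/-- The metric space structure. -/
@[reducible] def met (A : Set ℕ) : MetricSpace F where
  dist := D A
  dist_self := D_self A
  dist_comm := D_comm A
  dist_triangle := D_tri A
  eq_of_dist_eq_zero := by
    intro x y h
    by_contra hne
    have := D_ge A hne
    change D A x y = 0 at h
    linarith

/-- The test words. -/
def w (n : ℕ) : F :=
  FreeGroup.of true ^ L n * FreeGroup.of false ^ L n *
    (FreeGroup.of true ^ L n)⁻¹ * (FreeGroup.of false ^ L n)⁻¹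

lemma rho_w (m n : ℕ) : rho m (w n) = ui (L n * th m) * uj (L n * th m) *
    (ui (L n * th m))⁻¹ * (uj (L n * th m))⁻¹ := by
  simp [w, rho, ui_pow, uj_pow]

lemma E_w_self (n : ℕ) : E n (w n) 1 = 2 * L n := by
  have h : (L n : ℝ) * th n = Real.pi / 2 := by
    unfold th; rw [mul_div_cancel₀ _ (L_pos n).ne']
  have h2 : (rho n (w n) : ℍ[ℝ]) = -1 := by
    rw [rho_w, h]
    simp only [Units.val_mul, ui, uj, Units.inv_mk]
    ext <;> simp
  unfold E
  rw [h2, map_one, Units.val_one]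
  have : ‖(-1 - 1 : ℍ[ℝ])‖ = 2 := by
    rw [← neg_add', norm_neg, one_add_one_eq_two]
    rw [show (2 : ℍ[ℝ]) = ((2 : ℝ) : ℍ[ℝ]) from rfl, Quaternion.norm_coe]; norm_num
  rw [this]; ring

lemma comm_norm (x y x' y' : ℍ[ℝ]) (hx : x * x' = 1) (hy : y * y' = 1)
    (hx1 : ‖x'‖ = 1) (hy1 : ‖y'‖ = 1) :
    ‖x * y * x' * y' - 1‖ ≤ 2 * (‖x - 1‖ * ‖y - 1‖) := by
  have hx2 : x' * x = 1 := mul_eq_one_comm.mp hx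
  have e : x * y * x' * y' - 1 = ((x - 1) * (y - 1) - (y - 1) * (x - 1)) * x' * y' := by
    have : ((x - 1) * (y - 1) - (y - 1) * (x - 1)) = x * y - y * x := by noncomm_ring
    rw [this, sub_mul, sub_mul, mul_assoc y x x', hx, mul_one, hy]
  rw [e, norm_mul, norm_mul, hx1, hy1, mul_one, mul_one]
  refine (norm_sub_le _ _).trans ?_
  rw [norm_mul, norm_mul]; linarith [mul_comm ‖x - 1‖ ‖y - 1‖]

lemma L_lt {m n : ℕ} (h : m < n) : 16 * (L m : ℝ) ≤ L n := by
  have : 16 * L m ≤ L n := by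
    unfold L
    calc 16 * 16 ^ (m + 1) = 16 ^ (m + 1 + 1) := by ring
      _ ≤ 16 ^ (n + 1) := Nat.pow_le_pow_right (by norm_num) (by omega)
  exact_mod_cast this

lemma E_w_ne {m n : ℕ} (h : m ≠ n) : E m (w n) 1 ≤ L n / 2 := by
  rcases lt_or_gt_of_ne h with h | h
  · have h1 := L_lt h
    have h2 : ‖(rho m (w n) : ℍ[ℝ]) - rho m 1‖ ≤ 2 := by
      refine (norm_sub_le _ _).trans ?_
      rw [norm_rho, norm_rho]; norm_num
    unfold E
    have := mul_le_mul_of_nonneg_left h2 (L_pos m).le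
    linarith [L_pos n]
  · have h1 := L_lt h
    have hm := L_pos m
    have hn := L_pos n
    set s := (L n : ℝ) * th m with hs
    have hs0 : 0 ≤ s := mul_nonneg hn.le (th_pos m).le
    have hsm : L m * s ≤ 2 * L n := by
      have := mul_le_mul_of_nonneg_left (th_le m) hn.le
      rw [hs]; linarith
    have h2 : ‖(rho m (w n) : ℍ[ℝ]) - rho m 1‖ ≤ 2 * (s * s) := by
      rw [rho_w, map_one]
      simp only [Units.val_mul, ui, uj, Units.inv_mk, Units.val_one]
      refine (comm_norm (qi s) (qj s) (qi (-s)) (qj (-s)) (ui s).val_inv (uj s).val_inv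
        (norm_qi _) (norm_qj _)).trans ?_
      have a1 := norm_qi_sub s
      have a2 := norm_qj_sub s
      rw [abs_of_nonneg hs0] at a1 a2
      gcongr
    unfold E
    have h3 := mul_le_mul_of_nonneg_left h2 hm.le
    have hs8 : s ≤ 1 / 8 := by
      by_contra hc
      push Not at hc
      nlinarith
    have h5 := mul_le_mul_of_nonneg_right hsm hs0
    nlinarith

lemma P_w_not (A : Set ℕ) (n : ℕ) (h : n ∉ A) : P A (w n) 1 ≤ L n / 2 := by
  refine ciSup_le fun m => ?_
  unfold EA
  split_ifs with hm
  · exact E_w_ne (by rintro rfl; exact h hm)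
  · have := L_pos n; positivity

lemma D_w_not (A : Set ℕ) (n : ℕ) (h : n ∉ A) : D A (w n) 1 ≤ L n / 2 + 1 := by
  have := P_w_not A n h
  unfold D
  split_ifs <;> linarith

lemma D_w_mem (A : Set ℕ) (n : ℕ) (h : n ∈ A) : 2 * L n ≤ D A (w n) 1 := by
  have h1 := le_P A n (w n) 1
  rw [EA, if_pos h, E_w_self] at h1
  unfold D
  split_ifs <;> linarith

section G
variable {G : Type} [Group G] [MetricSpace G]

lemma dist_mul_le (hbi : BiInvariantDist G) (x y x' y' : G) :
    dist (x * y) (x' * y') ≤ dist x x' + dist y y' := by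
  have := dist_triangle (x * y) (x' * y) (x' * y')
  rwa [(hbi y x x').2, (hbi x' y y').1] at this

lemma dist_inv_eq (hbi : BiInvariantDist G) (x y : G) : dist x⁻¹ y⁻¹ = dist x y := by
  rw [← (hbi x x⁻¹ y⁻¹).1, ← (hbi y (x * x⁻¹) (x * y⁻¹)).2]
  simp [dist_comm]

lemma dist_pow_le (hbi : BiInvariantDist G) (x y : G) (k : ℕ) :
    dist (x ^ k) (y ^ k) ≤ k * dist x y := by
  induction k with
  | zero => simp
  | succ k ih =>
    rw [pow_succ, pow_succ]
    refine (dist_mul_le hbi _ _ _ _).trans ?_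
    push_cast; linarith

lemma key (hbi : BiInvariantDist G) (A B : Set ℕ) (f g : F →* G)
    (hf : ∀ x y, dist (f x) (f y) = D A x y) (hg : ∀ x y, dist (g x) (g y) = D B x y)
    (h : ∀ b, dist (f (FreeGroup.of b)) (g (FreeGroup.of b)) ≤ 1 / 8) (n : ℕ)
    (hA : n ∈ A) : n ∈ B := by
  by_contra hB
  have h1 := D_w_mem A n hA
  have h2 := D_w_not B n hB
  rw [← hf, map_one] at h1
  rw [← hg, map_one] at h2
  have hp : ∀ b, dist (f (FreeGroup.of b) ^ L n) (g (FreeGroup.of b) ^ L n) ≤ L n * (1 / 8) :=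
    fun b => (dist_pow_le hbi _ _ _).trans (mul_le_mul_of_nonneg_left (h b) (L_pos n).le)
  have h3 : dist (f (w n)) (g (w n)) ≤ L n / 2 := by
    simp only [w, map_mul, map_inv, map_pow]
    refine (dist_mul_le hbi _ _ _ _).trans ?_
    have e1 := dist_mul_le hbi (f (FreeGroup.of true) ^ L n * f (FreeGroup.of false) ^ L n)
      (f (FreeGroup.of true) ^ L n)⁻¹ (g (FreeGroup.of true) ^ L n * g (FreeGroup.of false) ^ L n)
      (g (FreeGroup.of true) ^ L n)⁻¹
    have e2 := dist_mul_le hbi (f (FreeGroup.of true) ^ L n) (f (FreeGroup.of false) ^ L n)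
      (g (FreeGroup.of true) ^ L n) (g (FreeGroup.of false) ^ L n)
    rw [dist_inv_eq hbi] at e1 ⊢
    linarith [hp true, hp false]
  have h4 := dist_triangle (f (w n)) (g (w n)) 1
  have h5 : (16 : ℝ) ≤ L n := by
    have : 16 ≤ L n := by
      unfold L; rw [pow_succ]; have := Nat.one_le_pow n 16 (by norm_num); omega
    exact_mod_cast this
  linarith

end G

lemma countable_F : Countable F := by
  unfold F FreeGroup; infer_instance

end

end LCNE

/-- For every separable group `G` with bi-invariant metric there is a
separable group `H` with bi-invariant metric whose metric topology is locally compact such that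
`H` admits no isometric group monomorphism into `G`. -/
theorem exists_locally_compact_not_embeddable (G : Type) [Group G] [MetricSpace G]
    (hbi : BiInvariantDist G) (hsep : TopologicalSpace.SeparableSpace G) :
    ∃ (H : Type) (_ : Group H) (_ : MetricSpace H),
      BiInvariantDist H ∧ TopologicalSpace.SeparableSpace H ∧ LocallyCompactSpace H ∧
      ¬∃ f : H →* G, Function.Injective f ∧ Isometry f := by
  by_contra hcon
  have hex : ∀ A : Set ℕ, ∃ f : LCNE.F →* G, ∀ x y, dist (f x) (f y) = LCNE.D A x y := by
    intro A
    by_contra hno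
    apply hcon
    let _ := LCNE.met A
    have := LCNE.countable_F
    have : DiscreteTopology LCNE.F :=
      DiscreteTopology.of_forall_le_dist (r := 1) one_pos (fun x y hxy => LCNE.D_ge A hxy)
    refine ⟨LCNE.F, inferInstance, LCNE.met A,
      fun g x y => ⟨LCNE.D_left A g x y, LCNE.D_right A g x y⟩, inferInstance, inferInstance, ?_⟩
    rintro ⟨f, -, hf⟩
    exact hno ⟨f, fun x y => hf.dist_eq x y⟩
  choose f hf using hex
  have : Nonempty G := ⟨1⟩
  have hd := TopologicalSpace.denseRange_denseSeq G
  have hk : ∀ (A : Set ℕ) (b : Bool), ∃ k,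
      dist (f A (FreeGroup.of b)) (TopologicalSpace.denseSeq G k) < 1 / 16 :=
    fun A b => hd.exists_dist_lt _ (by norm_num)
  choose k hk using hk
  have hinj : Function.Injective k := by
    intro A B hAB
    have hclose : ∀ b, dist (f A (FreeGroup.of b)) (f B (FreeGroup.of b)) ≤ 1 / 8 := by
      intro b
      have h1 := hk A b
      have h2 := hk B b
      rw [hAB] at h1
      have := dist_triangle_right (f A (FreeGroup.of b)) (f B (FreeGroup.of b))
        (TopologicalSpace.denseSeq G (k B b))
      linarith
    ext n
    exact ⟨LCNE.key hbi A B _ _ (hf A) (hf B) hclose n,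
      LCNE.key hbi B A _ _ (hf B) (hf A) (fun b => by rw [dist_comm]; exact hclose b) n⟩
  have : Countable (Set ℕ) := hinj.countable
  obtain ⟨e, he⟩ := exists_injective_nat (Set ℕ)
  exact Function.cantor_injective e he
end

section
/- There is no separable metric group with a bi-invariant metric into which every locally compact separable metric group with a bi-invariant metric admits an isometric group monomorphism; that is, for every separable group G with bi-invariant metric d_G there exists a locally compact separable group H with bi-invariant metric d_H admitting no isometric group monomorphism into G. -/
namespace NoUniv

abbrev Lt := Fin 3 × Bool

/-- Admissible cost of a block `P` of letters of the same sign. -/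
def Cost (A : Set ℕ) (P : List Lt) (c : ℕ) : Prop :=
  P.length ≤ c ∨ ∃ k ∈ A, (∀ i, (P.map Prod.fst).count i ≤ 2 * 4 ^ k) ∧ 5 * 4 ^ k ≤ c

/-- Words generated by planar insertion of cancelling pairs (free) and blocks (at a cost). -/
inductive Good (A : Set ℕ) : List Lt → ℕ → Prop
  | nil : Good A [] 0
  | pair (L R : List Lt) (x : Fin 3) (b : Bool) (c : ℕ) (h : Good A (L ++ R) c) :
      Good A (L ++ [(x, b), (x, !b)] ++ R) c
  | block (L P R : List Lt) (b : Bool) (c d : ℕ) (h : Good A (L ++ R) c)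
      (hP : ∀ x ∈ P, x.2 = b) (hc : Cost A P d) : Good A (L ++ P ++ R) (c + d)

variable {A : Set ℕ}

lemma Cost.of_subperm {P Q : List Lt} {c : ℕ} (h : Cost A P c) (hs : List.Subperm Q P) :
    Cost A Q c := by
  rcases h with h | ⟨k, hk, h, hc⟩
  · exact Or.inl (hs.length_le.trans h)
  · refine Or.inr ⟨k, hk, fun i => le_trans ?_ (h i), hc⟩
    obtain ⟨l, hl, hl'⟩ := hs
    rw [← (hl.map Prod.fst).count_eq i]
    exact (hl'.map Prod.fst).count_le i

lemma Good.subst {W : List Lt} {c : ℕ} (h : Good A W c) :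
    ∀ (L R B : List Lt) (y : Fin 3) (s : Bool) (d : ℕ), W = L ++ (y, s) :: R →
      (∀ x ∈ B, x.2 = !s) → Cost A ((y, !s) :: B) d → Good A (L ++ B ++ R) (c + d) := by
  induction h with
  | nil => intro L R B y s d hW; simp at hW
  | pair L' R' x b c h ih =>
    intro L R B y s d hW hB hd
    rw [List.append_assoc, List.append_eq_append_iff] at hW
    rcases hW with ⟨T, rfl, hT⟩ | ⟨T, rfl, hT⟩
    · match T, hT with
      | [], hT =>
        simp at hT
        obtain ⟨⟨rfl, rfl⟩, rfl⟩ := hT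
        have := Good.block L' (B ++ [(x, !b)]) R' (!b) c d h
          (by intro z hz; simp at hz; rcases hz with hz | rfl
              · exact hB z hz
              · rfl)
          (hd.of_subperm (by
            exact (List.perm_append_singleton _ _).subperm))
        simpa using this
      | [t], hT =>
        simp at hT
        obtain ⟨rfl, ⟨rfl, rfl⟩, rfl⟩ := hT
        have := Good.block L' ((x, !s) :: B) R' (!s) c d h
          (by intro z hz; simp at hz; rcases hz with rfl | hz
              · rfl
              · simpa using hB z hz)
          (by simpa using hd)
        simpa using this
      | t :: t' :: T', hT =>
        simp at hT
        obtain ⟨rfl, rfl, rfl⟩ := hT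
        have := Good.pair L' (T' ++ B ++ R) x b _ (by
          simpa using ih (L' ++ T') R B y s d (by simp) hB hd)
        simpa using this
    · match T, hT with
      | [], hT =>
        simp at hT
        obtain ⟨⟨rfl, rfl⟩, rfl⟩ := hT
        have := Good.block L (B ++ [(y, !s)]) R' (!s) c d (by simpa using h)
          (by intro z hz; simp at hz; rcases hz with hz | rfl
              · exact hB z hz
              · rfl)
          (hd.of_subperm (by
            exact (List.perm_append_singleton _ _).subperm))
        simpa using this
      | t :: T', hT =>
        simp at hT
        obtain ⟨rfl, rfl⟩ := hT
        have := Good.pair (L ++ B ++ T') R' x b _ (by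
          simpa using ih L (T' ++ R') B y s d (by simp) hB hd)
        simpa using this
  | block L' P R' b c e h hP he ih =>
    intro L R B y s d hW hB hd
    rw [List.append_assoc, List.append_eq_append_iff] at hW
    have key : ∀ T S, P = T ++ (y, s) :: S → Good A (L' ++ T ++ B ++ S ++ R') (c + e + d) := by
      rintro T S rfl
      have h1 := Good.block L' (T ++ S) R' b c e h
        (by intro z hz; apply hP; simp at hz ⊢; tauto)
        (he.of_subperm (by
          apply List.Sublist.subperm
          simp))
      have h2 := Good.block (L' ++ T) B (S ++ R') (!s) (c + e) d (by simpa using h1) hB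
        (hd.of_subperm (List.sublist_cons_self _ _).subperm)
      simpa using h2
    rcases hW with ⟨T, rfl, hT⟩ | ⟨T, rfl, hT⟩
    · rw [List.append_eq_append_iff] at hT
      rcases hT with ⟨T', rfl, hT⟩ | ⟨S, rfl, hT⟩
      · subst hT
        have := Good.block L' P (T' ++ B ++ R) b (c + d) e (by
          simpa using ih (L' ++ T') R B y s d (by simp) hB hd) hP he
        rw [show c + e + d = c + d + e by ring]
        simpa using this
      · match S, hT with
        | [], hT =>
          simp at hT
          subst hT
          have := Good.block L' T (B ++ R) b (c + d) e (by
            simpa using ih L' R B y s d (by simp) hB hd) (by simpa using hP) (by simpa using he)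
          rw [show c + e + d = c + d + e by ring]
          simpa using this
        | t :: S, hT =>
          simp at hT
          obtain ⟨rfl, rfl⟩ := hT
          simpa using key T S rfl
    · match T, hT with
      | [], hT =>
        match P, hT with
        | [], hT =>
          simp at hT
          subst hT
          have := Good.block L [] (B ++ R) b (c + d) e (by
            simpa using ih L R B y s d (by simp) hB hd) (by simp) he
          rw [show c + e + d = c + d + e by ring]
          simpa using this
        | p :: P, hT =>
          simp at hT
          obtain ⟨rfl, rfl⟩ := hT
          simpa using key [] P rfl
      | t :: T', hT =>
        simp at hT
        obtain ⟨rfl, rfl⟩ := hT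
        have := Good.block (L ++ B ++ T') P R' b (c + d) e (by
          simpa using ih L (T' ++ R') B y s d (by simp) hB hd) hP he
        rw [show c + e + d = c + d + e by ring]
        simpa using this

lemma Good.reduce {W : List Lt} {c : ℕ} (h : Good A W c) :
    ∀ (L R : List Lt) (x : Fin 3) (s : Bool), W = L ++ (x, s) :: (x, !s) :: R →
      Good A (L ++ R) c := by
  induction h with
  | nil => intro L R x s hW; simp at hW
  | pair L' R' y b c h ih =>
    intro L R x s hW
    rw [List.append_assoc, List.append_eq_append_iff] at hW
    rcases hW with ⟨T, rfl, hT⟩ | ⟨T, rfl, hT⟩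
    · match T, hT with
      | [], hT =>
        simp at hT
        obtain ⟨⟨rfl, rfl⟩, _, rfl⟩ := hT
        simpa using h
      | [t], hT =>
        simp at hT
        obtain ⟨rfl, ⟨rfl, rfl⟩, rfl⟩ := hT
        simpa using h
      | t :: t' :: T', hT =>
        simp at hT
        obtain ⟨rfl, rfl, rfl⟩ := hT
        have := Good.pair L' (T' ++ R) y b _ (by
          simpa using ih (L' ++ T') R x s (by simp))
        simpa using this
    · match T, hT with
      | [], hT =>
        simp at hT
        obtain ⟨⟨rfl, rfl⟩, _, rfl⟩ := hT
        simpa using h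
      | [t], hT =>
        simp at hT
        obtain ⟨rfl, ⟨rfl, rfl⟩, rfl⟩ := hT
        simpa using h
      | t :: t' :: T', hT =>
        simp at hT
        obtain ⟨rfl, rfl, rfl⟩ := hT
        have := Good.pair (L ++ T') R' y b _ (by
          simpa using ih L (T' ++ R') x s (by simp))
        simpa using this
  | block L' P R' b c e h hP he ih =>
    intro L R x s hW
    rw [List.append_assoc, List.append_eq_append_iff] at hW
    have key : ∀ P', P = (x, !s) :: P' → L' = L ++ [(x, s)] → R = P' ++ R' →
        Good A (L ++ R) (c + e) := by
      rintro P' rfl rfl rfl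
      have hb : (!s) = b := hP (x, !s) (by simp)
      have := h.subst L R' P' x s e (by simp)
        (by intro z hz; rw [hb]; exact hP z (by simp [hz])) he
      simpa using this
    rcases hW with ⟨T, rfl, hT⟩ | ⟨T, rfl, hT⟩
    · rw [List.append_eq_append_iff] at hT
      rcases hT with ⟨T', rfl, hT⟩ | ⟨S, rfl, hT⟩
      · subst hT
        have := Good.block L' P (T' ++ R) b c e (by
          simpa using ih (L' ++ T') R x s (by simp)) hP he
        simpa using this
      · match S, hT with
        | [], hT =>
          simp at hT
          subst hT
          have := Good.block L' T R b c e (by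
            simpa using ih L' R x s (by simp)) (by simpa using hP) (by simpa using he)
          simpa using this
        | [t], hT =>
          simp at hT
          obtain ⟨rfl, rfl⟩ := hT
          have hb : s = b := hP (x, s) (by simp)
          have := h.subst L' R T x (!s) e (by simp)
            (by intro z hz; rw [Bool.not_not, hb]; exact hP z (by simp [hz]))
            (he.of_subperm (by
              rw [Bool.not_not]
              exact (List.perm_append_singleton _ _).symm.subperm))
          simpa using this
        | t :: t' :: S, hT =>
          simp at hT
          obtain ⟨rfl, rfl, rfl⟩ := hT
          have h1 := hP (x, s) (by simp)
          have h2 := hP (x, !s) (by simp)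
          simp at h1 h2
          cases s <;> simp_all
    · match T, hT with
      | [], hT =>
        match P, hT with
        | [], hT =>
          simp at hT
          subst hT
          have := Good.block L [] R b c e (by
            simpa using ih L R x s (by simp)) (by simp) he
          simpa using this
        | [p], hT =>
          simp at hT
          obtain ⟨rfl, rfl⟩ := hT
          have hb : s = b := hP (x, s) (by simp)
          have := h.subst L R [] x (!s) e (by simp)
            (by simp) (by simpa using he)
          simpa using this
        | t :: t' :: S, hT =>
          simp at hT
          obtain ⟨rfl, rfl, rfl⟩ := hT
          have h1 := hP (x, s) (by simp)
          have h2 := hP (x, !s) (by simp)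
          simp at h1 h2
          cases s <;> simp_all
      | [t], hT =>
        simp at hT
        obtain ⟨rfl, hT⟩ := hT
        match P, hT with
        | [], hT =>
          simp at hT
          subst hT
          have := Good.block L [] R b c e (by
            simpa using ih L R x s (by simp)) (by simp) he
          simpa using this
        | p :: P, hT =>
          simp at hT
          obtain ⟨rfl, rfl⟩ := hT
          exact key P rfl rfl rfl
      | t :: t' :: T', hT =>
        simp at hT
        obtain ⟨rfl, rfl, rfl⟩ := hT
        have := Good.block (L ++ T') P R' b c e (by
          simpa using ih L (T' ++ R') x s (by simp)) hP he
        simpa using this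

lemma Good.red {W V : List Lt} {c : ℕ} (h : Good A W c) (r : FreeGroup.Red W V) :
    Good A V c := by
  induction r with
  | refl => exact h
  | tail _ s ih =>
    cases s with
    | not => exact ih.reduce _ _ _ _ rfl

lemma Good.append {W V : List Lt} {c d : ℕ} (h : Good A W c) (h' : Good A V d) :
    Good A (W ++ V) (c + d) := by
  induction h with
  | nil => simpa using h'
  | pair L R x b c h ih =>
    have := Good.pair L (R ++ V) x b _ (by simpa using ih)
    simpa using this
  | block L P R b c e h hP he ih =>
    have := Good.block L P (R ++ V) b _ e (by simpa using ih) hP he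
    rw [show c + e + d = c + d + e by ring]
    simpa using this

lemma Good.conj1 {W : List Lt} {c : ℕ} (h : Good A W c) (x : Fin 3) (b : Bool) :
    Good A ((x, b) :: W ++ [(x, !b)]) c := by
  induction h with
  | nil => simpa using Good.pair [] [] x b 0 Good.nil
  | pair L R y s c h ih =>
    have := Good.pair ((x, b) :: L) (R ++ [(x, !b)]) y s _ (by simpa using ih)
    simpa using this
  | block L P R s c e h hP he ih =>
    have := Good.block ((x, b) :: L) P (R ++ [(x, !b)]) s _ e (by simpa using ih) hP he
    simpa using this

lemma Good.conj {W : List Lt} {c : ℕ} (h : Good A W c) (U : List Lt) :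
    Good A (U ++ W ++ FreeGroup.invRev U) c := by
  induction U with
  | nil => simpa [FreeGroup.invRev] using h
  | cons u U ih =>
    have := ih.conj1 u.1 u.2
    simpa [FreeGroup.invRev] using this

lemma Good.inv {W : List Lt} {c : ℕ} (h : Good A W c) : Good A (FreeGroup.invRev W) c := by
  induction h with
  | nil => exact Good.nil
  | pair L R y s c h ih =>
    have := Good.pair (FreeGroup.invRev R) (FreeGroup.invRev L) y s c
      (by simpa [FreeGroup.invRev] using ih)
    simpa [FreeGroup.invRev] using this
  | block L P R s c e h hP he ih =>
    have := Good.block (FreeGroup.invRev R) (FreeGroup.invRev P) (FreeGroup.invRev L) (!s) c e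
      (by simpa [FreeGroup.invRev] using ih)
      (by
        intro z hz
        simp only [FreeGroup.invRev, List.mem_reverse, List.mem_map] at hz
        obtain ⟨a, hz, rfl⟩ := hz
        simp [hP _ hz])
      (by
        have e1 : (List.map Prod.fst (FreeGroup.invRev P)) = (P.map Prod.fst).reverse := by
          simp [FreeGroup.invRev, Function.comp_def]
        unfold Cost at he ⊢
        simpa [e1] using he)
    simpa [FreeGroup.invRev] using this

lemma Good.zero {W : List Lt} {c : ℕ} (h : Good A W c) (hc : c = 0) :
    FreeGroup.mk W = 1 := by
  induction h with
  | nil => rfl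
  | pair L R y s c h ih =>
    rw [← ih hc]
    apply Quot.sound
    simp
  | block L P R s c e h hP he ih =>
    have : P = [] := by
      rcases he with he | ⟨k, _, _, hk⟩
      · exact List.length_eq_zero_iff.mp (by omega)
      · have : 0 < 4 ^ k := by positivity
        omega
    subst this
    simpa using ih (by omega)

lemma Good.exists (W : List Lt) : Good A W W.length := by
  induction W with
  | nil => exact Good.nil
  | cons u U ih =>
    have := Good.block [] [u] U u.2 _ 1 (by simpa using ih) (by simp) (Or.inl (by simp))
    simpa using this

lemma Cost.missing {P : List Lt} {d : ℕ} (h : Cost A P d) (i : Fin 3) (s : Bool)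
    (hs : ∀ x ∈ P, x.2 = s) (hi : (i, s) ∉ P) : P.length ≤ d := by
  rcases h with h | ⟨k, _, h, hk⟩
  · exact h
  have hc : P.length = ∑ j : Fin 3, (P.map Prod.fst).count j := by
    have := (Multiset.sum_count_eq_card (s := Finset.univ) (m := ((P.map Prod.fst : List (Fin 3)) : Multiset (Fin 3))) (by simp))
    simpa using this.symm
  have h0 : (P.map Prod.fst).count i = 0 := by
    rw [List.count_eq_zero]
    intro hm
    obtain ⟨z, hz, rfl⟩ := List.mem_map.mp hm
    apply hi
    rw [← hs z hz]; exact hz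
  rw [Fin.sum_univ_three] at hc
  have := h 0; have := h 1; have := h 2
  fin_cases i <;> simp at h0 <;> omega

lemma Cost.lower {P : List Lt} {d N : ℕ} (h : Cost A P d) (hN : N ∉ A)
    (hl : P.length ≤ 6 * 4 ^ N) : 4 * P.length ≤ 4 * d + 4 ^ N := by
  rcases h with h | ⟨k, hkA, h, hk⟩
  · omega
  have hc : P.length = ∑ j : Fin 3, (P.map Prod.fst).count j := by
    have := (Multiset.sum_count_eq_card (s := Finset.univ) (m := ((P.map Prod.fst : List (Fin 3)) : Multiset (Fin 3))) (by simp))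
    simpa using this.symm
  rw [Fin.sum_univ_three] at hc
  have := h 0; have := h 1; have := h 2
  rcases lt_trichotomy k N with hlt | rfl | hlt
  · have : 4 ^ (k + 1) ≤ 4 ^ N := Nat.pow_le_pow_right (by norm_num) hlt
    rw [pow_succ] at this
    omega
  · exact absurd hkA hN
  · have : 4 ^ (N + 1) ≤ 4 ^ k := Nat.pow_le_pow_right (by norm_num) hlt
    rw [pow_succ] at this
    omega

lemma Good.missing {W : List Lt} {c : ℕ} (h : Good A W c) (i : Fin 3)
    (hs : ∀ x ∈ W, x.2 = true) (hi : (i, true) ∉ W) : W.length ≤ c := by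
  induction h with
  | nil => simp
  | pair L R y s c h ih =>
    have h1 := hs (y, s) (by simp)
    have h2 := hs (y, !s) (by simp)
    simp at h1 h2
    simp_all
  | block L P R s c e h hP he ih =>
    have h1 := ih (by intro x hx; apply hs; simp at hx ⊢; tauto)
      (by intro hx; apply hi; simp at hx ⊢; tauto)
    have h2 := he.missing i true (by intro x hx; apply hs; simp; tauto)
      (by intro hx; apply hi; simp; tauto)
    simp at h1 ⊢
    omega

lemma Good.lower {W : List Lt} {c N : ℕ} (h : Good A W c) (hN : N ∉ A)
    (hs : ∀ x ∈ W, x.2 = true) (hW : W.Pairwise (fun x y => x.1 ≤ y.1))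
    (hl : W.length ≤ 6 * 4 ^ N) : 4 * W.length ≤ 4 * c + 4 ^ N := by
  induction h with
  | nil => simp
  | pair L R y s c h ih =>
    have h1 := hs (y, s) (by simp)
    have h2 := hs (y, !s) (by simp)
    simp at h1 h2
    simp_all
  | block L P R s c e h hP he ih =>
    have hsub : List.Sublist (L ++ R) (L ++ P ++ R) := by simp
    have hs' : ∀ x ∈ L ++ R, x.2 = true := fun x hx => hs x (hsub.subset hx)
    have hsP : ∀ x ∈ P, x.2 = true := by intro x hx; apply hs; simp; tauto
    have hlen : (L ++ P ++ R).length = (L ++ R).length + P.length := by simp; omega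
    by_cases hm : ((0 : Fin 3), true) ∈ P ∧ ((2 : Fin 3), true) ∈ P
    · have h1 := h.missing 1 hs' (by
        intro hx
        rw [List.pairwise_append, List.pairwise_append] at hW
        obtain ⟨⟨_, _, hLP⟩, _, hPR⟩ := hW
        rcases List.mem_append.mp hx with hx | hx
        · have := hLP _ hx _ hm.1
          simp at this
        · have := hPR _ (List.mem_append_right _ hm.2) _ hx
          revert this; decide)
      have h2 := he.lower hN (by omega)
      omega
    · have h2 : P.length ≤ e := by
        by_cases h0 : ((0 : Fin 3), true) ∈ P
        · exact he.missing 2 true hsP (fun h => hm ⟨h0, h⟩)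
        · exact he.missing 0 true hsP h0
      have h1 := ih hs' (hW.sublist hsub) (by omega)
      omega

/-- The norm. -/
noncomputable def nu (A : Set ℕ) (g : FreeGroup (Fin 3)) : ℕ :=
  sInf {c | ∃ W, FreeGroup.mk W = g ∧ Good A W c}

lemma nu_spec (A : Set ℕ) (g : FreeGroup (Fin 3)) :
    ∃ W, FreeGroup.mk W = g ∧ Good A W (nu A g) :=
  Nat.sInf_mem (s := {c | ∃ W, FreeGroup.mk W = g ∧ Good A W c})
    ⟨_, g.toWord, FreeGroup.mk_toWord, Good.exists _⟩

lemma nu_le {W : List Lt} {c : ℕ} (h : Good A W c) : nu A (FreeGroup.mk W) ≤ c :=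
  Nat.sInf_le ⟨W, rfl, h⟩

lemma nu_one : nu A 1 = 0 := Nat.le_zero.mp (nu_le Good.nil)

lemma nu_eq_zero {g : FreeGroup (Fin 3)} (h : nu A g = 0) : g = 1 := by
  obtain ⟨W, rfl, hW⟩ := nu_spec A g
  exact hW.zero h

lemma nu_mul (g h : FreeGroup (Fin 3)) : nu A (g * h) ≤ nu A g + nu A h := by
  obtain ⟨W, hg, hW⟩ := nu_spec A g
  obtain ⟨V, hh, hV⟩ := nu_spec A h
  have := nu_le (hW.append hV)
  rwa [← FreeGroup.mul_mk, hg, hh] at this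

lemma nu_inv_le (g : FreeGroup (Fin 3)) : nu A g⁻¹ ≤ nu A g := by
  obtain ⟨W, hg, hW⟩ := nu_spec A g
  have := nu_le hW.inv
  rwa [← FreeGroup.inv_mk, hg] at this

lemma nu_inv (g : FreeGroup (Fin 3)) : nu A g⁻¹ = nu A g :=
  le_antisymm (nu_inv_le g) (by simpa using nu_inv_le (A := A) g⁻¹)

lemma nu_conj_le (g u : FreeGroup (Fin 3)) : nu A (u * g * u⁻¹) ≤ nu A g := by
  obtain ⟨W, hg, hW⟩ := nu_spec A g
  have := nu_le (hW.conj u.toWord)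
  rwa [← FreeGroup.mul_mk, ← FreeGroup.mul_mk, ← FreeGroup.inv_mk, hg, FreeGroup.mk_toWord] at this

lemma nu_conj (g u : FreeGroup (Fin 3)) : nu A (u * g * u⁻¹) = nu A g := by
  refine le_antisymm (nu_conj_le g u) ?_
  have := nu_conj_le (A := A) (u * g * u⁻¹) u⁻¹
  simpa [mul_assoc] using this

/-- The metric. -/
@[reducible]
noncomputable def met (A : Set ℕ) : MetricSpace (FreeGroup (Fin 3)) where
  dist g h := (nu A (g⁻¹ * h) : ℝ)
  dist_self g := by simp [nu_one]
  dist_comm g h := by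
    rw [← nu_inv]; simp
  dist_triangle g h k := by
    have := nu_mul (A := A) (g⁻¹ * h) (h⁻¹ * k)
    rw [show g⁻¹ * h * (h⁻¹ * k) = g⁻¹ * k by group] at this
    exact_mod_cast this
  eq_of_dist_eq_zero {g h} hd := by
    have : nu A (g⁻¹ * h) = 0 := by exact_mod_cast hd
    have := nu_eq_zero this
    exact (inv_mul_eq_one.mp this)

lemma met_dist (A : Set ℕ) (g h : FreeGroup (Fin 3)) :
    (met A).dist g h = (nu A (g⁻¹ * h) : ℝ) := rfl

lemma met_bi (A : Set ℕ) : @BiInvariantDist (FreeGroup (Fin 3)) _ (met A) := by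
  intro g x y
  constructor
  · change (nu A _ : ℝ) = nu A _
    congr 2; group
  · change (nu A _ : ℝ) = nu A _
    rw [← nu_conj (x⁻¹ * y) g⁻¹]
    congr 2; group

lemma met_discrete (A : Set ℕ) :
    @DiscreteTopology (FreeGroup (Fin 3)) (met A).toPseudoMetricSpace.toUniformSpace.toTopologicalSpace := by
  let _ := met A
  refine DiscreteTopology.of_forall_le_dist (r := 1) one_pos ?_
  intro x y hxy
  change (1 : ℝ) ≤ (nu A (x⁻¹ * y) : ℝ)
  have : nu A (x⁻¹ * y) ≠ 0 := fun h => hxy (inv_mul_eq_one.mp (nu_eq_zero h))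
  exact_mod_cast Nat.one_le_iff_ne_zero.mpr this

def wl (n : ℕ) : List Lt :=
  List.replicate n (0, true) ++ List.replicate n (1, true) ++ List.replicate n (2, true)

lemma mk_replicate (n : ℕ) (i : Fin 3) :
    FreeGroup.mk (List.replicate n (i, true)) = FreeGroup.of i ^ n := by
  rw [← FreeGroup.toWord_of_pow, FreeGroup.mk_toWord]

lemma mk_wl (n : ℕ) : FreeGroup.mk (wl n) =
    FreeGroup.of (0 : Fin 3) ^ n * FreeGroup.of 1 ^ n * FreeGroup.of 2 ^ n := by
  rw [wl, ← FreeGroup.mul_mk, ← FreeGroup.mul_mk, mk_replicate, mk_replicate, mk_replicate]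

lemma wl_true (n : ℕ) : ∀ x ∈ wl n, x.2 = true := by
  intro x hx
  simp [wl, List.mem_replicate] at hx
  rcases hx with ⟨_, rfl⟩ | ⟨_, rfl⟩ | ⟨_, rfl⟩ <;> rfl

lemma wl_sorted (n : ℕ) : (wl n).Pairwise (fun x y => x.1 ≤ y.1) := by
  simp only [wl, List.pairwise_append, List.pairwise_replicate, List.mem_append, List.mem_replicate]
  refine ⟨⟨by simp, by simp, ?_⟩, by simp, ?_⟩
  · rintro a ⟨_, rfl⟩ b ⟨_, rfl⟩; decide
  · rintro a (⟨_, rfl⟩ | ⟨_, rfl⟩) b ⟨_, rfl⟩ <;> decide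

lemma wl_reduced (n : ℕ) : FreeGroup.reduce (wl n) = wl n := by
  rw [← FreeGroup.isReduced_iff_reduce_eq]
  unfold FreeGroup.IsReduced
  apply List.Pairwise.isChain
  exact List.Pairwise.imp_of_mem (R := fun _ _ => True)
    (fun {a b} ha hb _ _ => by rw [wl_true n a ha, wl_true n b hb])
    (List.pairwise_of_forall fun _ _ => trivial)

lemma nu_upper {k : ℕ} (hk : k ∈ A) : nu A (FreeGroup.mk (wl (2 * 4 ^ k))) ≤ 5 * 4 ^ k := by
  have := Good.block (A := A) [] (wl (2 * 4 ^ k)) [] true 0 (5 * 4 ^ k) Good.nil (wl_true _)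
    (Or.inr ⟨k, hk, by
      intro i
      fin_cases i <;> simp [wl, List.count_replicate], le_rfl⟩)
  simpa using nu_le this

lemma nu_lower {k : ℕ} (hk : k ∉ A) :
    23 * 4 ^ k ≤ 4 * nu A (FreeGroup.mk (wl (2 * 4 ^ k))) := by
  obtain ⟨W, hg, hW⟩ := nu_spec A (FreeGroup.mk (wl (2 * 4 ^ k)))
  have h1 : Good A (wl (2 * 4 ^ k)) (nu A (FreeGroup.mk (wl (2 * 4 ^ k)))) := by
    refine hW.red ?_
    have := FreeGroup.reduce.red (L := W)
    rwa [FreeGroup.reduce.eq_of_red (FreeGroup.Red.refl) , ← FreeGroup.toWord_mk, hg, FreeGroup.toWord_mk, wl_reduced] at this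
  have hlen : (wl (2 * 4 ^ k)).length = 6 * 4 ^ k := by simp [wl]; ring
  have := h1.lower hk (wl_true _) (wl_sorted _) hlen.le
  omega

section target
variable {G : Type} [Group G] [MetricSpace G]

lemma dist_mul_le (hG : BiInvariantDist G) (x y x' y' : G) :
    dist (x * y) (x' * y') ≤ dist x x' + dist y y' := by
  calc _ ≤ dist (x * y) (x' * y) + dist (x' * y) (x' * y') := dist_triangle _ _ _
    _ = _ := by rw [(hG y x x').2, (hG x' y y').1]

lemma dist_pow_le (hG : BiInvariantDist G) (x x' : G) (n : ℕ) :
    dist (x ^ n) (x' ^ n) ≤ n * dist x x' := by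
  induction n with
  | zero => simp
  | succ n ih =>
    rw [pow_succ, pow_succ]
    have := dist_mul_le hG (x ^ n) x (x' ^ n) x'
    push_cast; linarith

lemma contra (hG : BiInvariantDist G) (A B : Set ℕ) (f g : FreeGroup (Fin 3) →* G)
    (hf : ∀ w, dist (f w) 1 = nu A w) (hg : ∀ w, dist (g w) 1 = nu B w)
    (hd : ∀ i, dist (f (FreeGroup.of i)) (g (FreeGroup.of i)) ≤ 1 / 10) : A ⊆ B := by
  intro k hk
  by_contra hkB
  have h1 := nu_upper hk
  have h2 := nu_lower hkB
  set w := FreeGroup.mk (wl (2 * 4 ^ k)) with hw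
  have h3 : dist (f w) (g w) ≤ (6 * 4 ^ k) * (1 / 10) := by
    rw [hw, mk_wl]
    simp only [map_mul, map_pow]
    have e1 := fun i => dist_pow_le hG (f (FreeGroup.of i)) (g (FreeGroup.of i)) (2 * 4 ^ k)
    have e2 := fun i => mul_le_mul_of_nonneg_left (hd i) (Nat.cast_nonneg (α := ℝ) (2 * 4 ^ k))
    have e3 := dist_mul_le hG (f (FreeGroup.of 0) ^ (2 * 4 ^ k) * f (FreeGroup.of 1) ^ (2 * 4 ^ k))
      (f (FreeGroup.of 2) ^ (2 * 4 ^ k)) (g (FreeGroup.of 0) ^ (2 * 4 ^ k) * g (FreeGroup.of 1) ^ (2 * 4 ^ k))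
      (g (FreeGroup.of 2) ^ (2 * 4 ^ k))
    have e4 := dist_mul_le hG (f (FreeGroup.of 0) ^ (2 * 4 ^ k)) (f (FreeGroup.of 1) ^ (2 * 4 ^ k))
      (g (FreeGroup.of 0) ^ (2 * 4 ^ k)) (g (FreeGroup.of 1) ^ (2 * 4 ^ k))
    have a0 := e1 0; have a1 := e1 1; have a2 := e1 2
    have b0 := e2 0; have b1 := e2 1; have b2 := e2 2
    push_cast at *
    linarith
  have h4 : dist (g w) 1 ≤ dist (f w) (g w) + dist (f w) 1 := by
    rw [dist_comm (f w) (g w)]; exact dist_triangle _ _ _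
  rw [hf, hg] at h4
  have h1' : (nu A w : ℝ) ≤ 5 * 4 ^ k := by exact_mod_cast h1
  have h2' : (23 : ℝ) * 4 ^ k ≤ 4 * nu B w := by exact_mod_cast h2
  have : (0 : ℝ) < 4 ^ k := by positivity
  linarith

end target

lemma main (G : Type) (_ : Group G) (_ : MetricSpace G)
    (hG : BiInvariantDist G) (hsep : TopologicalSpace.SeparableSpace G) :
    ∃ A : Set ℕ, ¬ ∃ f : FreeGroup (Fin 3) →* G, ∀ w, dist (f w) 1 = nu A w := by
  by_contra hcon
  push Not at hcon
  choose f hf using hcon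
  let F : Set ℕ → (Fin 3 → G) := fun A i => f A (FreeGroup.of i)
  have hne : Nonempty (Fin 3 → G) := ⟨fun _ => 1⟩
  have hex : ∀ A, ∃ n, dist (F A) (TopologicalSpace.denseSeq (Fin 3 → G) n) < 1 / 20 := by
    intro A
    obtain ⟨n, hy⟩ := (TopologicalSpace.denseRange_denseSeq (Fin 3 → G)).exists_dist_lt
      (F A) (show (0 : ℝ) < 1 / 20 by norm_num)
    exact ⟨n, hy⟩
  choose N hN using hex
  refine Function.cantor_injective N ?_
  have key : ∀ A B, N A = N B → A ⊆ B := by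
    intro A B h
    refine contra hG A B (f A) (f B) (hf A) (hf B) ?_
    intro i
    have h1 := hN A
    have h2 := hN B
    rw [← h] at h2
    have h3 := dist_triangle_right (F A) (F B) (TopologicalSpace.denseSeq (Fin 3 → G) (N A))
    have h4 := dist_le_pi_dist (F A) (F B) i
    change dist (F A i) (F B i) ≤ _
    linarith
  intro A B h
  exact Set.Subset.antisymm (key A B h) (key B A h.symm)

lemma second (G : Type) (iG : Group G) (mG : MetricSpace G)
    (hG : BiInvariantDist G) (hsep : TopologicalSpace.SeparableSpace G) :
    ∃ (H : Type) (_ : Group H) (_ : MetricSpace H),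
        BiInvariantDist H ∧ TopologicalSpace.SeparableSpace H ∧ LocallyCompactSpace H ∧
        ¬∃ f : H →* G, Function.Injective f ∧ Isometry f := by
  obtain ⟨A, hA⟩ := main G iG mG hG hsep
  let _ := met A
  have := met_discrete A
  refine ⟨FreeGroup (Fin 3), inferInstance, met A, met_bi A, ?_, inferInstance, ?_⟩
  · have : Countable (FreeGroup (Fin 3)) := Function.Injective.countable FreeGroup.toWord_injective
    infer_instance
  · rintro ⟨f, _, hf⟩
    apply hA
    refine ⟨f, fun w => ?_⟩
    rw [← map_one f, hf.dist_eq, dist_comm]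
    change (nu A _ : ℝ) = _
    simp

end NoUniv

/-- There is no separable group with bi-invariant metric into which every
locally compact separable group with bi-invariant metric embeds isometrically; equivalently,
for every separable `G` with bi-invariant metric there is a locally compact separable group `H`
with bi-invariant metric admitting no isometric group monomorphism into `G`. -/
theorem no_metrically_universal_group :
    (¬∃ (G : Type) (_ : Group G) (_ : MetricSpace G),
        BiInvariantDist G ∧ TopologicalSpace.SeparableSpace G ∧
        ∀ (H : Type) (_ : Group H) (_ : MetricSpace H),
          BiInvariantDist H → TopologicalSpace.SeparableSpace H → LocallyCompactSpace H →
          ∃ f : H →* G, Function.Injective f ∧ Isometry f) ∧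
    ∀ (G : Type) (_ : Group G) (_ : MetricSpace G),
      BiInvariantDist G → TopologicalSpace.SeparableSpace G →
      ∃ (H : Type) (_ : Group H) (_ : MetricSpace H),
        BiInvariantDist H ∧ TopologicalSpace.SeparableSpace H ∧ LocallyCompactSpace H ∧
        ¬∃ f : H →* G, Function.Injective f ∧ Isometry f := by
  refine ⟨?_, NoUniv.second⟩
  rintro ⟨G, iG, mG, hG, hsep, hall⟩
  obtain ⟨H, iH, mH, h1, h2, h3, h4⟩ := NoUniv.second G iG mG hG hsep
  exact h4 (hall H iH mH h1 h2 h3)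
end
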